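/- arXiv:1707.01013 — 7 statements merged into one kernel-verified Lean document; each statement's English description precedes it below -/
import Mathlib

section
/- Let β ∈ (1, β_T], where β_T is the unique root of x³ − x² − 2x + 1 = 0 in the interval (1,2) (β_T ≈ 1.80194). Then every x ∈ (0, 1/(β−1)) has a simply normal β-expansion, i.e., there exists a sequence (ε_i)_{i≥1} ∈ {0,1}^ℕ with x = Σ_{i=1}^∞ ε_i β^{-i} and lim_{n→∞} #{1 ≤ i ≤ n : ε_i = 0}/n = 1/2. -/
/-- `ε` (indexed from 0, representing `ε_{i+1}`) is a β-expansion of `x`: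
all digits are in {0,1} and `x = Σ_{i≥1} ε_i β^{-i}`. -/
def isExpansion (β x : ℝ) (ε : ℕ → ℕ) : Prop :=
  (∀ i, ε i ≤ 1) ∧ x = ∑' i : ℕ, (ε i : ℝ) / β ^ (i + 1)

/-- A {0,1}-sequence is simply normal if the frequency of zeros tends to 1/2. -/
def simplyNormal (ε : ℕ → ℕ) : Prop :=
  Filter.Tendsto
    (fun n => (((Finset.range n).filter fun i => ε i = 0).card : ℝ) / n)
    Filter.atTop (nhds (1 / 2))

/-- Parameters of the digit-selection strategy (in the symmetric coordinate `y = 2x - E`). -/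
structure Par where
  β : ℝ
  p : ℝ
  q : ℝ
  c : ℝ
  s : ℝ
  E : ℝ
  C : ℝ
  θ : ℝ
  K : ℕ
  hβ : 1 < β
  hp : β * p = 1 - p
  hq : β * q = 1 + p
  hc : β * c = 1 - q
  hs : β * s = E - 1
  hE : β * E = E + 1
  hcs : c ≤ s
  hC : 0 < C
  hCpc : C < p - c
  hCp : C < p
  hCqp : C ≤ q - p
  hθ : 0 < θ
  hθs : θ ≤ s
  hθC : β ^ 2 * θ ≤ C
  hqE : q < E
  hK : E - q ≤ β * θ * β ^ K

/-- The digit `+1` is allowed at position `y` with current digit sum `S`. -/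
def AP (P : Par) (y : ℝ) (S : ℤ) : Prop :=
  (P.c < y ∧ 0 ≤ y) ∨ (|y| ≤ P.c ∧
    ((0 ≤ S ∧ P.θ ≤ (y + P.s) * P.β ^ S.toNat) ∨ (S < 0 ∧ (P.s - y) * P.β ^ (-S).toNat < P.θ)))

theorem AP_total (P : Par) (y : ℝ) (S : ℤ) : AP P y S ∨ AP P (-y) (-S) := by
  unfold AP
  rcases le_or_gt |y| P.c with h | h
  · rcases lt_trichotomy S 0 with hS | hS | hS
    · rcases lt_or_ge ((P.s - y) * P.β ^ (-S).toNat) P.θ with h1 | h1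
      · exact Or.inl (Or.inr ⟨h, Or.inr ⟨hS, h1⟩⟩)
      · refine Or.inr (Or.inr ⟨by rwa [abs_neg], Or.inl ⟨by omega, ?_⟩⟩)
        rw [neg_add_eq_sub]; exact h1
    · subst hS
      have := P.hθs
      rcases le_total 0 y with h0 | h0
      · exact Or.inl (Or.inr ⟨h, Or.inl ⟨le_rfl, by simp; linarith⟩⟩)
      · exact Or.inr (Or.inr ⟨by rwa [abs_neg], Or.inl ⟨by simp, by simp; linarith⟩⟩)
    · rcases le_or_gt P.θ ((y + P.s) * P.β ^ S.toNat) with h1 | h1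
      · exact Or.inl (Or.inr ⟨h, Or.inl ⟨hS.le, h1⟩⟩)
      · refine Or.inr (Or.inr ⟨by rwa [abs_neg], Or.inr ⟨by omega, ?_⟩⟩)
        rw [sub_neg_eq_add, neg_neg, add_comm]; exact h1
  · rcases le_total 0 y with h0 | h0
    · rw [abs_of_nonneg h0] at h; exact Or.inl (Or.inl ⟨h, h0⟩)
    · rw [abs_of_nonpos h0] at h; exact Or.inr (Or.inl ⟨h, by linarith⟩)

/-- `S` is bounded by `w` plus the potential of `y`. -/
def Pot (P : Par) (y : ℝ) (S : ℤ) (w : ℕ) : Prop :=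
  (y ≤ -P.p ∧ S ≤ w + 1) ∨ (-P.p < y ∧ y ≤ P.p ∧ S ≤ w) ∨ (P.p < y ∧ y ≤ P.q ∧ S ≤ w - 1)

def ModeN (P : Par) (n : ℕ) (y : ℝ) (S : ℤ) : Prop :=
  ∃ k w : ℕ, Pot P y S w ∧ k ≤ w ∧ w * w ≤ w + 2 * (n + k) + P.K * (P.K + 1) ∧
    (k = 0 ∨ |y - P.p| * P.β ^ k ≤ P.C ∨ |y + P.p| * P.β ^ k ≤ P.C)

def ModeR (P : Par) (y : ℝ) (S : ℤ) : Prop :=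
  P.p < y ∧ ∃ k : ℕ, P.E - P.q ≤ (P.E - y) * P.β ^ k ∧ S + k ≤ P.K

def ModeQ (P : Par) (n : ℕ) (y : ℝ) (S : ℤ) : Prop :=
  P.q ≤ y ∧ ∃ w : ℕ, S ≤ w - 1 ∧ w * w ≤ w + 2 * n + P.K * (P.K + 1) ∧
    (y - P.q) * P.β ^ (w + 1) ≤ P.C

def UU (P : Par) (n : ℕ) (y : ℝ) (S : ℤ) : Prop :=
  ModeN P n y S ∨ ModeR P y S ∨ ModeQ P n y S

theorem Pot_low (P : Par) (y : ℝ) (S : ℤ) (w : ℕ) (hy : y ≤ P.p) (hS : S ≤ w) : Pot P y S w := by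
  unfold Pot
  rcases le_or_gt y (-P.p) with h | h
  · exact Or.inl ⟨h, by omega⟩
  · exact Or.inr (Or.inl ⟨h, hy, hS⟩)

theorem Par.p_pos (P : Par) : 0 < P.p := lt_trans P.hC P.hCp

theorem Par.p_lt_q (P : Par) : P.p < P.q := by linarith [P.hC, P.hCqp]

theorem near_bound (P : Par) (z : ℝ) (k : ℕ) (h : |z| * P.β ^ k ≤ P.C) : |z| ≤ P.C := by
  have : 1 ≤ P.β ^ k := one_le_pow₀ P.hβ.le
  nlinarith [abs_nonneg z]

theorem near_step (P : Par) (z z' : ℝ) (k : ℕ) (hz : z' = P.β * z)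
    (h : |z| * P.β ^ (k + 1) ≤ P.C) : |z'| * P.β ^ k ≤ P.C := by
  rw [hz, abs_mul, abs_of_pos (by linarith [P.hβ])]
  calc _ = |z| * P.β ^ (k + 1) := by ring
    _ ≤ _ := h

/-- The counter update in the plus step. -/
theorem near_plus (P : Par) (y : ℝ) (k : ℕ) (hy : 0 ≤ y)
    (h : k = 0 ∨ |y - P.p| * P.β ^ k ≤ P.C ∨ |y + P.p| * P.β ^ k ≤ P.C) :
    (k - 1 = 0 ∨ |P.β * y - 1 - P.p| * P.β ^ (k - 1) ≤ P.C ∨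
      |P.β * y - 1 + P.p| * P.β ^ (k - 1) ≤ P.C) := by
  rcases k with _ | k
  · simp
  right; right
  rcases h with h | h | h
  · omega
  · exact near_step P _ _ k (by linarith [P.hp]) h
  · have := near_bound P _ _ h
    have h2 := le_abs_self (y + P.p)
    linarith [P.hCp]

theorem near_minus (P : Par) (y : ℝ) (k : ℕ) (hy : y ≤ 0)
    (h : k = 0 ∨ |y - P.p| * P.β ^ k ≤ P.C ∨ |y + P.p| * P.β ^ k ≤ P.C) :
    (k - 1 = 0 ∨ |P.β * y + 1 - P.p| * P.β ^ (k - 1) ≤ P.C ∨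
      |P.β * y + 1 + P.p| * P.β ^ (k - 1) ≤ P.C) := by
  rcases k with _ | k
  · simp
  right; left
  rcases h with h | h | h
  · omega
  · have := near_bound P _ _ h
    have h2 := neg_abs_le (y - P.p)
    linarith [P.hCp]
  · exact near_step P _ _ k (by linarith [P.hp]) h

/-- At decision points the counter vanishes. -/
theorem near_zero (P : Par) (y : ℝ) (k : ℕ) (hy : |y| ≤ P.c)
    (h : k = 0 ∨ |y - P.p| * P.β ^ k ≤ P.C ∨ |y + P.p| * P.β ^ k ≤ P.C) : k = 0 := by
  obtain ⟨h1, h2⟩ := abs_le.1 hy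
  rcases h with h | h | h
  · exact h
  · have := near_bound P _ _ h
    have h2 := neg_abs_le (y - P.p)
    linarith [P.hCpc]
  · have := near_bound P _ _ h
    have h2 := le_abs_self (y + P.p)
    linarith [P.hCpc]

theorem step_plus (P : Par) (n : ℕ) (y : ℝ) (S : ℤ) (hA : AP P y S) (hU : UU P n y S) :
    UU P (n + 1) (P.β * y - 1) (S + 1) := by
  have hβ := P.hβ
  have hp := P.hp
  have hq := P.hq
  have hc := P.hc
  have hpp := P.p_pos
  have hpq := P.p_lt_q
  have hpc : P.c < P.p := by linarith [P.hC, P.hCpc]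
  rcases hU with ⟨k, w, hP, hkw, hw, hk⟩ | ⟨hy, k, hk, hS⟩ | ⟨hy, w, hS, hw, hd⟩
  · left
    rcases le_or_gt |y| P.c with hyc | hyc
    · have hk0 := near_zero P y k hyc hk
      subst hk0
      obtain ⟨h1, h2⟩ := abs_le.1 hyc
      refine ⟨0, w, Or.inl ⟨?_, ?_⟩, by omega, by omega, by simp⟩
      · nlinarith
      · rcases hP with h | h | h
        · linarith [h.1]
        · omega
        · omega
    · have hy0 : 0 ≤ y := by
        rcases hA with h | h
        · exact h.2
        · linarith [h.1]
      refine ⟨k - 1, w, ?_, by omega, by omega, near_plus P y k hy0 hk⟩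
      rcases hP with h | h | h
      · linarith [h.1]
      · left
        exact ⟨by nlinarith [h.2.1], by omega⟩
      · refine Pot_low P _ _ _ (by nlinarith [h.2.1]) (by omega)
  · rcases le_or_gt y P.q with hyq | hyq
    · left
      refine ⟨0, P.K + 1, Pot_low P _ _ _ (by nlinarith) (by push_cast; omega), by omega, ?_, by simp⟩
      nlinarith
    · right; left
      refine ⟨by nlinarith, ?_⟩
      rcases k with _ | k
      · simp at hk; linarith
      · refine ⟨k, ?_, by push_cast at hS; linarith⟩
        calc _ ≤ _ := hk
          _ = (P.E - (P.β * y - 1)) * P.β ^ k := by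
            rw [pow_succ]; linear_combination (-P.β ^ k) * -P.hE
  · left
    have e : P.β * y - 1 - P.p = P.β * (y - P.q) := by linarith
    have hn : |P.β * y - 1 - P.p| * P.β ^ w ≤ P.C := by
      apply near_step P (y - P.q) _ w e
      rwa [abs_of_nonneg (by linarith)]
    have hb := near_bound P _ _ hn
    have hb2 := le_abs_self (P.β * y - 1 - P.p)
    refine ⟨w, w + 1, ?_, by omega, by nlinarith, Or.inr (Or.inl hn)⟩
    rcases le_or_gt (P.β * y - 1) P.p with h | h
    · exact Pot_low P _ _ _ h (by push_cast; omega)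
    · exact Or.inr (Or.inr ⟨h, by linarith [P.hCqp], by push_cast; omega⟩)

theorem step_minus (P : Par) (n : ℕ) (y : ℝ) (S : ℤ) (hA : AP P (-y) (-S)) (hU : UU P n y S) :
    UU P (n + 1) (P.β * y + 1) (S - 1) := by
  have hβ := P.hβ
  have hp := P.hp
  have hq := P.hq
  have hc := P.hc
  have hpp := P.p_pos
  have hpq := P.p_lt_q
  have hpc : P.c < P.p := by linarith [P.hC, P.hCpc]
  have hyp : y ≤ P.p := by
    rcases hA with h | h
    · linarith [h.2]
    · have := h.1
      rw [abs_neg] at this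
      linarith [le_abs_self y]
  rcases hU with ⟨k, w, hP, hkw, hw, hk⟩ | ⟨hy, _⟩ | ⟨hy, _⟩
  · rcases hA with ⟨h1, h2⟩ | ⟨hyc, hd⟩
    · left
      refine ⟨k - 1, w, ?_, by omega, by omega, near_minus P y k (by linarith) hk⟩
      rcases hP with h | h | h
      · exact Pot_low P _ _ _ (by nlinarith [h.1]) (by omega)
      · exact Or.inr (Or.inr ⟨by nlinarith [h.1], by nlinarith, by omega⟩)
      · linarith [h.1]
    · rw [abs_neg] at hyc
      have hk0 := near_zero P y k hyc hk
      subst hk0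
      obtain ⟨h1, h2⟩ := abs_le.1 hyc
      have hSw : S ≤ w := by
        rcases hP with h | h | h
        · linarith [h.1]
        · omega
        · omega
      have hyq : P.q ≤ P.β * y + 1 := by nlinarith
      rcases hd with ⟨hS, hd⟩ | ⟨hS, hd⟩
      · right; left
        refine ⟨by linarith, (-S).toNat + P.K, ?_, by push_cast; omega⟩
        have hKp : 0 < P.β ^ P.K := pow_pos (by linarith) _
        calc P.E - P.q ≤ P.β * P.θ * P.β ^ P.K := P.hK
          _ ≤ P.β * ((-y + P.s) * P.β ^ (-S).toNat) * P.β ^ P.K := by gcongr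
          _ = (P.E - (P.β * y + 1)) * P.β ^ ((-S).toNat + P.K) := by
            rw [pow_add]; linear_combination (P.β ^ (-S).toNat * P.β ^ P.K) * P.hs
      · right; right
        rw [neg_neg, sub_neg_eq_add] at hd
        have hT : (S.toNat : ℤ) = S := Int.toNat_of_nonneg (by omega)
        refine ⟨hyq, S.toNat, by omega, ?_, ?_⟩
        · have a : S.toNat ≤ w := by omega
          have b : 1 ≤ S.toNat := by omega
          obtain ⟨j, hj⟩ := Nat.exists_eq_add_of_le a
          generalize S.toNat = T at *
          subst hj
          nlinarith
        · have e : P.β * y + 1 - P.q = P.β * (y + P.c) := by linarith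
          have hKp : 0 < P.β ^ S.toNat := pow_pos (by linarith) _
          calc _ = P.β ^ 2 * ((y + P.c) * P.β ^ S.toNat) := by rw [e]; ring
            _ ≤ P.β ^ 2 * ((P.s + y) * P.β ^ S.toNat) := by
              gcongr ?_ * (?_ * ?_)
              linarith [P.hcs]
            _ ≤ P.β ^ 2 * P.θ := by gcongr
            _ ≤ _ := P.hθC
  · linarith
  · linarith

theorem UU_bound (P : Par) (n : ℕ) (y : ℝ) (S : ℤ) (hU : UU P n y S) :
    y ≤ P.E + P.C ∧ (S : ℝ) ≤ √(8 * n + (4 * (P.K + 2) ^ 2 + 18 + 4 * (P.K * (P.K + 1)))) := by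
  have hβ := P.hβ
  have hC := P.hC
  have key : ∀ k w : ℕ, k ≤ w → w * w ≤ w + 2 * (n + k) + P.K * (P.K + 1) → S ≤ w + 1 →
      (S : ℝ) ≤ √(8 * n + (4 * (P.K + 2) ^ 2 + 18 + 4 * (P.K * (P.K + 1)))) := by
    intro k w h1 h2 h3
    have h3' : (S : ℝ) ≤ (w : ℝ) + 1 := by exact_mod_cast h3
    have h1' : (k : ℝ) ≤ w := by exact_mod_cast h1
    have h2' : (w : ℝ) * w ≤ w + 2 * (n + k) + P.K * (P.K + 1) := by exact_mod_cast h2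
    have hK0 : (0 : ℝ) ≤ P.K := Nat.cast_nonneg _
    refine h3'.trans (Real.le_sqrt_of_sq_le ?_)
    nlinarith [sq_nonneg ((w : ℝ) - 3), sq_nonneg ((w : ℝ) - 1)]
  refine ⟨?_, ?_⟩
  · rcases hU with ⟨k, w, hP, hkw, hw, hk⟩ | ⟨hy, k, hk, hS⟩ | ⟨hy, w, hS, hw, hd⟩
    · rcases hP with h | h | h
      · linarith [h.1, P.p_pos, P.p_lt_q, P.hqE]
      · linarith [h.2.1, P.p_pos, P.p_lt_q, P.hqE]
      · linarith [h.2.1, P.p_pos, P.p_lt_q, P.hqE]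
    · by_contra hcon
      have : 0 < P.β ^ k := pow_pos (by linarith) _
      nlinarith [P.hqE]
    · have : 1 ≤ P.β ^ (w + 1) := one_le_pow₀ hβ.le
      nlinarith [P.hqE]
  · rcases hU with ⟨k, w, hP, hkw, hw, hk⟩ | ⟨hy, k, hk, hS⟩ | ⟨hy, w, hS, hw, hd⟩
    · refine key k w hkw hw ?_
      rcases hP with h | h | h <;> omega
    · have h3' : (S : ℝ) ≤ (P.K : ℝ) := by
        have : S ≤ (P.K : ℤ) := by omega
        exact_mod_cast this
      refine h3'.trans (Real.le_sqrt_of_sq_le ?_)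
      have hK0 : (0 : ℝ) ≤ P.K := Nat.cast_nonneg _
      have hn0 : (0 : ℝ) ≤ n := Nat.cast_nonneg _
      nlinarith
    · exact key 0 w (by omega) (by omega) (by omega)

theorem UU_init (P : Par) (y : ℝ) (h : P.E - P.q ≤ (P.E - y) * P.β ^ P.K) : UU P 0 y 0 := by
  rcases le_or_gt y P.p with hy | hy
  · exact Or.inl ⟨0, 0, Pot_low P _ _ _ hy (by simp), le_rfl, by simp, by simp⟩
  · exact Or.inr (Or.inl ⟨hy, P.K, h, by simp⟩)

theorem exists_par (β : ℝ) (h1 : 1 < β) (h2 : β < 2) (hP : β ^ 3 - β ^ 2 - 2 * β + 1 ≤ 0)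
    (D : ℝ) (hD : 0 < D) :
    ∃ P : Par, P.β = β ∧ P.E = 1 / (β - 1) ∧ P.E - P.q ≤ D * P.β ^ P.K := by
  have b0 : 0 < β := by linarith
  have b1 : 0 < β - 1 := by linarith
  have b2 : 0 < β + 1 := by linarith
  have hs : 0 < (2 - β) / (β * (β - 1)) := div_pos (by linarith) (by positivity)
  have hC : 0 < 1 / (β ^ 2 * (β + 1)) := by positivity
  obtain ⟨θ, hθ⟩ : ∃ θ, θ = min ((2 - β) / (β * (β - 1))) (1 / (β ^ 2 * (β + 1)) / β ^ 2) :=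
    ⟨_, rfl⟩
  have hθ0 : 0 < θ := by rw [hθ]; exact lt_min hs (by positivity)
  have hθ1 : θ ≤ (2 - β) / (β * (β - 1)) := by rw [hθ]; exact min_le_left _ _
  have hθ2 : θ ≤ 1 / (β ^ 2 * (β + 1)) / β ^ 2 := by rw [hθ]; exact min_le_right _ _
  set X := 1 / (β - 1) - (β + 2) / (β * (β + 1)) with hX
  have hX0 : 0 < X := by
    have : X = 2 / ((β - 1) * β * (β + 1)) := by rw [hX]; field_simp; ring
    rw [this]; positivity
  set m := min (β * θ) D with hm
  have hm0 : 0 < m := lt_min (by positivity) hD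
  obtain ⟨K, hK⟩ := pow_unbounded_of_one_lt (X / m) h1
  rw [div_lt_iff₀ hm0] at hK
  have hβK : 0 < β ^ K := by positivity
  have k1 : m ≤ β * θ := min_le_left _ _
  have k2 : m ≤ D := min_le_right _ _
  refine ⟨⟨β, 1 / (β + 1), (β + 2) / (β * (β + 1)), (β ^ 2 - 2) / (β ^ 2 * (β + 1)),
    (2 - β) / (β * (β - 1)), 1 / (β - 1), 1 / (β ^ 2 * (β + 1)), θ, K, h1, ?_, ?_, ?_, ?_, ?_, ?_,
    hC, ?_, ?_, ?_, hθ0, hθ1, ?_, ?_, ?_⟩, rfl, rfl, ?_⟩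
  · field_simp; ring
  · field_simp; ring
  · field_simp; ring
  · field_simp; ring
  · field_simp; ring
  · rw [div_le_div_iff₀ (by positivity) (by positivity)]
    nlinarith
  · rw [← sub_pos]
    have : 1 / (β + 1) - (β ^ 2 - 2) / (β ^ 2 * (β + 1)) - 1 / (β ^ 2 * (β + 1))
      = 1 / (β ^ 2 * (β + 1)) := by field_simp; ring
    rw [this]; exact hC
  · rw [div_lt_div_iff₀ (by positivity) (by positivity)]
    nlinarith
  · rw [← sub_nonneg]
    have : (β + 2) / (β * (β + 1)) - 1 / (β + 1) - 1 / (β ^ 2 * (β + 1))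
      = (2 * β - 1) / (β ^ 2 * (β + 1)) := by field_simp; ring
    rw [this]; exact div_nonneg (by linarith) (by positivity)
  · rw [le_div_iff₀ (by positivity)] at hθ2
    linarith
  · linarith
  · change X ≤ β * θ * β ^ K
    nlinarith
  · change X ≤ D * β ^ K
    nlinarith

open Classical in
/-- The orbit of the strategy: position and digit sum. -/
noncomputable def orb (P : Par) (y : ℝ) : ℕ → ℝ × ℤ
  | 0 => (y, 0)
  | n + 1 => if AP P (orb P y n).1 (orb P y n).2 then
      (P.β * (orb P y n).1 - 1, (orb P y n).2 + 1)
    else (P.β * (orb P y n).1 + 1, (orb P y n).2 - 1)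

open Classical in
noncomputable def dig (P : Par) (y : ℝ) (n : ℕ) : ℕ :=
  if AP P (orb P y n).1 (orb P y n).2 then 1 else 0

theorem dig_le (P : Par) (y : ℝ) (n : ℕ) : dig P y n ≤ 1 := by
  unfold dig; split_ifs <;> simp

theorem orb_fst (P : Par) (y : ℝ) (n : ℕ) :
    (orb P y (n + 1)).1 = P.β * (orb P y n).1 + 1 - 2 * dig P y n := by
  rw [orb, dig]; split_ifs
  · push_cast; ring
  · push_cast; ring

theorem orb_snd (P : Par) (y : ℝ) (n : ℕ) :
    (orb P y n).2 = n - 2 * ((Finset.range n).filter fun i => dig P y i = 0).card := by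
  induction n with
  | zero => simp [orb]
  | succ n ih =>
    rw [Finset.range_add_one, Finset.filter_insert, orb]
    by_cases h : AP P (orb P y n).1 (orb P y n).2
    · have hd : dig P y n = 1 := by simp [dig, h]
      rw [if_pos h, if_neg (by omega)]
      push_cast; simp only [ih]; ring
    · have hd : dig P y n = 0 := by simp [dig, h]
      rw [if_neg h, if_pos hd, Finset.card_insert_of_notMem (by simp)]
      push_cast; simp only [ih]; ring

theorem orb_inv (P : Par) (y : ℝ) (h1 : UU P 0 y 0) (h2 : UU P 0 (-y) 0) (n : ℕ) :
    UU P n (orb P y n).1 (orb P y n).2 ∧ UU P n (-(orb P y n).1) (-(orb P y n).2) := by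
  induction n with
  | zero => simpa [orb] using ⟨h1, h2⟩
  | succ n ih =>
    rw [orb]
    by_cases h : AP P (orb P y n).1 (orb P y n).2
    · rw [if_pos h]
      refine ⟨step_plus P _ _ _ h ih.1, ?_⟩
      convert step_minus P _ _ _ (by simpa using h) ih.2 using 1 <;> ring
    · rw [if_neg h]
      have h' := (AP_total P (orb P y n).1 (orb P y n).2).resolve_left h
      refine ⟨step_minus P _ _ _ h' ih.1, ?_⟩
      convert step_plus P _ _ _ h' ih.2 using 1 <;> ring

theorem orb_sum (P : Par) (y : ℝ) (n : ℕ) :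
    (y + P.E) / 2 = ∑ i ∈ Finset.range n, (dig P y i : ℝ) / P.β ^ (i + 1)
      + (((orb P y n).1 + P.E) / 2) / P.β ^ n := by
  have b0 : P.β ≠ 0 := by linarith [P.hβ]
  induction n with
  | zero => simp [orb]
  | succ n ih =>
    rw [ih, Finset.sum_range_succ, orb_fst, add_assoc]
    congr 1
    rw [pow_succ]
    field_simp
    linear_combination P.hE

theorem every_x_has_simply_normal_expansion_below_betaT
    (βT : ℝ) (hβT : βT ∈ Set.Ioo (1 : ℝ) 2)
    (hroot : βT ^ 3 - βT ^ 2 - 2 * βT + 1 = 0)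
    (β : ℝ) (hβ : β ∈ Set.Ioc (1 : ℝ) βT)
    (x : ℝ) (hx : x ∈ Set.Ioo (0 : ℝ) (1 / (β - 1))) :
    ∃ ε : ℕ → ℕ, isExpansion β x ε ∧ simplyNormal ε := by
  obtain ⟨hT1, hT2⟩ := hβT
  obtain ⟨hb1, hb2⟩ := hβ
  obtain ⟨hx1, hx2⟩ := hx
  have hpoly : β ^ 3 - β ^ 2 - 2 * β + 1 ≤ 0 := by
    by_contra hcon
    push Not at hcon
    nlinarith [mul_nonneg (sub_nonneg.2 hb2) (sub_pos.2 hb1).le,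
      mul_nonneg (mul_nonneg (sub_nonneg.2 hb2) (sub_pos.2 hb1).le) (sub_pos.2 hb1).le,
      mul_nonneg (mul_nonneg (sub_nonneg.2 hb2) (sub_pos.2 hb1).le) (sub_pos.2 hT1).le]
  obtain ⟨P, rfl, hPE, hPK⟩ := exists_par β hb1 (by linarith) hpoly
    (min (2 * x) (2 * (1 / (β - 1) - x))) (lt_min (by linarith) (by linarith))
  rw [← hPE] at hx2 hPK
  obtain ⟨y, hy⟩ : ∃ y, y = 2 * x - P.E := ⟨_, rfl⟩
  have hK0 : 0 < P.β ^ P.K := pow_pos (by linarith) _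
  have i1 : UU P 0 y 0 := by
    refine UU_init P y (hPK.trans ?_)
    gcongr
    exact (min_le_right _ _).trans (by rw [hy]; linarith)
  have i2 : UU P 0 (-y) 0 := by
    refine UU_init P (-y) (hPK.trans ?_)
    gcongr
    exact (min_le_left _ _).trans (by rw [hy]; linarith)
  have inv := orb_inv P y i1 i2
  have hxy : (y + P.E) / 2 = x := by rw [hy]; ring
  have b0 : (0 : ℝ) < P.β := by linarith
  refine ⟨dig P y, ⟨dig_le P y, ?_⟩, ?_⟩
  · symm
    apply HasSum.tsum_eq
    rw [hasSum_iff_tendsto_nat_of_nonneg (fun i => by positivity)]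
    have e : (fun n => ∑ i ∈ Finset.range n, (dig P y i : ℝ) / P.β ^ (i + 1))
        = fun n => x - (((orb P y n).1 + P.E) / 2) * (P.β⁻¹) ^ n := by
      funext n
      have := orb_sum P y n
      rw [hxy] at this
      rw [this, inv_pow, div_eq_mul_inv _ (P.β ^ n)]; ring
    rw [e]
    have hz : Filter.Tendsto (fun n => (((orb P y n).1 + P.E) / 2) * (P.β⁻¹) ^ n)
        Filter.atTop (nhds 0) := by
      have hg : Filter.Tendsto (fun n : ℕ => (P.β⁻¹) ^ n) Filter.atTop (nhds 0) :=
        tendsto_pow_atTop_nhds_zero_of_lt_one (by positivity) (inv_lt_one_of_one_lt₀ hb1)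
      refine bdd_le_mul_tendsto_zero' (P.E + P.C) (Filter.Eventually.of_forall fun n => ?_) hg
      have u1 := (UU_bound P _ _ _ (inv n).1).1
      have u2 := (UU_bound P _ _ _ (inv n).2).1
      have hC := P.hC
      rw [abs_le]; constructor <;> linarith
    simpa using hz.const_sub x
  · unfold simplyNormal
    set B : ℝ := 4 * (P.K + 2) ^ 2 + 18 + 4 * (P.K * (P.K + 1)) with hB
    have hB0 : 0 ≤ B := by positivity
    have hS : ∀ n, |((orb P y n).2 : ℝ)| ≤ √(8 * n + B) := by
      intro n
      have u1 := (UU_bound P _ _ _ (inv n).1).2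
      have u2 := (UU_bound P _ _ _ (inv n).2).2
      push_cast at u2
      rw [abs_le]; constructor <;> linarith
    have hlim : Filter.Tendsto (fun n : ℕ => ((orb P y n).2 : ℝ) / n) Filter.atTop (nhds 0) := by
      have hg : Filter.Tendsto (fun n : ℕ => √((8 + B) * (1 / (n : ℝ)))) Filter.atTop (nhds 0) := by
        have := (tendsto_one_div_atTop_nhds_zero_nat (𝕜 := ℝ)).const_mul (8 + B)
        rw [mul_zero] at this
        have := (Real.continuous_sqrt.tendsto 0).comp this
        rw [Real.sqrt_zero] at this
        exact this
      refine squeeze_zero_norm' ?_ hg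
      filter_upwards [Filter.eventually_ge_atTop 1] with n hn
      have hn' : (1 : ℝ) ≤ n := by exact_mod_cast hn
      rw [Real.norm_eq_abs, abs_div, Nat.abs_cast, div_le_iff₀ (by linarith)]
      refine (hS n).trans ?_
      have : (n : ℝ) = √((n : ℝ) ^ 2) := (Real.sqrt_sq (by linarith)).symm
      conv_rhs => rw [this]
      rw [← Real.sqrt_mul' _ (by positivity)]
      apply Real.sqrt_le_sqrt
      rw [Real.sqrt_sq (by linarith)]
      have : (8 + B) * (1 / (n : ℝ)) * (n : ℝ) ^ 2 = (8 + B) * n := by field_simp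
      rw [this]
      nlinarith
    have h2 := (hlim.const_mul (-1 / 2)).const_add (1 / 2)
    simp only [mul_zero, add_zero] at h2
    refine h2.congr' ?_
    filter_upwards [Filter.eventually_ge_atTop 1] with n hn
    have hn' : (n : ℝ) ≠ 0 := by
      have : (1 : ℝ) ≤ n := by exact_mod_cast hn
      linarith
    have e := orb_snd P y n
    have e' : ((orb P y n).2 : ℝ)
        = n - 2 * ((Finset.range n).filter fun i => dig P y i = 0).card := by
      rw [e]; push_cast; rfl
    rw [e']
    field_simp
    ring
end

section
/- Let β ∈ (1, β_KL), where β_KL is the Komornik–Loreti constant. Then every x ∈ (0, 1/(β−1)) has a simply normal β-expansion. -/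
/-- The Thue–Morse sequence: `thueMorse n` is the parity of the number of ones
in the binary expansion of `n`. -/
def thueMorse (n : ℕ) : ℕ := (Nat.digits 2 n).sum % 2

open Filter Topology

/-- The constant from the hypothesis is below `9/5`. -/
lemma betaKL_lt (b : ℝ) (hb : b ∈ Set.Ioo (1 : ℝ) 2)
    (hKL : ∑' i : ℕ, (thueMorse (i + 1) : ℝ) / b ^ (i + 1) = 1) : b < 9 / 5 := by
  by_contra hcon
  push Not at hcon
  have hb0 : 0 < b := by linarith
  have h1 : ∀ n, (thueMorse n : ℝ) ≤ 1 := by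
    intro n
    have : thueMorse n ≤ 1 := by unfold thueMorse; omega
    exact_mod_cast this
  have hle : ∀ i : ℕ, (thueMorse (i + 1) : ℝ) / b ^ (i + 1) ≤ (5 / 9 : ℝ) ^ (i + 1) := by
    intro i
    rw [div_le_iff₀ (by positivity), ← mul_pow]
    exact (h1 _).trans (one_le_pow₀ (by linarith))
  have h0 : ∀ i : ℕ, 0 ≤ (thueMorse (i + 1) : ℝ) / b ^ (i + 1) := fun i => by positivity
  have hg : Summable (fun i : ℕ => (5 / 9 : ℝ) ^ (i + 1)) :=
    (summable_nat_add_iff 1).2 (summable_geometric_of_lt_one (by norm_num) (by norm_num))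
  have hf := Summable.of_nonneg_of_le h0 hle hg
  have hsplit := hf.sum_add_tsum_nat_add 6
  rw [hKL] at hsplit
  have htail : ∑' i : ℕ, (thueMorse (i + 6 + 1) : ℝ) / b ^ (i + 6 + 1)
      ≤ ∑' i : ℕ, (5 / 9 : ℝ) ^ (i + 6 + 1) :=
    ((summable_nat_add_iff 6).2 hf).tsum_le_tsum (fun i => hle (i + 6))
      ((summable_nat_add_iff 6).2 hg)
  have hgeo : ∑' i : ℕ, (5 / 9 : ℝ) ^ (i + 6 + 1) = (5 / 9 : ℝ) ^ 7 * (9 / 4) := by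
    have : ∀ i : ℕ, (5 / 9 : ℝ) ^ (i + 6 + 1) = (5 / 9 : ℝ) ^ 7 * (5 / 9 : ℝ) ^ i := by
      intro i; rw [← pow_add]; congr 1; omega
    rw [tsum_congr this]
    rw [tsum_mul_left, tsum_geometric_of_lt_one (by norm_num) (by norm_num)]
    norm_num
  rw [hgeo] at htail
  have t3 : thueMorse 3 = 0 := by norm_num [thueMorse]
  have t5 : thueMorse 5 = 0 := by norm_num [thueMorse]
  have t6 : thueMorse 6 = 0 := by norm_num [thueMorse]
  have e0 := hle 0
  have e1 := hle 1
  have e3 := hle 3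
  simp only [Finset.sum_range_succ, Finset.sum_range_zero] at hsplit
  norm_num [t3, t5, t6] at hsplit e0 e1 e3 htail
  linarith

/-- The digit chosen in state `(y, s)`. -/
noncomputable def dg (t : ℝ) (z : ℝ × ℝ) : ℕ :=
  if |z.1| < t then (if 0 < z.2 then 1 else 0) else (if 0 ≤ z.1 then 1 else 0)

/-- One step of the dynamics. -/
noncomputable def stp (β t : ℝ) (z : ℝ × ℝ) : ℝ × ℝ :=
  (β * z.1 - (2 * (dg t z : ℝ) - 1), z.2 + (2 * (dg t z : ℝ) - 1))

/-- The invariant. -/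
def OrbInv (p q k e C y s : ℝ) : Prop :=
  (-p ≤ y ∧ y ≤ p ∧ -C ≤ s ∧ s ≤ C) ∨
  (p ≤ y ∧ y ≤ k ∧ -C - 1 ≤ s ∧ s * e + y ≤ k) ∨
  (p ≤ y ∧ y ≤ q ∧ -C - 1 ≤ s ∧ s ≤ C - 1) ∨
  (-k ≤ y ∧ y ≤ -p ∧ s ≤ C + 1 ∧ -k ≤ s * e + y) ∨
  (-q ≤ y ∧ y ≤ -p ∧ s ≤ C + 1 ∧ -C + 1 ≤ s)

lemma dg_le (t : ℝ) (z : ℝ × ℝ) : dg t z ≤ 1 := by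
  unfold dg; split_ifs <;> simp

/-- digit `+` outside. -/
lemma orb_pos {β p q k e C y s : ℝ} (hβ : 1 < β) (hp : β * p = 1 - p) (hq : β * q = 1 + p)
    (he : e = 1 - (β - 1) * k) (he0 : 0 < e) (hC : C * e = k + p)
    (h : (p ≤ y ∧ y ≤ k ∧ -C - 1 ≤ s ∧ s * e + y ≤ k) ∨
      (p ≤ y ∧ y ≤ q ∧ -C - 1 ≤ s ∧ s ≤ C - 1)) :
    OrbInv p q k e C (β * y - 1) (s + 1) := by
  have hpy : p ≤ y := by rcases h with h | h <;> exact h.1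
  have a1 : β * p ≤ β * y := by nlinarith
  have hs : -C - 1 ≤ s := by rcases h with h | h <;> exact h.2.2.1
  by_cases hyq : y ≤ q
  · have a2 : β * y ≤ β * q := by nlinarith
    refine Or.inl ⟨by linarith, by linarith, by linarith, ?_⟩
    rcases h with h | h
    · obtain ⟨_, h2, _, h4⟩ := h
      have a3 : (β - 1) * y ≤ (β - 1) * k := by nlinarith
      have : (s + 1) * e ≤ C * e := by nlinarith
      exact le_of_mul_le_mul_right this he0
    · linarith [h.2.2.2]
  · push Not at hyq
    have a2 : β * q ≤ β * y := by nlinarith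
    rcases h with h | h
    · obtain ⟨_, h2, _, h4⟩ := h
      have a3 : (β - 1) * y ≤ (β - 1) * k := by nlinarith
      refine Or.inr (Or.inl ⟨by linarith, by linarith, by linarith, by linarith⟩)
    · linarith [h.2.1]

/-- symmetry of the invariant -/
lemma OrbInv.neg {p q k e C y s : ℝ} (h : OrbInv p q k e C y s) : OrbInv p q k e C (-y) (-s) := by
  rcases h with ⟨h1, h2, h3, h4⟩ | ⟨h1, h2, h3, h4⟩ | ⟨h1, h2, h3, h4⟩ | ⟨h1, h2, h3, h4⟩ |
    ⟨h1, h2, h3, h4⟩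
  · exact Or.inl ⟨by linarith, by linarith, by linarith, by linarith⟩
  · exact Or.inr (Or.inr (Or.inr (Or.inl ⟨by linarith, by linarith, by linarith, by linarith⟩)))
  · exact Or.inr (Or.inr (Or.inr (Or.inr ⟨by linarith, by linarith, by linarith, by linarith⟩)))
  · exact Or.inr (Or.inl ⟨by linarith, by linarith, by linarith, by linarith⟩)
  · exact Or.inr (Or.inr (Or.inl ⟨by linarith, by linarith, by linarith, by linarith⟩))

lemma inv_step {β p q k e C t : ℝ} (hβ : 1 < β) (hp0 : 0 < p)
    (hp : β * p = 1 - p) (hq : β * q = 1 + p)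
    (he : e = 1 - (β - 1) * k) (he0 : 0 < e) (hC : C * e = k + p)
    (ht0 : 0 ≤ t) (htp : t ≤ p) (htq : 1 - q ≤ β * t) (htk : 1 + β * t ≤ k)
    (z : ℝ × ℝ) (h : OrbInv p q k e C z.1 z.2) :
    OrbInv p q k e C (stp β t z).1 (stp β t z).2 := by
  obtain ⟨y, s⟩ := z
  simp only at h
  have hout : ¬ |y| < t → (0 ≤ y → dg t (y, s) = 1) ∧ (¬ 0 ≤ y → dg t (y, s) = 0) := by
    intro h; constructor <;> intro h' <;> simp [dg, h, h']
  have hP : ((p ≤ y ∧ y ≤ k ∧ -C - 1 ≤ s ∧ s * e + y ≤ k) ∨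
      (p ≤ y ∧ y ≤ q ∧ -C - 1 ≤ s ∧ s ≤ C - 1)) →
      OrbInv p q k e C (stp β t (y, s)).1 (stp β t (y, s)).2 := by
    intro h
    have hpy : p ≤ y := by rcases h with h | h <;> exact h.1
    have hy0 : 0 ≤ y := by linarith
    have : ¬ |y| < t := by rw [abs_of_nonneg hy0]; linarith
    have hd := (hout this).1 hy0
    have := orb_pos hβ hp hq he he0 hC h
    simp only [stp, hd]
    convert this using 1 <;> norm_num
  have hN : ((-k ≤ y ∧ y ≤ -p ∧ s ≤ C + 1 ∧ -k ≤ s * e + y) ∨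
      (-q ≤ y ∧ y ≤ -p ∧ s ≤ C + 1 ∧ -C + 1 ≤ s)) →
      OrbInv p q k e C (stp β t (y, s)).1 (stp β t (y, s)).2 := by
    intro h
    have hpy : y ≤ -p := by rcases h with h | h <;> exact h.2.1
    have hy0 : y < 0 := by linarith
    have : ¬ |y| < t := by rw [abs_of_neg hy0]; linarith
    have hd := (hout this).2 (by linarith)
    have h' : (p ≤ -y ∧ -y ≤ k ∧ -C - 1 ≤ -s ∧ -s * e + -y ≤ k) ∨
      (p ≤ -y ∧ -y ≤ q ∧ -C - 1 ≤ -s ∧ -s ≤ C - 1) := by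
      rcases h with ⟨h1, h2, h3, h4⟩ | ⟨h1, h2, h3, h4⟩
      · exact Or.inl ⟨by linarith, by linarith, by linarith, by linarith⟩
      · exact Or.inr ⟨by linarith, by linarith, by linarith, by linarith⟩
    have := (orb_pos hβ hp hq he he0 hC h').neg
    simp only [stp, hd]
    convert this using 1 <;> norm_num <;> ring
  rcases h with ⟨h1, h2, h3, h4⟩ | h | h | h | h
  · have b1 : β * y ≤ β * p := by nlinarith
    have b2 : β * (-p) ≤ β * y := by nlinarith
    by_cases hyt : |y| < t
    · obtain ⟨c1, c2⟩ := abs_lt.1 hyt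
      have b3 : β * y ≤ β * t := by nlinarith
      have b4 : β * (-t) ≤ β * y := by nlinarith
      by_cases hs : 0 < s
      · have hd : dg t (y, s) = 1 := by simp [dg, hyt, hs]
        have : 0 ≤ (s + 1) * e := by positivity
        simp only [stp, hd]
        norm_num
        exact Or.inr (Or.inr (Or.inr (Or.inl ⟨by linarith, by linarith, by linarith, by linarith⟩)))
      · have hd : dg t (y, s) = 0 := by simp [dg, hyt, hs]
        have : (s - 1) * e ≤ 0 := by nlinarith
        simp only [stp, hd]
        norm_num
        exact Or.inr (Or.inl ⟨by linarith, by linarith, by linarith, by linarith⟩)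
    · by_cases hy0 : 0 ≤ y
      · have hd := (hout hyt).1 hy0
        rw [abs_of_nonneg hy0] at hyt
        have b3 : β * t ≤ β * y := by nlinarith
        simp only [stp, hd]
        norm_num
        exact Or.inr (Or.inr (Or.inr (Or.inr ⟨by linarith, by linarith, by linarith, by linarith⟩)))
      · have hd := (hout hyt).2 hy0
        rw [abs_of_neg (by linarith)] at hyt
        have b3 : β * t ≤ β * (-y) := by nlinarith
        simp only [stp, hd]
        norm_num
        exact Or.inr (Or.inr (Or.inl ⟨by linarith, by linarith, by linarith, by linarith⟩))
  · exact hP (Or.inl h)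
  · exact hP (Or.inr h)
  · exact hN (Or.inl h)
  · exact hN (Or.inr h)

lemma inv_bound {p q k e C y s : ℝ} (hp0 : 0 < p) (hk : 0 < k) (hq : 0 < q) (he0 : 0 < e)
    (hC0 : 0 < C) (h : OrbInv p q k e C y s) : |y| ≤ p + q + k ∧ |s| ≤ C + 1 + k / e := by
  have hke : 0 < k / e := by positivity
  have key : ∀ u : ℝ, u * e ≤ k → u ≤ k / e := fun u hu => (le_div_iff₀ he0).2 hu
  rw [abs_le, abs_le]
  rcases h with ⟨h1, h2, h3, h4⟩ | ⟨h1, h2, h3, h4⟩ | ⟨h1, h2, h3, h4⟩ | ⟨h1, h2, h3, h4⟩ |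
    ⟨h1, h2, h3, h4⟩
  · exact ⟨⟨by linarith, by linarith⟩, by linarith, by linarith⟩
  · have := key s (by linarith)
    exact ⟨⟨by linarith, by linarith⟩, by linarith, by linarith⟩
  · exact ⟨⟨by linarith, by linarith⟩, by linarith, by linarith⟩
  · have := key (-s) (by linarith)
    exact ⟨⟨by linarith, by linarith⟩, by linarith, by linarith⟩
  · exact ⟨⟨by linarith, by linarith⟩, by linarith, by linarith⟩

lemma exists_orbit (β : ℝ) (hβ : 1 < β) (hβ2 : β < 9 / 5) (y0 : ℝ) (hy0 : |y0| < 1 / (β - 1)) :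
    ∃ (ε : ℕ → ℕ) (y : ℕ → ℝ) (B D : ℝ), (∀ i, ε i ≤ 1) ∧ y 0 = y0 ∧
      (∀ n, y (n + 1) = β * y n - (2 * (ε n : ℝ) - 1)) ∧ (∀ n, |y n| ≤ D) ∧
      ∀ n, |∑ i ∈ Finset.range n, (2 * (ε i : ℝ) - 1)| ≤ B := by
  have hb1 : 0 < β - 1 := by linarith
  set p : ℝ := 1 / (β + 1) with hpdef
  have hp0 : 0 < p := by positivity
  have hp : β * p = 1 - p := by rw [hpdef]; field_simp; ring
  set q : ℝ := (1 + p) / β with hqdef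
  have hq : β * q = 1 + p := by rw [hqdef]; field_simp
  have hq0 : 0 < q := by positivity
  have hpq : p ≤ q := by
    rw [hqdef, le_div_iff₀ (by linarith)]; linarith
  set t : ℝ := max 0 ((1 - q) / β) with htdef
  have ht0 : 0 ≤ t := le_max_left _ _
  have htp : t ≤ p := by
    apply max_le hp0.le
    rw [div_le_iff₀ (by linarith)]; linarith
  have hbt : β * t = max 0 (1 - q) := by
    rw [htdef, mul_max_of_nonneg _ _ (by linarith), mul_zero]
    congr 1; field_simp
  have htq : 1 - q ≤ β * t := by rw [hbt]; exact le_max_right _ _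
  have hr1 : 1 < 1 / (β - 1) := by rw [lt_div_iff₀ hb1]; linarith
  have htr : 1 + β * t < 1 / (β - 1) := by
    have h2 : 1 + (1 - q) < 1 / (β - 1) := by
      have hqe : q = (β + 2) / (β * (β + 1)) := by rw [hqdef, hpdef]; field_simp; ring
      have hcub : β ^ 3 - β ^ 2 - 2 * β + 1 < 0 := by
        have := mul_nonneg (mul_nonneg hb1.le (by linarith : 0 ≤ 9 / 5 - β))
          (by linarith : 0 ≤ β + 9 / 5)
        nlinarith
      rw [hqe, ← sub_pos]
      have : 1 / (β - 1) - (1 + (1 - (β + 2) / (β * (β + 1)))) =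
        -2 * (β ^ 3 - β ^ 2 - 2 * β + 1) / ((β - 1) * (β * (β + 1))) := by
        field_simp; ring
      rw [this]
      apply div_pos (by linarith); positivity
    rw [hbt]
    rcases max_cases 0 (1 - q) with h | h <;> rw [h.1] <;> linarith
  set k : ℝ := max (1 + β * t) |y0| with hkdef
  have hkr : k < 1 / (β - 1) := max_lt htr hy0
  have htk : 1 + β * t ≤ k := le_max_left _ _
  have hyk : |y0| ≤ k := le_max_right _ _
  have hk0 : 0 < k := by have : 0 ≤ β * t := by positivity
                         linarith
  obtain ⟨e, he⟩ : ∃ e, e = 1 - (β - 1) * k := ⟨_, rfl⟩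
  have he0 : 0 < e := by
    rw [lt_div_iff₀ hb1] at hkr; linarith
  obtain ⟨C, hCd⟩ : ∃ C, C = (k + p) / e := ⟨_, rfl⟩
  have hC0 : 0 < C := by rw [hCd]; positivity
  have hC : C * e = k + p := by rw [hCd]; field_simp
  let z : ℕ → ℝ × ℝ := fun n => (stp β t)^[n] (y0, 0)
  have hz : ∀ n, z (n + 1) = stp β t (z n) := fun n => Function.iterate_succ_apply' _ _ _
  have hinv : ∀ n, OrbInv p q k e C (z n).1 (z n).2 := by
    intro n
    induction n with
    | zero =>
      obtain ⟨a1, a2⟩ := abs_le.1 hyk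
      change OrbInv p q k e C y0 0
      rcases le_total p y0 with h | h
      · exact Or.inr (Or.inl ⟨by linarith, by linarith, by linarith, by linarith⟩)
      rcases le_total y0 (-p) with h' | h'
      · exact Or.inr (Or.inr (Or.inr (Or.inl ⟨by linarith, by linarith, by linarith, by linarith⟩)))
      · exact Or.inl ⟨by linarith, by linarith, by linarith, by linarith⟩
    | succ n ih =>
      rw [hz]
      exact inv_step hβ hp0 hp hq he he0 hC ht0 htp htq htk _ ih
  have hs : ∀ n, (z n).2 = ∑ i ∈ Finset.range n, (2 * (dg t (z i) : ℝ) - 1) := by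
    intro n
    induction n with
    | zero => simp [z]
    | succ n ih => rw [Finset.sum_range_succ, ← ih, hz]; rfl
  refine ⟨fun n => dg t (z n), fun n => (z n).1, C + 1 + k / e, p + q + k, fun i => dg_le _ _,
    rfl, fun n => congrArg Prod.fst (hz n), fun n => (inv_bound hp0 hk0 hq0 he0 hC0 (hinv n)).1, fun n => ?_⟩
  rw [← hs]
  exact (inv_bound hp0 hk0 hq0 he0 hC0 (hinv n)).2

theorem every_x_has_simply_normal_expansion_below_betaKL
    (βKL : ℝ) (hβKL : βKL ∈ Set.Ioo (1 : ℝ) 2)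
    (hKL : ∑' i : ℕ, (thueMorse (i + 1) : ℝ) / βKL ^ (i + 1) = 1)
    (β : ℝ) (hβ : β ∈ Set.Ioo (1 : ℝ) βKL)
    (x : ℝ) (hx : x ∈ Set.Ioo (0 : ℝ) (1 / (β - 1))) :
    ∃ ε : ℕ → ℕ, isExpansion β x ε ∧ simplyNormal ε := by
  obtain ⟨hβ1, hβ2⟩ := hβ
  have hb0 : 0 < β := by linarith
  have hb1 : 0 < β - 1 := by linarith
  have h95 : β < 9 / 5 := hβ2.trans (betaKL_lt βKL hβKL hKL)
  obtain ⟨r, hr⟩ : ∃ r, r = 1 / (β - 1) := ⟨_, rfl⟩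
  have hrb : (β - 1) * r = 1 := by rw [hr]; field_simp
  have hy0 : |2 * x - r| < 1 / (β - 1) := by
    rw [← hr] at hx ⊢
    rw [abs_lt]
    constructor <;> linarith [hx.1, hx.2]
  obtain ⟨ε, y, B, D, hε, h0, hstep, hD, hB⟩ := exists_orbit β hβ1 h95 _ hy0
  refine ⟨ε, ⟨hε, ?_⟩, ?_⟩
  · have hpart : ∀ n, ∑ i ∈ Finset.range n, (ε i : ℝ) / β ^ (i + 1) =
        x - (y n + r) / 2 / β ^ n := by
      intro n
      induction n with
      | zero => rw [h0]; simp
      | succ n ih =>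
        rw [Finset.sum_range_succ, ih, hstep]
        have : r = β * r - 1 := by linarith
        have h2 : (β * y n - (2 * (ε n : ℝ) - 1) + r) / 2 = β * ((y n + r) / 2) - ε n := by
          linarith
        rw [h2, pow_succ]
        field_simp
        ring
    have hlim : Tendsto (fun n => x - (y n + r) / 2 / β ^ n) atTop (𝓝 x) := by
      have hz : Tendsto (fun n => (y n + r) / 2 / β ^ n) atTop (𝓝 0) := by
        have hg : Tendsto (fun n : ℕ => (D + |r|) / 2 * (β⁻¹) ^ n) atTop (𝓝 0) := by
          have := (tendsto_pow_atTop_nhds_zero_of_lt_one (inv_nonneg.2 hb0.le)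
            (inv_lt_one_of_one_lt₀ hβ1)).const_mul ((D + |r|) / 2)
          simpa using this
        apply squeeze_zero_norm _ hg
        intro n
        rw [Real.norm_eq_abs, abs_div, abs_div, abs_of_pos (pow_pos hb0 n), inv_pow, div_eq_mul_inv]
        have h1 : |y n + r| ≤ D + |r| := (abs_add_le _ _).trans (by linarith [hD n])
        rw [abs_of_pos (by norm_num : (0 : ℝ) < 2)]
        gcongr
      simpa using hz.const_sub x
    have hs : HasSum (fun i : ℕ => (ε i : ℝ) / β ^ (i + 1)) x := by
      rw [hasSum_iff_tendsto_nat_of_nonneg (fun i => by positivity)]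
      simp_rw [hpart]
      exact hlim
    exact hs.tsum_eq.symm
  · unfold simplyNormal
    have hcount : ∀ n, (((Finset.range n).filter fun i => ε i = 0).card : ℝ) =
        (n - ∑ i ∈ Finset.range n, (2 * (ε i : ℝ) - 1)) / 2 := by
      intro n
      induction n with
      | zero => simp
      | succ n ih =>
        rw [Finset.range_add_one, Finset.filter_insert, Finset.sum_insert (by simp)]
        have := hε n
        interval_cases h : ε n
        · rw [if_pos rfl, Finset.card_insert_of_notMem (by simp)]
          push_cast
          rw [ih]; ring
        · rw [if_neg (by norm_num), ih]
          push_cast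
          ring
    have hz : Tendsto (fun n : ℕ => (∑ i ∈ Finset.range n, (2 * (ε i : ℝ) - 1)) / 2 / n)
        atTop (𝓝 0) := by
      apply squeeze_zero_norm _ (tendsto_const_div_atTop_nhds_zero_nat (B / 2))
      intro n
      rw [Real.norm_eq_abs, abs_div, abs_div, Nat.abs_cast,
        abs_of_pos (by norm_num : (0 : ℝ) < 2)]
      have := hB n
      gcongr
    have hz' := hz.const_sub (1 / 2)
    rw [sub_zero] at hz'
    refine hz'.congr' ?_
    filter_upwards [eventually_gt_atTop 0] with n hn
    rw [hcount]
    have : (n : ℝ) ≠ 0 := by positivity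
    field_simp
end

section
/- Let β ∈ (1, (1+√5)/2). Then every x ∈ (0, 1/(β−1)) has a β-expansion (ε_i) for which the frequency of zeros, lim_{n→∞} #{1 ≤ i ≤ n : ε_i = 0}/n, does not exist. -/
/-- The frequency of zeros among the first `n` digits. -/
noncomputable def zeroFreq (ε : ℕ → ℕ) (n : ℕ) : ℝ :=
  (((Finset.range n).filter fun i => ε i = 0).card : ℝ) / n

open Filter Topology in
/-- Along a quasi-greedy orbit zeros are in strict majority. -/
lemma greedy_excess (β : ℝ) (h1 : 1 < β) (h2 : β ^ 2 < β + 1) (y : ℕ → ℝ) (e : ℕ → ℕ)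
    (hy0 : 0 < y 0) (hyL : (β - 1) * y 0 < 1)
    (he : ∀ n, e n = if 1 < β * y n then 1 else 0)
    (hy : ∀ n, y (n + 1) = β * y n - e n) (D : ℕ → ℝ)
    (hD : ∀ n, D (n + 1) = D n + (1 - 2 * (e n : ℝ))) (K : ℝ) :
    ∃ k, (1 + β - β ^ 2) / 8 * k + K ≤ D k := by
  have hβ2 : β < 2 := by nlinarith
  have hpos : ∀ n, 0 < y n := by
    intro n
    induction n with
    | zero => exact hy0
    | succ n ih =>
      rw [hy, he]
      split_ifs with h
      · push_cast; linarith
      · push_cast; nlinarith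
  have hent : ∃ N, y N ≤ 1 := by
    by_contra hcon
    push Not at hcon
    have hf : ∀ n, 1 - (β - 1) * y n = β ^ n * (1 - (β - 1) * y 0) := by
      intro n
      induction n with
      | zero => simp
      | succ n ih =>
        have : 1 < β * y n := by nlinarith [hcon n]
        rw [hy, he, if_pos this, pow_succ]
        push_cast
        linear_combination β * ih
    have ht := (tendsto_pow_atTop_atTop_of_one_lt h1).eventually
      (eventually_ge_atTop (1 / (1 - (β - 1) * y 0)))
    obtain ⟨n, hn⟩ := ht.exists
    have hp : 0 < 1 - (β - 1) * y 0 := by linarith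
    rw [div_le_iff₀ hp, ← hf] at hn
    nlinarith [hpos n]
  obtain ⟨N, hN⟩ := hent
  have hle : ∀ k, y (N + k) ≤ 1 := by
    intro k
    induction k with
    | zero => exact hN
    | succ k ih =>
      rw [← add_assoc, hy, he]
      split_ifs with h
      · push_cast; nlinarith
      · push_cast; linarith
  obtain ⟨δ, hδ⟩ : ∃ δ, δ = (1 + β - β ^ 2) / 4 := ⟨_, rfl⟩
  have hδ0 : 0 < δ := by rw [hδ]; linarith
  obtain ⟨c, hc⟩ : ∃ c, c = 1 - ((2 - β) + (β - 1) ^ 2) / 4 := ⟨_, rfl⟩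
  have hc0 : 0 < c := by nlinarith
  have hc1 : c ≤ 1 := by nlinarith
  obtain ⟨h, hh⟩ : ∃ h : ℝ → ℝ, ∀ x, h x = (if x ≤ β - 1 then c else 0) - x / 2 :=
    ⟨_, fun _ => rfl⟩
  have hpot : ∀ k, D N + h (y N) - h (y (N + k)) + δ * k ≤ D (N + k) := by
    intro k
    induction k with
    | zero => simp
    | succ k ih =>
      have hp := hpos (N + k)
      have hl := hle k
      rw [← add_assoc, hD]
      suffices hs : δ ≤ (1 - 2 * (e (N + k) : ℝ)) + h (y (N + k + 1)) - h (y (N + k)) by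
        push_cast; linarith
      rw [hy, he, hh, hh]
      generalize y (N + k) = x at *
      by_cases hx : 1 < β * x
      · have a1 : ¬ x ≤ β - 1 := by intro h'; nlinarith
        have a2 : β * x - 1 ≤ β - 1 := by nlinarith
        simp only [if_pos hx, if_neg a1]
        push_cast
        rw [if_pos a2]
        nlinarith
      · simp only [if_neg hx]
        push_cast
        have a3 : 0 ≤ (if β * x - 0 ≤ β - 1 then c else 0) := by split_ifs <;> linarith
        by_cases a1 : x ≤ β - 1
        · rw [if_pos a1]
          nlinarith
        · rw [if_neg a1]
          nlinarith
  have hb : ∀ k, h (y (N + k)) ≤ 1 := by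
    intro k
    rw [hh]
    have := hpos (N + k)
    split_ifs <;> linarith
  obtain ⟨k, hk⟩ := exists_nat_ge ((K + δ / 2 * N + 1 - D N - h (y N)) / (δ / 2))
  rw [div_le_iff₀ (by linarith)] at hk
  refine ⟨N + k, ?_⟩
  have e1 : (1 + β - β ^ 2) / 8 = δ / 2 := by rw [hδ]; ring
  rw [e1]
  push_cast
  nlinarith [hpot k, hb k]

/-- The control system: state is (point, excess of zeros, mode). -/
noncomputable def ctlDigit (β : ℝ) (s : ℝ × ℝ × Bool) : ℕ :=
  if s.2.2 then (if 1 < β * s.1 then 1 else 0)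
  else (if 1 < β * (1 / (β - 1) - s.1) then 0 else 1)

open Classical in
noncomputable def ctl (β x η : ℝ) : ℕ → ℝ × ℝ × Bool
  | 0 => (x, 0, true)
  | n + 1 =>
    let s := ctl β x η n
    let d : ℝ := s.2.1 + (1 - 2 * (ctlDigit β s : ℝ))
    (β * s.1 - ctlDigit β s, d,
      if s.2.2 then (if η * (n + 1 : ℕ) ≤ d then false else true)
      else (if d ≤ -(η * (n + 1 : ℕ)) then true else false))

open Filter Topology in
theorem exists_expansion_with_no_frequency
    (β : ℝ) (hβ1 : 1 < β) (hβ2 : β < (1 + Real.sqrt 5) / 2)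
    (x : ℝ) (hx : x ∈ Set.Ioo (0 : ℝ) (1 / (β - 1))) :
    ∃ ε : ℕ → ℕ, isExpansion β x ε ∧
      ¬ ∃ p : ℝ, Filter.Tendsto (zeroFreq ε) Filter.atTop (nhds p) := by
  have h2 : β ^ 2 < β + 1 := by
    have h5 : Real.sqrt 5 ^ 2 = 5 := Real.sq_sqrt (by norm_num)
    have := Real.sqrt_nonneg 5
    nlinarith
  obtain ⟨η, hη⟩ : ∃ η, η = (1 + β - β ^ 2) / 8 := ⟨_, rfl⟩
  have hη0 : 0 < η := by rw [hη]; linarith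
  obtain ⟨L, hL⟩ : ∃ L, L = 1 / (β - 1) := ⟨_, rfl⟩
  have hL1 : (β - 1) * L = 1 := by rw [hL]; field_simp [show β - 1 ≠ 0 by linarith]
  rw [← hL] at hx
  obtain ⟨hx0, hxL⟩ := hx
  obtain ⟨y, d, m, ε, y0, d0, hy, hd, hmt, hmf, het, hef⟩ :
      ∃ (y d : ℕ → ℝ) (m : ℕ → Bool) (ε : ℕ → ℕ), y 0 = x ∧ d 0 = 0 ∧
        (∀ n, y (n + 1) = β * y n - ε n) ∧
        (∀ n, d (n + 1) = d n + (1 - 2 * (ε n : ℝ))) ∧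
        (∀ n, m n = true → m (n + 1) = if η * (n + 1 : ℕ) ≤ d (n + 1) then false else true) ∧
        (∀ n, m n = false →
          m (n + 1) = if d (n + 1) ≤ -(η * (n + 1 : ℕ)) then true else false) ∧
        (∀ n, m n = true → ε n = if 1 < β * y n then 1 else 0) ∧
        (∀ n, m n = false → ε n = if 1 < β * (L - y n) then 0 else 1) := by
    refine ⟨fun n => (ctl β x η n).1, fun n => (ctl β x η n).2.1, fun n => (ctl β x η n).2.2,
      fun n => ctlDigit β (ctl β x η n), rfl, rfl, fun n => rfl, fun n => rfl, ?_, ?_, ?_, ?_⟩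
    · intro n hn
      simp only at hn
      simp only [ctl, hn, if_true]
    · intro n hn
      simp only at hn
      simp only [ctl, hn, if_false, Bool.false_eq_true]
    · intro n hn
      simp only at hn
      simp only [ctlDigit, hn, if_true]
    · intro n hn
      simp only at hn
      simp only [ctlDigit, hn, if_false, Bool.false_eq_true, hL]
  have hε1 : ∀ n, ε n ≤ 1 := by
    intro n
    cases hm : m n
    · rw [hef n hm]; split_ifs <;> simp
    · rw [het n hm]; split_ifs <;> simp
  have hβ2' : β < 2 := by nlinarith
  have hbd : ∀ n, 0 < y n ∧ y n < L := by
    intro n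
    induction n with
    | zero => rw [y0]; exact ⟨hx0, hxL⟩
    | succ n ih =>
      obtain ⟨i1, i2⟩ := ih
      rw [hy]
      cases hm : m n
      · rw [hef n hm]
        split_ifs with h
        · push_cast; constructor <;> nlinarith
        · push_cast; constructor <;> nlinarith
      · rw [het n hm]
        split_ifs with h
        · push_cast; constructor <;> nlinarith
        · push_cast; constructor <;> nlinarith
  have hup : ∀ N, m N = true → ∃ n, N < n ∧ η * n ≤ d n ∧ m n = false := by
    intro N hN
    by_contra hcon
    push Not at hcon
    have hno : ∀ k, ¬ η * ((N + k + 1 : ℕ) : ℝ) ≤ d (N + k + 1) ∨ m (N + k) = false := by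
      intro k
      by_cases hc : η * ((N + k + 1 : ℕ) : ℝ) ≤ d (N + k + 1)
      · right
        by_contra hm
        have hm' : m (N + k) = true := by simpa using hm
        have := hmt _ hm'
        rw [if_pos hc] at this
        exact hcon _ (by omega) hc this
      · left; exact hc
    have hall : ∀ k, m (N + k) = true := by
      intro k
      induction k with
      | zero => exact hN
      | succ k ih =>
        rcases hno k with h | h
        · have := hmt _ ih
          rw [if_neg h] at this
          exact this
        · rw [h] at ih; cases ih
    obtain ⟨k, hk⟩ := greedy_excess β hβ1 h2 (fun k => y (N + k)) (fun k => ε (N + k))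
      (hbd _).1 (by have := (hbd (N + 0)).2; nlinarith) (fun n => het _ (hall n))
      (fun n => hy (N + n)) (fun k => d (N + k) - d N)
      (fun n => by have := hd (N + n); rw [← add_assoc]; linarith) (|η * N - d N| + 1)
    rw [← hη] at hk
    have hab := le_abs_self (η * N - d N)
    rcases k with _ | k
    · simp at hk
      linarith [abs_nonneg (η * N - d N)]
    · rcases hno k with h | h
      · apply h
        have has : N + (k + 1) = N + k + 1 := rfl
        rw [has] at hk
        push_cast at hk ⊢
        nlinarith
      · rw [hall] at h; cases h
  have hdn : ∀ N, m N = false → ∃ n, N < n ∧ d n ≤ -(η * n) ∧ m n = true := by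
    intro N hN
    by_contra hcon
    push Not at hcon
    have hno : ∀ k, ¬ d (N + k + 1) ≤ -(η * ((N + k + 1 : ℕ) : ℝ)) ∨ m (N + k) = true := by
      intro k
      by_cases hc : d (N + k + 1) ≤ -(η * ((N + k + 1 : ℕ) : ℝ))
      · right
        by_contra hm
        have hm' : m (N + k) = false := by simpa using hm
        have := hmf _ hm'
        rw [if_pos hc] at this
        exact hcon _ (by omega) hc this
      · left; exact hc
    have hall : ∀ k, m (N + k) = false := by
      intro k
      induction k with
      | zero => exact hN
      | succ k ih =>
        rcases hno k with h | h
        · have := hmf _ ih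
          rw [if_neg h] at this
          exact this
        · rw [h] at ih; cases ih
    have hcast : ∀ n, ((1 - ε n : ℕ) : ℝ) = 1 - (ε n : ℝ) := fun n => by
      rw [Nat.cast_sub (hε1 n)]; simp
    obtain ⟨k, hk⟩ := greedy_excess β hβ1 h2 (fun k => L - y (N + k)) (fun k => 1 - ε (N + k))
      (by have := (hbd (N + 0)).2; linarith)
      (by have := (hbd (N + 0)).1; nlinarith)
      (fun n => by
        rw [hef _ (hall n)]
        split_ifs <;> simp)
      (fun n => by
        have := hy (N + n)
        simp only [hcast]
        rw [← add_assoc, this]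
        linear_combination -hL1)
      (fun k => d N - d (N + k))
      (fun n => by
        have := hd (N + n)
        simp only [hcast]
        rw [← add_assoc]; linarith) (|η * N + d N| + 1)
    rw [← hη] at hk
    have hab := le_abs_self (η * N + d N)
    rcases k with _ | k
    · simp at hk
      linarith [abs_nonneg (η * N + d N)]
    · rcases hno k with h | h
      · apply h
        have has : N + (k + 1) = N + k + 1 := rfl
        rw [has] at hk
        push_cast at hk ⊢
        nlinarith
      · rw [hall] at h; cases h
  have hupf : ∀ N, ∃ n, N < n ∧ η * n ≤ d n := by
    intro N
    cases hm : m N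
    · obtain ⟨n, hn, -, hmn⟩ := hdn N hm
      obtain ⟨n', hn', h', -⟩ := hup n hmn
      exact ⟨n', by omega, h'⟩
    · obtain ⟨n', hn', h', -⟩ := hup N hm
      exact ⟨n', by omega, h'⟩
  have hdnf : ∀ N, ∃ n, N < n ∧ d n ≤ -(η * n) := by
    intro N
    cases hm : m N
    · obtain ⟨n', hn', h', -⟩ := hdn N hm
      exact ⟨n', by omega, h'⟩
    · obtain ⟨n, hn, -, hmn⟩ := hup N hm
      obtain ⟨n', hn', h', -⟩ := hdn n hmn
      exact ⟨n', by omega, h'⟩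
  have hcount : ∀ n, 2 * (((Finset.range n).filter fun i => ε i = 0).card : ℝ) = n + d n := by
    intro n
    induction n with
    | zero => simp [d0]
    | succ n ih =>
      rw [Finset.range_add_one, Finset.filter_insert, hd]
      have := hε1 n
      split_ifs with h
      · rw [Finset.card_insert_of_notMem (by simp), h]
        push_cast; linarith
      · have h1 : ε n = 1 := by omega
        rw [h1]; push_cast; linarith
  have hzf : ∀ n, 0 < n → zeroFreq ε n = 1 / 2 + d n / n / 2 := by
    intro n hn
    have hn' : (0 : ℝ) < n := by exact_mod_cast hn
    have := hcount n
    unfold zeroFreq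
    field_simp
    linarith
  refine ⟨ε, ⟨hε1, ?_⟩, ?_⟩
  · have hβ0 : 0 < β := by linarith
    have hpart : ∀ n, ∑ i ∈ Finset.range n, (ε i : ℝ) / β ^ (i + 1) = x - y n * (β⁻¹) ^ n := by
      intro n
      induction n with
      | zero => simp [y0]
      | succ n ih =>
        rw [Finset.sum_range_succ, ih, hy]
        rw [inv_pow, inv_pow]
        field_simp
        ring
    symm
    apply HasSum.tsum_eq
    rw [hasSum_iff_tendsto_nat_of_nonneg (fun i => by positivity)]
    simp only [hpart]
    have ht : Tendsto (fun n : ℕ => (β⁻¹) ^ n) atTop (𝓝 0) :=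
      tendsto_pow_atTop_nhds_zero_of_lt_one (by positivity) (inv_lt_one_of_one_lt₀ hβ1)
    have ht2 : Tendsto (fun n : ℕ => y n * (β⁻¹) ^ n) atTop (𝓝 0) := by
      apply squeeze_zero (g := fun n : ℕ => L * (β⁻¹) ^ n)
      · intro n
        have := (hbd n).1
        positivity
      · intro n
        exact mul_le_mul_of_nonneg_right (hbd n).2.le (by positivity)
      · simpa using ht.const_mul L
    simpa using ht2.const_sub x
  · rintro ⟨p, hp⟩
    have hA : 1 / 2 + η / 2 ≤ p := by
      by_contra hc
      push Not at hc
      obtain ⟨N, hN⟩ := eventually_atTop.1 (hp.eventually (gt_mem_nhds hc))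
      obtain ⟨n, hn, h⟩ := hupf N
      have h3 := hN n hn.le
      rw [hzf n (by omega)] at h3
      have hn' : (0 : ℝ) < n := by exact_mod_cast (by omega : 0 < n)
      have := (le_div_iff₀ hn').2 h
      linarith
    have hB : p ≤ 1 / 2 - η / 2 := by
      by_contra hc
      push Not at hc
      obtain ⟨N, hN⟩ := eventually_atTop.1 (hp.eventually (lt_mem_nhds hc))
      obtain ⟨n, hn, h⟩ := hdnf N
      have h3 := hN n hn.le
      rw [hzf n (by omega)] at h3
      have hn' : (0 : ℝ) < n := by exact_mod_cast (by omega : 0 < n)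
      have := (div_le_iff₀ hn').2 (by linarith : d n ≤ (-η) * n)
      linarith
    linarith
end

section
/- Let β ∈ (1, (1+√5)/2). Then there exists a constant c = c(β) > 0 such that for every x ∈ (0, 1/(β−1)) and every p ∈ [1/2 − c, 1/2 + c], there exists a β-expansion (ε_i) of x whose frequency of zeros exists and equals p, i.e., lim_{n→∞} #{1 ≤ i ≤ n : ε_i = 0}/n = p. -/
namespace BetaFreq

/-- Signed digit. -/
def sg (b : Bool) : ℝ := if b then 1 else -1

/-- Run a word of signed digits from `y`. -/
def run (β : ℝ) : List Bool → ℝ → ℝ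
  | [], y => y
  | b :: l, y => run β l (β * y - sg b)

/-- Sum of signed digits. -/
def tot : List Bool → ℝ
  | [] => 0
  | b :: l => sg b + tot l

lemma run_append (β : ℝ) (l m : List Bool) (y : ℝ) :
    run β (l ++ m) y = run β m (run β l y) := by
  induction l generalizing y with
  | nil => rfl
  | cons b l ih => simp [run, ih]

lemma tot_append (l m : List Bool) : tot (l ++ m) = tot l + tot m := by
  induction l with
  | nil => simp [tot]
  | cons b l ih => simp [tot, ih, add_assoc]

lemma sg_not (b : Bool) : sg (!b) = - sg b := by cases b <;> simp [sg]

lemma abs_sg (b : Bool) : |sg b| = 1 := by cases b <;> simp [sg]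

lemma run_not (β : ℝ) (l : List Bool) (y : ℝ) :
    run β (l.map not) (-y) = - run β l y := by
  induction l generalizing y with
  | nil => rfl
  | cons b l ih =>
    simp only [List.map, run, sg_not]
    rw [← ih]; congr 1; ring

lemma tot_not (l : List Bool) : tot (l.map not) = - tot l := by
  induction l with
  | nil => simp [tot]
  | cons b l ih => simp only [List.map, tot, sg_not, ih]; ring

lemma abs_tot (l : List Bool) : |tot l| ≤ l.length := by
  induction l with
  | nil => simp [tot]
  | cons b l ih =>
    simp only [tot, List.length_cons]
    push_cast
    have := abs_add_le (sg b) (tot l)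
    rw [abs_sg] at this
    linarith

lemma down (β R s : ℝ) (hβ : 1 < β) (hR : R * (β - 1) = 1) (M : ℕ) : ∀ y, s < y →
    R - s ≤ β ^ M * (R - y) →
    ∃ l : List Bool, l.length ≤ M ∧ 1 ≤ tot l ∧ β * s - 1 ≤ run β l y ∧ run β l y ≤ s := by
  induction M with
  | zero => intro y h1 h2; simp at h2; linarith
  | succ M ih =>
    intro y h1 h2
    have h3 : β * s - 1 ≤ β * y - 1 := by nlinarith
    by_cases h : β * y - 1 ≤ s
    · exact ⟨[true], by simp, by simp [tot, sg], by simpa [run, sg] using h3,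
        by simpa [run, sg] using h⟩
    · push Not at h
      obtain ⟨l, l1, l2, l3, l4⟩ := ih (β * y - 1) h (by
        have : R - (β * y - 1) = β * (R - y) := by linarith
        rw [this]; rw [pow_succ] at h2; linarith)
      refine ⟨true :: l, by simpa using l1, ?_, by simpa [run, sg] using l3,
        by simpa [run, sg] using l4⟩
      simp only [tot, sg]; simp; linarith

lemma up (β a s : ℝ) (_hβ : 1 < β) (ha : a * (β + 1) = 1) (M : ℕ) : ∀ y, y ≤ s →
    s + a < (β ^ 2) ^ M * (y + a) →
    ∃ l : List Bool, l.length ≤ 2 * M ∧ tot l = 0 ∧ s < run β l y ∧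
      run β l y ≤ β ^ 2 * s + β - 1 := by
  induction M with
  | zero => intro y h1 h2; simp at h2; linarith
  | succ M ih =>
    intro y h1 h2
    have h3 : β ^ 2 * y + β - 1 ≤ β ^ 2 * s + β - 1 := by
      have := mul_le_mul_of_nonneg_left h1 (sq_nonneg β); linarith
    have e : β * (β * y - sg false) - sg true = β ^ 2 * y + β - 1 := by simp [sg]; ring
    by_cases h : s < β ^ 2 * y + β - 1
    · exact ⟨[false, true], by simp, by simp [tot, sg], by simp only [run, e]; exact h,
        by simp only [run, e]; exact h3⟩
    · push Not at h
      obtain ⟨l, l1, l2, l3, l4⟩ := ih (β ^ 2 * y + β - 1) h (by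
        have : β ^ 2 * y + β - 1 + a = β ^ 2 * (y + a) := by linear_combination (1 - β) * ha
        rw [this]; rw [pow_succ] at h2; linarith)
      refine ⟨false :: true :: l, by simp; omega, ?_, by simp only [run, e]; exact l3,
        by simp only [run, e]; exact l4⟩
      simp only [tot, sg, l2]; simp

lemma words (β : ℝ) (hβ1 : 1 < β) (hβ2 : β < (1 + Real.sqrt 5) / 2) :
    ∃ s : ℝ, 0 < s ∧ 0 < β * s - 1 + s ∧ s < 1 / (β - 1) ∧ ∃ N : ℕ, ∀ y, -s ≤ y → y ≤ s →
      ∃ l : List Bool, l.length ≤ N ∧ 1 ≤ tot l ∧ -s ≤ run β l y ∧ run β l y ≤ s := by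
  have hb : β ^ 2 - β - 1 < 0 := by
    have h5 : Real.sqrt 5 ^ 2 = 5 := Real.sq_sqrt (by norm_num)
    have h6 : 0 ≤ Real.sqrt 5 := Real.sqrt_nonneg 5
    nlinarith
  obtain ⟨R, hRdef⟩ : ∃ R, R = 1 / (β - 1) := ⟨_, rfl⟩
  obtain ⟨a, hadef⟩ : ∃ a, a = 1 / (β + 1) := ⟨_, rfl⟩
  have hR : R * (β - 1) = 1 := by rw [hRdef]; field_simp [show β - 1 ≠ 0 by linarith]
  have ha : a * (β + 1) = 1 := by rw [hadef]; field_simp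
  have ha0 : 0 < a := by rw [hadef]; positivity
  have hRpos : 0 < R := by rw [hRdef]; apply div_pos <;> linarith
  have key : β ^ 2 * a + β - 1 < R := by
    have e : (R - (β ^ 2 * a + β - 1)) * ((β - 1) * (β + 1)) = -2 * β * (β ^ 2 - β - 1) := by
      linear_combination (β + 1) * hR - β ^ 2 * (β - 1) * ha
    have : 0 < (R - (β ^ 2 * a + β - 1)) * ((β - 1) * (β + 1)) := by rw [e]; nlinarith
    have h2 : 0 < (β - 1) * (β + 1) := by nlinarith
    have := (pos_iff_pos_of_mul_pos this).2 h2
    linarith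
  have hab : a < 1 / β := by rw [hadef]; apply one_div_lt_one_div_of_lt <;> linarith
  have hb2 : 0 < β ^ 2 := by positivity
  have key2 : a < (R - β + 1) / β ^ 2 := by rw [lt_div_iff₀ hb2]; linarith
  obtain ⟨s, hs1, hs2⟩ := exists_between (lt_min hab key2)
  have hs3 : s < 1 / β := hs2.trans_le (min_le_left _ _)
  have hs4 : s < (R - β + 1) / β ^ 2 := hs2.trans_le (min_le_right _ _)
  rw [lt_div_iff₀ (by linarith)] at hs3
  rw [lt_div_iff₀ hb2] at hs4
  have hs0 : 0 < s := ha0.trans hs1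
  have hK : 0 < β * s - 1 + s := by nlinarith
  obtain ⟨t, ht⟩ : ∃ t, t = β ^ 2 * s + β - 1 := ⟨_, rfl⟩
  have htR : 0 < R - t := by linarith
  have hst : s < t := by nlinarith
  obtain ⟨M2, hM2⟩ : ∃ M : ℕ, R - s ≤ β ^ M * (R - t) := by
    obtain ⟨M, hM⟩ := pow_unbounded_of_one_lt ((R - s) / (R - t)) hβ1
    exact ⟨M, by rw [div_lt_iff₀ htR] at hM; exact hM.le⟩
  have hg : 0 < β * s - 1 + a := by nlinarith
  obtain ⟨M1, hM1⟩ : ∃ M : ℕ, s + a < (β ^ 2) ^ M * (β * s - 1 + a) := by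
    obtain ⟨M, hM⟩ := pow_unbounded_of_one_lt ((s + a) / (β * s - 1 + a))
      (show 1 < β ^ 2 by nlinarith)
    exact ⟨M, by rw [div_lt_iff₀ hg] at hM; exact hM⟩
  have hdown : ∀ y, s < y → y ≤ t → ∃ l : List Bool, l.length ≤ M2 ∧ 1 ≤ tot l ∧
      β * s - 1 ≤ run β l y ∧ run β l y ≤ s := by
    intro y h1 h2
    apply down β R s hβ1 hR M2 y h1
    have : β ^ M2 * (R - t) ≤ β ^ M2 * (R - y) := by gcongr
    linarith
  have hgood : ∀ y, β * s - 1 ≤ y → y ≤ s → ∃ l : List Bool, l.length ≤ 2 * M1 + M2 ∧ 1 ≤ tot l ∧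
      β * s - 1 ≤ run β l y ∧ run β l y ≤ s := by
    intro y h1 h2
    obtain ⟨l, l1, l2, l3, l4⟩ := up β a s hβ1 ha M1 y h2 (by
      have : (β ^ 2) ^ M1 * (β * s - 1 + a) ≤ (β ^ 2) ^ M1 * (y + a) := by gcongr
      linarith)
    obtain ⟨m, m1, m2, m3, m4⟩ := hdown _ l3 (by rw [ht]; exact l4)
    refine ⟨l ++ m, by simp; omega, by rw [tot_append]; linarith, ?_, ?_⟩ <;>
      rw [run_append] <;> assumption
  refine ⟨s, hs0, hK, by rw [← hRdef]; linarith, 1 + 2 * (2 * M1 + M2), fun y h1 h2 => ?_⟩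
  by_cases hy : β * s - 1 ≤ y
  · obtain ⟨l, l1, l2, l3, l4⟩ := hgood y hy h2
    exact ⟨l, by omega, l2, by linarith, l4⟩
  push Not at hy
  have e : β * y - sg false = β * y + 1 := by simp [sg]
  obtain ⟨l, l1, l2, l3, l4⟩ : ∃ l : List Bool, l.length ≤ 2 * M1 + M2 ∧ 1 ≤ tot l ∧
      β * s - 1 ≤ run β l (β * y + 1) ∧ run β l (β * y + 1) ≤ s := by
    by_cases h : β * y + 1 ≤ s
    · exact hgood _ (by nlinarith) h
    · obtain ⟨l, l1, l2⟩ := hdown (β * y + 1) (by linarith) (by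
        have := mul_le_mul_of_nonneg_left hy.le (show 0 ≤ β by linarith)
        nlinarith)
      exact ⟨l, by omega, l2⟩
  obtain ⟨m, m1, m2, m3, m4⟩ := hgood _ l3 l4
  refine ⟨false :: (l ++ m), by simp; omega, ?_, ?_, ?_⟩
  · simp only [tot, tot_append, sg]; simp; linarith
  · simp only [run, run_append, e]; linarith
  · simp only [run, run_append, e]; exact m4

lemma entry (β s : ℝ) (hβ1 : 1 < β) (hK : 0 < β * s - 1 + s)
    (y : ℝ) (hy1 : -(1 / (β - 1)) < y) (hy2 : y < 1 / (β - 1)) :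
    ∃ l : List Bool, -s ≤ run β l y ∧ run β l y ≤ s := by
  have hR : 1 / (β - 1) * (β - 1) = 1 := by field_simp [show β - 1 ≠ 0 by linarith]
  have main : ∀ y, s < y → y < 1 / (β - 1) → ∃ l : List Bool, -s ≤ run β l y ∧ run β l y ≤ s := by
    intro y h1 h2
    have h3 : 0 < 1 / (β - 1) - y := by linarith
    obtain ⟨M, hM⟩ := pow_unbounded_of_one_lt ((1 / (β - 1) - s) / (1 / (β - 1) - y)) hβ1
    rw [div_lt_iff₀ h3] at hM
    obtain ⟨l, _, _, l3, l4⟩ := down β _ s hβ1 hR M y h1 hM.le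
    exact ⟨l, by linarith, l4⟩
  by_cases h : s < y
  · exact main y h hy2
  by_cases h' : s < -y
  · obtain ⟨l, l1, l2⟩ := main (-y) h' (by linarith)
    have := run_not β l (-y)
    rw [neg_neg] at this
    exact ⟨l.map not, by linarith, by linarith⟩
  · exact ⟨[], by simp only [run]; linarith, by simp only [run]; linarith⟩

/-- Invariant: a bounded word brings the state back to the core. -/
def Inv (β s q C : ℝ) (N : ℕ) (z : ℝ × ℝ) : Prop :=
  ∃ l : List Bool, l.length ≤ N ∧ |run β l z.1| ≤ s ∧ |z.2 + tot l - q * l.length| ≤ C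

lemma run_bound (β R : ℝ) (hβ : 1 < β) (hR : R * (β - 1) = 1) (l : List Bool) :
    ∀ y, |run β l y| ≤ R → |y| ≤ R := by
  induction l with
  | nil => intro y h; exact h
  | cons b l ih =>
    intro y h
    have h1 := ih _ h
    have h2 := abs_le.1 h1
    have h3 := abs_le.1 (abs_sg b).le
    rw [abs_le]
    constructor <;> nlinarith

lemma Inv_step (β s q : ℝ) (N : ℕ) (hq : |q| ≤ 1) (N₀ : ℕ) (hN : N₀ ≤ N) (hqN : |q| * N₀ ≤ 1)
    (hw : ∀ y, -s ≤ y → y ≤ s →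
      ∃ l : List Bool, l.length ≤ N₀ ∧ 1 ≤ tot l ∧ -s ≤ run β l y ∧ run β l y ≤ s)
    (z : ℝ × ℝ) (hz : Inv β s q (2 * N) N z) :
    ∃ b : Bool, Inv β s q (2 * N) N (β * z.1 - sg b, z.2 + sg b - q) := by
  have cons : ∀ (b : Bool) (l : List Bool), (b :: l).length ≤ N → |run β (b :: l) z.1| ≤ s →
      |z.2 + tot (b :: l) - q * (b :: l).length| ≤ 2 * N →
      ∃ b : Bool, Inv β s q (2 * N) N (β * z.1 - sg b, z.2 + sg b - q) := by
    intro b l h1 h2 h3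
    refine ⟨b, l, by simp at h1; omega, h2, ?_⟩
    convert h3 using 2
    simp only [tot, List.length_cons]; push_cast; ring
  obtain ⟨l, l1, l2, l3⟩ := hz
  match l, l1, l2, l3 with
  | b :: l, l1, l2, l3 => exact cons b l l1 l2 l3
  | [], l1, l2, l3 =>
    simp only [run, tot, List.length_nil] at l2 l3
    have l2' := abs_le.1 l2
    have l3' := abs_le.1 l3
    simp at l3'
    have bd : ∀ l : List Bool, l.length ≤ N₀ →
        |q * l.length| ≤ 1 ∧ |tot l - q * l.length| ≤ 2 * N := by
      intro l hl
      have hl1 : (l.length : ℝ) ≤ N₀ := by exact_mod_cast hl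
      have hl2 : (N₀ : ℝ) ≤ N := by exact_mod_cast hN
      have hl0 : (0 : ℝ) ≤ l.length := Nat.cast_nonneg _
      have h4 : |q * l.length| = |q| * l.length := by
        rw [abs_mul, abs_of_nonneg hl0]
      have h5 := abs_tot l
      have h6 := abs_sub (tot l) (q * l.length)
      have h7 : |q| * l.length ≤ 1 * l.length := by gcongr
      have h8 : |q| * l.length ≤ |q| * N₀ := by gcongr
      constructor <;> linarith
    rcases le_total z.2 0 with h0 | h0
    · obtain ⟨l, h1, h2, h3, h4⟩ := hw z.1 l2'.1 l2'.2
      obtain ⟨b1, b2⟩ := bd l h1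
      rcases l with _ | ⟨b, l⟩
      · simp [tot] at h2; linarith
      · have b1' := abs_le.1 b1
        have b2' := abs_le.1 b2
        exact cons b l (h1.trans hN) (abs_le.2 ⟨h3, h4⟩) (abs_le.2 ⟨by linarith, by linarith⟩)
    · obtain ⟨l, h1, h2, h3, h4⟩ := hw (-z.1) (by linarith) (by linarith)
      have hr := run_not β l (-z.1)
      rw [neg_neg] at hr
      have ht := tot_not l
      have hlen : (l.map not).length ≤ N₀ := by simpa using h1
      generalize l.map not = l' at *
      obtain ⟨b1, b2⟩ := bd l' hlen
      rcases l' with _ | ⟨b, l'⟩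
      · simp [tot] at ht; linarith
      · have b1' := abs_le.1 b1
        have b2' := abs_le.1 b2
        exact cons b l' (hlen.trans hN) (abs_le.2 ⟨by linarith, by linarith⟩)
          (abs_le.2 ⟨by linarith, by linarith⟩)

lemma Inv_bound (β s q C R : ℝ) (N : ℕ) (hβ : 1 < β) (hR : R * (β - 1) = 1) (hs : s ≤ R)
    (hq : |q| ≤ 1) (z : ℝ × ℝ) (hz : Inv β s q C N z) : |z.1| ≤ R ∧ |z.2| ≤ C + 2 * N := by
  obtain ⟨l, l1, l2, l3⟩ := hz
  refine ⟨run_bound β R hβ hR l _ (l2.trans hs), ?_⟩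
  have hl : (l.length : ℝ) ≤ N := by exact_mod_cast l1
  have h5 := abs_tot l
  have h4 : |q * l.length| ≤ 1 * l.length := by
    rw [abs_mul, abs_of_nonneg (Nat.cast_nonneg l.length : (0:ℝ) ≤ _)]; gcongr
  rw [abs_le] at *
  constructor <;> linarith [h4.1, h4.2, h5.1, h5.2, l3.1, l3.2]

end BetaFreq

open BetaFreq in
theorem exists_expansion_with_prescribed_frequency
    (β : ℝ) (hβ1 : 1 < β) (hβ2 : β < (1 + Real.sqrt 5) / 2) :
    ∃ c : ℝ, 0 < c ∧
      ∀ x ∈ Set.Ioo (0 : ℝ) (1 / (β - 1)),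
        ∀ p ∈ Set.Icc (1 / 2 - c) (1 / 2 + c),
          ∃ ε : ℕ → ℕ, isExpansion β x ε ∧
            Filter.Tendsto (zeroFreq ε) Filter.atTop (nhds p) := by
  obtain ⟨s, hs0, hK, hsR, N₀, hw⟩ := words β hβ1 hβ2
  have hN0 : (0 : ℝ) ≤ N₀ := Nat.cast_nonneg _
  refine ⟨1 / (2 * (N₀ + 1)), by positivity, ?_⟩
  rintro x ⟨hx0, hx1⟩ p ⟨hp0, hp1⟩
  have hR : 1 / (β - 1) * (β - 1) = 1 := by field_simp [show β - 1 ≠ 0 by linarith]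
  obtain ⟨l₀, l01, l02⟩ := entry β s hβ1 hK (2 * x - 1 / (β - 1)) (by linarith) (by linarith)
  generalize 1 / (β - 1) = R at *
  obtain ⟨q, hqdef⟩ : ∃ q, q = 1 - 2 * p := ⟨_, rfl⟩
  have hq' : |q| ≤ 1 / (N₀ + 1) := by
    have e : 2 * (1 / (2 * ((N₀ : ℝ) + 1))) = 1 / (N₀ + 1) := by field_simp
    rw [abs_le]; constructor <;> linarith
  rw [le_div_iff₀ (by positivity)] at hq'
  have hqa := abs_nonneg q
  have hq : |q| ≤ 1 := by nlinarith
  have hqN : |q| * N₀ ≤ 1 := by nlinarith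
  obtain ⟨N, hNdef⟩ : ∃ N, N = max N₀ l₀.length := ⟨_, rfl⟩
  have hN : N₀ ≤ N := by omega
  have hNl : l₀.length ≤ N := by omega
  have hstep := Inv_step β s q N hq N₀ hN hqN hw
  have hinit : Inv β s q (2 * N) N (2 * x - R, 0) := by
    refine ⟨l₀, hNl, abs_le.2 ⟨l01, l02⟩, ?_⟩
    have h1 := abs_tot l₀
    have h2 : |q * l₀.length| ≤ 1 * l₀.length := by
      rw [abs_mul, abs_of_nonneg (Nat.cast_nonneg l₀.length : (0:ℝ) ≤ _)]; gcongr
    have h3 : (l₀.length : ℝ) ≤ N := by exact_mod_cast hNl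
    rw [abs_le] at *
    constructor <;> simp only <;> linarith [h1.1, h1.2, h2.1, h2.2]
  choose! f hf using hstep
  let z : ℕ → ℝ × ℝ := fun n => Nat.rec (2 * x - R, 0)
    (fun _ w => (β * w.1 - sg (f w), w.2 + sg (f w) - q)) n
  have hz0 : z 0 = (2 * x - R, 0) := rfl
  have hz1 : ∀ n, z (n + 1) = (β * (z n).1 - sg (f (z n)), (z n).2 + sg (f (z n)) - q) :=
    fun n => rfl
  clear_value z
  have hI : ∀ n, Inv β s q (2 * N) N (z n) := by
    intro n
    induction n with
    | zero => rw [hz0]; exact hinit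
    | succ n ih => rw [hz1]; exact hf _ ih
  have hB := fun n => Inv_bound β s q (2 * N) R N hβ1 hR hsR.le hq (z n) (hI n)
  let ε : ℕ → ℕ := fun n => if f (z n) then 1 else 0
  have hε : ∀ n, ε n = if f (z n) then 1 else 0 := fun n => rfl
  clear_value ε
  have hε1 : ∀ n, (ε n : ℝ) = (1 + sg (f (z n))) / 2 := by
    intro n; rw [hε, sg]; cases f (z n) <;> norm_num
  have hβ0 : 0 < β := by linarith
  refine ⟨ε, ⟨fun i => by rw [hε]; split <;> simp, ?_⟩, ?_⟩
  · have hsum : ∀ n, ∑ i ∈ Finset.range n, (ε i : ℝ) / β ^ (i + 1) =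
        x - ((z n).1 + R) / 2 * (1 / β) ^ n := by
      intro n
      induction n with
      | zero => simp [hz0]
      | succ n ih =>
        rw [Finset.sum_range_succ, ih, hz1, hε1]
        simp only [one_div, inv_pow]
        field_simp
        linear_combination (-(β ^ n)) * hR
    symm
    apply HasSum.tsum_eq
    rw [hasSum_iff_tendsto_nat_of_nonneg (fun i => by positivity)]
    simp only [hsum]
    have h0 : Filter.Tendsto (fun n => ((z n).1 + R) / 2 * (1 / β) ^ n) Filter.atTop (nhds 0) := by
      have hp := tendsto_pow_atTop_nhds_zero_of_lt_one (r := 1 / β) (by positivity)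
        (by rw [div_lt_one hβ0]; exact hβ1)
      have hp' := hp.const_mul R
      rw [mul_zero] at hp'
      refine squeeze_zero (fun n => ?_) (fun n => ?_) hp'
      · have := abs_le.1 (hB n).1
        have : 0 ≤ ((z n).1 + R) / 2 := by linarith
        positivity
      · have := abs_le.1 (hB n).1
        gcongr
        linarith
    simpa using h0.const_sub x
  · have hcard : ∀ n : ℕ, (((Finset.range n).filter fun i => ε i = 0).card : ℝ) =
        p * n - (z n).2 / 2 := by
      intro n
      induction n with
      | zero => simp [hz0]
      | succ n ih =>
        rw [Finset.range_add_one, Finset.filter_insert, hz1]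
        split_ifs with h
        · rw [Finset.card_insert_of_notMem (by simp)]
          have := hε1 n
          rw [h] at this
          push_cast at this ⊢
          rw [ih]; linarith
        · have h1 : ε n = 1 := by
            have := hε n
            split at this <;> omega
          have := hε1 n
          rw [h1] at this
          push_cast at this ⊢
          rw [ih]; linarith
    have h0 : Filter.Tendsto (fun n : ℕ => (z n).2 / 2 / (n : ℝ)) Filter.atTop (nhds 0) := by
      have hc := tendsto_const_div_atTop_nhds_zero_nat (2 * (N : ℝ) + 2 * N)
      refine squeeze_zero_norm (fun n => ?_) hc
      rw [Real.norm_eq_abs, abs_div, abs_div, abs_of_nonneg (Nat.cast_nonneg n : (0:ℝ) ≤ n)]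
      have h1 := (hB n).2
      have h2 := abs_nonneg (z n).2
      gcongr
      norm_num
      linarith
    have h1 := h0.const_sub p
    rw [sub_zero] at h1
    refine h1.congr' ?_
    filter_upwards [Filter.eventually_gt_atTop 0] with n hn
    have hn' : (n : ℝ) ≠ 0 := by positivity
    rw [zeroFreq, hcard]
    field_simp
end

section
/- Let β ∈ (1,2). Then Lebesgue almost every x ∈ [0, 1/(β−1)] has a simply normal β-expansion; that is, the set of x ∈ [0, 1/(β−1)] which do not admit any simply normal β-expansion has Lebesgue measure zero. -/
open MeasureTheory Filter Topology ProbabilityTheory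

noncomputable section
namespace SN

/-- value of a finite word -/
def lo (β : ℝ) : List Bool → ℝ
  | [] => 0
  | b :: w => ((if b then 1 else 0) + lo β w) / β

/-- length of the cylinder interval of a word -/
def sz (β : ℝ) (w : List Bool) : ℝ := (1 / (β - 1)) / β ^ w.length

/-- the open cylinder interval of a word -/
def cyl (β : ℝ) (w : List Bool) : Set ℝ := Set.Ioo (lo β w) (lo β w + sz β w)

lemma sz_pos {β : ℝ} (hβ : β ∈ Set.Ioo (1 : ℝ) 2) (w : List Bool) : 0 < sz β w := by
  have h1 : 0 < β - 1 := by linarith [hβ.1]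
  have h2 : 0 < β := by linarith [hβ.1]
  unfold sz; positivity

lemma lo_append {β : ℝ} (hβ : β ∈ Set.Ioo (1 : ℝ) 2) (u v : List Bool) :
    lo β (u ++ v) = lo β u + lo β v / β ^ u.length := by
  have h2 : 0 < β := by linarith [hβ.1]
  induction u with
  | nil => simp [lo]
  | cons b u ih =>
    simp only [List.cons_append, lo, ih, List.length_cons, pow_succ]
    field_simp
    ring

lemma lo_not {β : ℝ} (hβ : β ∈ Set.Ioo (1 : ℝ) 2) (w : List Bool) :
    lo β (w.map not) = 1 / (β - 1) - lo β w - sz β w := by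
  have h1 : 0 < β - 1 := by linarith [hβ.1]
  have h2 : 0 < β := by linarith [hβ.1]
  induction w with
  | nil => simp [lo, sz]
  | cons b u ih =>
    simp only [List.map_cons, lo, ih, sz, List.length_cons, pow_succ]
    cases b <;> simp <;> field_simp <;> ring

lemma sz_not (β : ℝ) (w : List Bool) : sz β (w.map not) = sz β w := by simp [sz]

lemma exists_word {β : ℝ} (hβ : β ∈ Set.Ioo (1 : ℝ) 2) (n : ℕ) :
    ∀ x : ℝ, 0 ≤ x → x ≤ 1 / (β - 1) →
      ∃ w : List Bool, w.length = n ∧ lo β w ≤ x ∧ x ≤ lo β w + sz β w := by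
  have h1 : 0 < β - 1 := by linarith [hβ.1]
  have h2 : 0 < β := by linarith [hβ.1]
  have h3 : 1 ≤ 1 / (β - 1) := by rw [le_div_iff₀ h1]; linarith [hβ.2]
  have hM : β * (1 / (β - 1)) = 1 / (β - 1) + 1 := by field_simp; ring
  induction n with
  | zero => intro x hx0 hx; exact ⟨[], rfl, by simpa [lo], by simpa [lo, sz] using hx⟩
  | succ n ih =>
    intro x hx0 hx
    have key : ∀ b : Bool, 0 ≤ β * x - (if b then 1 else 0) →
        β * x - (if b then 1 else 0) ≤ 1 / (β - 1) →
        ∃ w : List Bool, w.length = n + 1 ∧ lo β w ≤ x ∧ x ≤ lo β w + sz β w := by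
      intro b hb1 hb2
      obtain ⟨w, hw, hl, hh⟩ := ih _ hb1 hb2
      refine ⟨b :: w, by simp [hw], ?_, ?_⟩
      · rw [lo, div_le_iff₀ h2]; linarith
      · have : sz β (b :: w) = sz β w / β := by
          simp only [sz, List.length_cons, pow_succ]; field_simp
        rw [lo, this, ← add_div, le_div_iff₀ h2]; linarith
    by_cases hc : β * x ≤ 1 / (β - 1)
    · exact key false (by simpa using mul_nonneg h2.le hx0) (by simpa using hc)
    · push Not at hc
      refine key true (by simp only [if_true]; linarith) ?_
      have := mul_le_mul_of_nonneg_left hx h2.le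
      simp only [if_true]; linarith

lemma exists_pick {β : ℝ} (hβ : β ∈ Set.Ioo (1 : ℝ) 2) {a b : ℝ} (ha : 0 ≤ a) (hab : a < b)
    (hb : b ≤ 1 / (β - 1)) :
    ∃ w : List Bool, w ≠ [] ∧ a + (b - a) / 4 ≤ lo β w ∧ lo β w + sz β w ≤ b - (b - a) / 4 ∧
      (b - a) / 8 ≤ sz β w := by
  have h1 : 0 < β - 1 := by linarith [hβ.1]
  have h2 : 0 < β := by linarith [hβ.1]
  have hl : 0 < b - a := by linarith
  obtain ⟨n, hn1, hn2⟩ := exists_nat_pow_near (x := 4 * (1 / (β - 1)) / (b - a)) (y := β)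
    (by rw [le_div_iff₀ hl]; linarith) hβ.1
  obtain ⟨w, hw, hw1, hw2⟩ := exists_word hβ (n + 1) ((a + b) / 2) (by linarith) (by linarith)
  rw [le_div_iff₀ hl] at hn1
  rw [div_lt_iff₀ hl] at hn2
  have hs : sz β w ≤ (b - a) / 4 := by
    rw [sz, hw, div_le_iff₀ (by positivity)]; linarith
  have hs' : (b - a) / 8 ≤ sz β w := by
    rw [sz, hw, le_div_iff₀ (by positivity), pow_succ]
    have hp : 0 ≤ β ^ n * (b - a) := by positivity
    nlinarith [hβ.2]
  refine ⟨w, ?_, by linarith, by linarith, hs'⟩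
  rintro rfl; simp at hw

open Classical in
/-- the chosen tile -/
def pick (β a b : ℝ) : List Bool :=
  if h : ∃ w : List Bool, w ≠ [] ∧ a + (b - a) / 4 ≤ lo β w ∧
      lo β w + sz β w ≤ b - (b - a) / 4 ∧ (b - a) / 8 ≤ sz β w then h.choose else []

lemma pick_spec {β : ℝ} (hβ : β ∈ Set.Ioo (1 : ℝ) 2) {a b : ℝ} (ha : 0 ≤ a) (hab : a < b)
    (hb : b ≤ 1 / (β - 1)) :
    pick β a b ≠ [] ∧ a + (b - a) / 4 ≤ lo β (pick β a b) ∧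
      lo β (pick β a b) + sz β (pick β a b) ≤ b - (b - a) / 4 ∧
      (b - a) / 8 ≤ sz β (pick β a b) := by
  have h := exists_pick hβ ha hab hb
  unfold pick
  rw [dif_pos h]
  exact h.choose_spec

/-- tiles after `k` stages -/
def tiles (β : ℝ) : ℕ → ℝ → ℝ → Finset (List Bool)
  | 0, _, _ => ∅
  | k + 1, a, b => insert (pick β a b)
      (tiles β k a (lo β (pick β a b)) ∪ tiles β k (lo β (pick β a b) + sz β (pick β a b)) b)

lemma tiles_mono (β : ℝ) (k : ℕ) : ∀ a b, tiles β k a b ⊆ tiles β (k + 1) a b := by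
  induction k with
  | zero => intro a b; simp [tiles]
  | succ k ih =>
    intro a b
    rw [tiles, tiles]
    exact Finset.insert_subset_insert _ (Finset.union_subset_union (ih _ _) (ih _ _))

lemma tiles_sub {β : ℝ} (hβ : β ∈ Set.Ioo (1 : ℝ) 2) (k : ℕ) :
    ∀ a b, 0 ≤ a → a < b → b ≤ 1 / (β - 1) → ∀ w ∈ tiles β k a b,
      w ≠ [] ∧ a ≤ lo β w ∧ lo β w + sz β w ≤ b := by
  induction k with
  | zero => intro a b _ _ _ w hw; simp [tiles] at hw
  | succ k ih =>
    intro a b ha hab hb w hw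
    obtain ⟨p0, p1, p2, p3⟩ := pick_spec hβ ha hab hb
    have hs := sz_pos hβ (pick β a b)
    rw [tiles, Finset.mem_insert, Finset.mem_union] at hw
    rcases hw with rfl | hw | hw
    · exact ⟨p0, by linarith, by linarith⟩
    · obtain ⟨q0, q1, q2⟩ := ih _ _ ha (by linarith) (by linarith) w hw
      exact ⟨q0, q1, by linarith⟩
    · obtain ⟨q0, q1, q2⟩ := ih _ _ (by linarith) (by linarith) (by linarith) w hw
      exact ⟨q0, by linarith, q2⟩

lemma cyl_disj {β : ℝ} {u v : List Bool} (h : lo β u + sz β u ≤ lo β v) :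
    Disjoint (cyl β u) (cyl β v) := by
  rw [Set.disjoint_left]
  intro x hx hx'
  exact absurd (hx.2.trans_le h) (not_lt.2 hx'.1.le)

lemma tiles_disj {β : ℝ} (hβ : β ∈ Set.Ioo (1 : ℝ) 2) (k : ℕ) :
    ∀ a b, 0 ≤ a → a < b → b ≤ 1 / (β - 1) →
      ((tiles β k a b : Finset (List Bool)) : Set (List Bool)).PairwiseDisjoint (cyl β) := by
  induction k with
  | zero => intro a b _ _ _; simp [tiles]
  | succ k ih =>
    intro a b ha hab hb
    obtain ⟨p0, p1, p2, p3⟩ := pick_spec hβ ha hab hb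
    have hs := sz_pos hβ (pick β a b)
    have hA := ih a (lo β (pick β a b)) ha (by linarith) (by linarith)
    have hB := ih (lo β (pick β a b) + sz β (pick β a b)) b (by linarith) (by linarith) (by linarith)
    have sA := tiles_sub hβ k a (lo β (pick β a b)) ha (by linarith) (by linarith)
    have sB := tiles_sub hβ k (lo β (pick β a b) + sz β (pick β a b)) b (by linarith) (by linarith)
      (by linarith)
    intro u hu v hv huv
    rw [tiles, Finset.mem_coe, Finset.mem_insert, Finset.mem_union] at hu hv
    rcases hu with rfl | hu | hu <;> rcases hv with rfl | hv | hv
    · exact absurd rfl huv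
    · exact (cyl_disj (sA v hv).2.2).symm
    · exact cyl_disj (sB v hv).2.1
    · exact cyl_disj (sA u hu).2.2
    · exact hA hu hv huv
    · exact cyl_disj (by linarith [(sA u hu).2.2, (sB v hv).2.1])
    · exact (cyl_disj (sB u hu).2.1).symm
    · exact (cyl_disj (by linarith [(sA v hv).2.2, (sB u hu).2.1])).symm
    · exact hB hu hv huv

lemma tiles_sum {β : ℝ} (hβ : β ∈ Set.Ioo (1 : ℝ) 2) (k : ℕ) {a b : ℝ} (ha : 0 ≤ a) (hab : a < b)
    (hb : b ≤ 1 / (β - 1)) (f : List Bool → ℝ) :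
    ∑ w ∈ tiles β (k + 1) a b, f w = f (pick β a b) +
      (∑ w ∈ tiles β k a (lo β (pick β a b)), f w +
       ∑ w ∈ tiles β k (lo β (pick β a b) + sz β (pick β a b)) b, f w) := by
  obtain ⟨p0, p1, p2, p3⟩ := pick_spec hβ ha hab hb
  have hs := sz_pos hβ (pick β a b)
  have sA := tiles_sub hβ k a (lo β (pick β a b)) ha (by linarith) (by linarith)
  have sB := tiles_sub hβ k (lo β (pick β a b) + sz β (pick β a b)) b (by linarith) (by linarith)
      (by linarith)
  rw [tiles, Finset.sum_insert, Finset.sum_union]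
  · rw [Finset.disjoint_left]
    intro u hu hv
    linarith [(sA u hu).2.2, (sB u hv).2.1, sz_pos hβ u]
  · rw [Finset.mem_union]
    rintro (hu | hu)
    · linarith [(sA _ hu).2.2]
    · linarith [(sB _ hu).2.1]

lemma tiles_cover {β : ℝ} (hβ : β ∈ Set.Ioo (1 : ℝ) 2) (k : ℕ) :
    ∀ a b, 0 ≤ a → a < b → b ≤ 1 / (β - 1) →
      (1 - (7 / 8 : ℝ) ^ k) * (b - a) ≤ ∑ w ∈ tiles β k a b, sz β w := by
  induction k with
  | zero => intro a b _ _ _; simp [tiles]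
  | succ k ih =>
    intro a b ha hab hb
    obtain ⟨p0, p1, p2, p3⟩ := pick_spec hβ ha hab hb
    have hs := sz_pos hβ (pick β a b)
    have hA := ih a (lo β (pick β a b)) ha (by linarith) (by linarith)
    have hB := ih (lo β (pick β a b) + sz β (pick β a b)) b (by linarith) (by linarith) (by linarith)
    rw [tiles_sum hβ k ha hab hb]
    have hp : 0 < (7 / 8 : ℝ) ^ k := by positivity
    rw [pow_succ]
    nlinarith

lemma len_bound {β : ℝ} (hβ : β ∈ Set.Ioo (1 : ℝ) 2) {l : ℝ} (hl : 0 < l) (w : List Bool)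
    (h : l / 8 ≤ sz β w) :
    (w.length : ℝ) ≤ - (1 / Real.log β) * Real.log l + Real.log (8 * (1 / (β - 1))) / Real.log β := by
  have h1 : 0 < β - 1 := by linarith [hβ.1]
  have h2 : 0 < β := by linarith [hβ.1]
  have hlog : 0 < Real.log β := Real.log_pos hβ.1
  rw [sz, le_div_iff₀ (by positivity)] at h
  have h' : β ^ w.length * l ≤ 8 * (1 / (β - 1)) := by linarith
  have := Real.log_le_log (by positivity) h'
  rw [Real.log_mul (by positivity) (by positivity), Real.log_pow] at this
  have e : - (1 / Real.log β) * Real.log l + Real.log (8 * (1 / (β - 1))) / Real.log β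
    = (Real.log (8 * (1 / (β - 1))) - Real.log l) / Real.log β := by field_simp; ring
  rw [e, le_div_iff₀ hlog]; linarith

lemma tiles_len {β : ℝ} (hβ : β ∈ Set.Ioo (1 : ℝ) 2) : ∃ A B : ℝ, ∀ k : ℕ, 
    ∀ a b, 0 ≤ a → a < b → b ≤ 1 / (β - 1) →
       ∑ w ∈ tiles β k a b, (w.length : ℝ) * sz β w ≤ (b - a) * (- A * Real.log (b - a) + B) := by
  have h1 : 0 < β - 1 := by linarith [hβ.1]
  set A := 1 / Real.log β with hA
  set A0 := Real.log (8 * (1 / (β - 1))) / Real.log β with hA0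
  have hApos : 0 < A := by have := Real.log_pos hβ.1; positivity
  have hlog4 : 0 < Real.log 4 := Real.log_pos (by norm_num)
  refine ⟨A, A0 + 8 * A * Real.log 4, ?_⟩
  intro k
  induction k with
  | zero =>
    intro a b ha hab hb
    simp only [tiles, Finset.sum_empty]
    apply mul_nonneg (by linarith)
    have hl : Real.log (b - a) ≤ Real.log (8 * (1 / (β - 1))) :=
      Real.log_le_log (by linarith) (by have : 0 < 1 / (β - 1) := by positivity
                                        linarith)
    have : A0 = A * Real.log (8 * (1 / (β - 1))) := by rw [hA0, hA]; ring
    rw [this]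
    nlinarith [mul_pos hApos hlog4]
  | succ k ih =>
    intro a b ha hab hb
    obtain ⟨p0, p1, p2, p3⟩ := pick_spec hβ ha hab hb
    have hs := sz_pos hβ (pick β a b)
    have iA := ih a (lo β (pick β a b)) ha (by linarith) (by linarith)
    have iB := ih (lo β (pick β a b) + sz β (pick β a b)) b (by linarith) (by linarith) (by linarith)
    have hn := len_bound hβ (sub_pos.2 hab) _ p3
    rw [← hA, ← hA0] at hn
    rw [tiles_sum hβ k ha hab hb]
    have hlg : ∀ l, (b - a) / 4 ≤ l → - A * Real.log l ≤ -A * Real.log (b - a) + A * Real.log 4 := by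
      intro l hl
      have := Real.log_le_log (by linarith) hl
      rw [Real.log_div (by linarith) (by norm_num)] at this
      nlinarith
    have gA := hlg (lo β (pick β a b) - a) (by linarith)
    have gB := hlg (b - (lo β (pick β a b) + sz β (pick β a b))) (by linarith)
    set s := sz β (pick β a b)
    set l := lo β (pick β a b)
    set X := -A * Real.log (b - a)
    set Y := A * Real.log 4 with hY
    have hYp : 0 < Y := mul_pos hApos hlog4
    have eB : A0 + 8 * A * Real.log 4 = A0 + 8 * Y := by rw [hY]; ring
    rw [eB] at iA iB ⊢
    have jA : (l - a) * (-A * Real.log (l - a) + (A0 + 8 * Y)) ≤ (l - a) * (X + Y + (A0 + 8 * Y)) :=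
      mul_le_mul_of_nonneg_left (by linarith) (by linarith)
    have jB : (b - (l + s)) * (-A * Real.log (b - (l + s)) + (A0 + 8 * Y)) ≤
        (b - (l + s)) * (X + Y + (A0 + 8 * Y)) :=
      mul_le_mul_of_nonneg_left (by linarith) (by linarith)
    have jn : ((pick β a b).length : ℝ) * s ≤ (X + A0) * s := mul_le_mul_of_nonneg_right hn hs.le
    have : (b - a) / 8 * Y ≤ s * Y := mul_le_mul_of_nonneg_right p3 hYp.le
    nlinarith [mul_pos hs hYp]


lemma vol_cyl (β : ℝ) (w : List Bool) : volume (cyl β w) = ENNReal.ofReal (sz β w) := by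
  simp [cyl, Real.volume_Ioo]

lemma exists_half {β : ℝ} (hβ : β ∈ Set.Ioo (1 : ℝ) 2) {a b : ℝ} (ha : 0 ≤ a) (hab : a < b)
    (hb : b ≤ 1 / (β - 1)) :
    ∃ W : Set (List Bool), (∀ w ∈ W, w ≠ [] ∧ a ≤ lo β w ∧ lo β w + sz β w ≤ b) ∧
      W.PairwiseDisjoint (cyl β) ∧ volume (Set.Ioo a b \ ⋃ w ∈ W, cyl β w) = 0 ∧
      Summable (W.indicator fun w => (w.length : ℝ) * sz β w) := by
  classical
  have hmono : Monotone (fun k => tiles β k a b) :=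
    monotone_nat_of_le_succ fun k => tiles_mono β k a b
  refine ⟨{w | ∃ k, w ∈ tiles β k a b}, ?_, ?_, ?_, ?_⟩
  · rintro w ⟨k, hk⟩
    exact tiles_sub hβ k a b ha hab hb w hk
  · rintro u ⟨k, hk⟩ v ⟨m, hm⟩ huv
    exact tiles_disj hβ (max k m) a b ha hab hb (hmono (le_max_left k m) hk)
      (hmono (le_max_right k m) hm) huv
  · have key : ∀ k : ℕ, volume (Set.Ioo a b \ ⋃ w ∈ {w | ∃ k, w ∈ tiles β k a b}, cyl β w) ≤
        ENNReal.ofReal ((7 / 8 : ℝ) ^ k * (b - a)) := by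
      intro k
      have hsub : (⋃ w ∈ tiles β k a b, cyl β w) ⊆ Set.Ioo a b := by
        intro x hx
        simp only [Set.mem_iUnion] at hx
        obtain ⟨w, hw, hx⟩ := hx
        obtain ⟨_, q1, q2⟩ := tiles_sub hβ k a b ha hab hb w hw
        exact ⟨lt_of_le_of_lt q1 hx.1, lt_of_lt_of_le hx.2 q2⟩
      have hmeas : volume (⋃ w ∈ tiles β k a b, cyl β w) =
          ENNReal.ofReal (∑ w ∈ tiles β k a b, sz β w) := by
        rw [measure_biUnion_finset (tiles_disj hβ k a b ha hab hb) (fun _ _ => measurableSet_Ioo),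
          ENNReal.ofReal_sum_of_nonneg (fun w _ => (sz_pos hβ w).le)]
        exact Finset.sum_congr rfl fun w _ => vol_cyl β w
      calc volume (Set.Ioo a b \ ⋃ w ∈ {w | ∃ k, w ∈ tiles β k a b}, cyl β w)
          ≤ volume (Set.Ioo a b \ ⋃ w ∈ tiles β k a b, cyl β w) := by
            apply measure_mono
            apply Set.sdiff_subset_sdiff_right
            apply Set.biUnion_subset_biUnion_left
            intro w hw; exact ⟨k, hw⟩
        _ = volume (Set.Ioo a b) - volume (⋃ w ∈ tiles β k a b, cyl β w) := by
            apply measure_sdiff hsub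
            · exact (Finset.measurableSet_biUnion _ (fun _ _ => measurableSet_Ioo)).nullMeasurableSet
            · rw [hmeas]; exact ENNReal.ofReal_ne_top
        _ ≤ _ := by
            rw [hmeas, Real.volume_Ioo, ← ENNReal.ofReal_sub _
              (Finset.sum_nonneg fun w _ => (sz_pos hβ w).le)]
            apply ENNReal.ofReal_le_ofReal
            linarith [tiles_cover hβ k a b ha hab hb]
    have hlim : Tendsto (fun k : ℕ => ENNReal.ofReal ((7 / 8 : ℝ) ^ k * (b - a))) atTop (𝓝 0) := by
      have : Tendsto (fun k : ℕ => ((7 / 8 : ℝ) ^ k * (b - a))) atTop (𝓝 (0 * (b - a))) :=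
        (tendsto_pow_atTop_nhds_zero_of_lt_one (by norm_num) (by norm_num)).mul_const _
      rw [zero_mul] at this
      simpa using ENNReal.tendsto_ofReal this
    exact le_antisymm (ge_of_tendsto' hlim key) (zero_le)
  · obtain ⟨A, B, hAB⟩ := tiles_len hβ
    have hnn : ∀ w : List Bool, 0 ≤ (w.length : ℝ) * sz β w := fun w =>
      mul_nonneg (Nat.cast_nonneg _) (sz_pos hβ w).le
    apply summable_of_sum_le (c := (b - a) * (- A * Real.log (b - a) + B))
    · intro w; exact Set.indicator_nonneg (fun w _ => hnn w) w
    · intro u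
      have : ∃ k, ∀ w ∈ u, w ∈ {w | ∃ k, w ∈ tiles β k a b} → w ∈ tiles β k a b := by
        induction u using Finset.induction_on with
        | empty => exact ⟨0, by simp⟩
        | insert v u hv ih =>
          obtain ⟨k, hk⟩ := ih
          by_cases hvW : ∃ m, v ∈ tiles β m a b
          · obtain ⟨m, hm⟩ := hvW
            refine ⟨max k m, fun w hw hwW => ?_⟩
            rcases Finset.mem_insert.1 hw with rfl | hw
            · exact hmono (le_max_right k m) hm
            · exact hmono (le_max_left k m) (hk w hw hwW)
          · refine ⟨k, fun w hw hwW => ?_⟩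
            rcases Finset.mem_insert.1 hw with rfl | hw
            · exact absurd hwW hvW
            · exact hk w hw hwW
      obtain ⟨k, hk⟩ := this
      refine le_trans ?_ (hAB k a b ha hab hb)
      rw [← Finset.sum_filter_add_sum_filter_not u (fun w => ∃ k, w ∈ tiles β k a b)]
      rw [Finset.sum_eq_zero (s := u.filter fun w => ¬ ∃ k, w ∈ tiles β k a b), add_zero]
      · calc _ = ∑ w ∈ u.filter (fun w => ∃ k, w ∈ tiles β k a b), (w.length : ℝ) * sz β w := by
              apply Finset.sum_congr rfl
              intro w hw
              exact Set.indicator_of_mem (s := {w | ∃ k, w ∈ tiles β k a b}) (Finset.mem_filter.1 hw).2 _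
          _ ≤ _ := by
              apply Finset.sum_le_sum_of_subset_of_nonneg
              · intro w hw
                exact hk w (Finset.mem_filter.1 hw).1 (Finset.mem_filter.1 hw).2
              · intro w _ _; exact hnn w
      · intro w hw
        exact Set.indicator_of_notMem (s := {w | ∃ k, w ∈ tiles β k a b}) (Finset.mem_filter.1 hw).2 _

lemma not_not_map (w : List Bool) : (w.map not).map not = w := by
  induction w with
  | nil => rfl
  | cons b w ih => simp only [List.map_cons, Bool.not_not, ih]

lemma mem_cyl_not {β : ℝ} (hβ : β ∈ Set.Ioo (1 : ℝ) 2) (w : List Bool) (x : ℝ) :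
    x ∈ cyl β (w.map not) ↔ 1 / (β - 1) - x ∈ cyl β w := by
  simp only [cyl, Set.mem_Ioo, lo_not hβ, sz_not]
  constructor <;> rintro ⟨h1, h2⟩ <;> constructor <;> linarith

lemma exists_tiling {β : ℝ} (hβ : β ∈ Set.Ioo (1 : ℝ) 2) :
    ∃ W : Set (List Bool), (∀ w ∈ W, w ≠ []) ∧ (∀ w ∈ W, cyl β w ⊆ Set.Ioo 0 (1 / (β - 1))) ∧
      (∀ w ∈ W, w.map not ∈ W) ∧
      W.PairwiseDisjoint (cyl β) ∧ volume (Set.Ioo 0 (1 / (β - 1)) \ ⋃ w ∈ W, cyl β w) = 0 ∧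
      Summable (W.indicator fun w => (w.length : ℝ) * sz β w) := by
  have h1 : 0 < 1 / (β - 1) := by have : 0 < β - 1 := by linarith [hβ.1]
                                  positivity
  set M := 1 / (β - 1) with hM
  obtain ⟨V, hV, hVd, hVc, hVs⟩ := exists_half hβ (a := M / 2) (b := M) (by linarith) (by linarith) le_rfl
  have hsub : ∀ w ∈ V, cyl β w ⊆ Set.Ioo (M / 2) M := fun w hw x hx =>
    ⟨lt_of_le_of_lt (hV w hw).2.1 hx.1, lt_of_lt_of_le hx.2 (hV w hw).2.2⟩
  set V' : Set (List Bool) := {w | w.map not ∈ V} with hV'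
  have hmem : ∀ w x, x ∈ cyl β w ↔ M - x ∈ cyl β (w.map not) := by
    intro w x
    rw [mem_cyl_not hβ, ← hM, sub_sub_cancel]
  have hsub' : ∀ w ∈ V', cyl β w ⊆ Set.Ioo 0 (M / 2) := fun w hw x hx => by
    have := hsub _ hw ((hmem w x).1 hx)
    exact ⟨by linarith [this.2], by linarith [this.1]⟩
  have hVV' : ∀ u ∈ V, ∀ v ∈ V', Disjoint (cyl β u) (cyl β v) := by
    intro u hu v hv
    rw [Set.disjoint_left]
    intro x hx hx'
    linarith [(hsub u hu hx).1, (hsub' v hv hx').2]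
  refine ⟨V ∪ V', ?_, ?_, ?_, ?_, ?_, ?_⟩
  · rintro w (hw | hw)
    · exact (hV w hw).1
    · rintro rfl; exact (hV _ hw).1 rfl
  · rintro w (hw | hw) x hx
    · have := hsub w hw hx; exact ⟨by linarith [this.1], this.2⟩
    · have := hsub' w hw hx; exact ⟨this.1, by linarith [this.2]⟩
  · rintro w (hw | hw)
    · right; simpa only [hV', Set.mem_ofPred_eq, not_not_map] using hw
    · left; exact hw
  · rintro u (hu | hu) v (hv | hv) huv
    · exact hVd hu hv huv
    · exact hVV' u hu v hv
    · exact (hVV' v hv u hu).symm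
    · have hne : u.map not ≠ v.map not := fun h => huv (by
        rw [← not_not_map u, h, not_not_map])
      have := hVd hu hv hne
      simp only [Function.onFun] at this ⊢
      rw [Set.disjoint_left] at this ⊢
      intro x hx hx'
      exact this ((hmem u x).1 hx) ((hmem v x).1 hx')
  · set N := Set.Ioo (M / 2) M \ ⋃ w ∈ V, cyl β w with hN
    have hN' : volume ((fun x => M - x) ⁻¹' N) = 0 :=
      (Measure.measurePreserving_sub_left volume M).quasiMeasurePreserving.preimage_null hVc
    have : Set.Ioo 0 M \ ⋃ w ∈ V ∪ V', cyl β w ⊆ N ∪ ((fun x => M - x) ⁻¹' N) ∪ {M / 2} := by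
      rintro x ⟨⟨hx0, hx1⟩, hx⟩
      simp only [Set.mem_iUnion, not_exists] at hx
      rcases lt_trichotomy x (M / 2) with h | h | h
      · left; right
        refine ⟨⟨by linarith, by linarith⟩, ?_⟩
        simp only [Set.mem_iUnion, not_exists]
        intro w hw hxw
        refine hx (w.map not) (Or.inr ?_) ((mem_cyl_not hβ w x).2 hxw)
        simpa only [hV', Set.mem_ofPred_eq, not_not_map] using hw
      · right; exact h
      · left; left
        refine ⟨⟨h, hx1⟩, ?_⟩
        simp only [Set.mem_iUnion, not_exists]
        intro w hw hxw
        exact hx w (Or.inl hw) hxw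
    refine measure_mono_null this ?_
    exact measure_union_null (measure_union_null hVc hN') (measure_singleton _)
  · have hnn : ∀ w : List Bool, 0 ≤ (w.length : ℝ) * sz β w := fun w =>
      mul_nonneg (Nat.cast_nonneg _) (sz_pos hβ w).le
    have hs' : Summable (V'.indicator fun w => (w.length : ℝ) * sz β w) := by
      have := hVs.comp_injective (i := List.map not) (fun u v h => by
        rw [← not_not_map u, h, not_not_map])
      have e : (V'.indicator fun w => (w.length : ℝ) * sz β w) =
          (V.indicator fun w => (w.length : ℝ) * sz β w) ∘ List.map not := by
        funext w
        by_cases hw : w ∈ V'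
        · rw [Set.indicator_of_mem hw, Function.comp, Set.indicator_of_mem (show w.map not ∈ V from hw)]
          simp [sz_not]
        · rw [Set.indicator_of_notMem hw, Function.comp,
            Set.indicator_of_notMem (show w.map not ∉ V from hw)]
      rw [e]; exact this
    refine Summable.of_nonneg_of_le (fun w => Set.indicator_nonneg (fun w _ => hnn w) w) ?_
      (hVs.add hs')
    intro w
    have a1 := Set.indicator_nonneg (s := V) (fun w _ => hnn w) w
    have a2 := Set.indicator_nonneg (s := V') (fun w _ => hnn w) w
    by_cases hw : w ∈ V ∪ V'
    · rw [Set.indicator_of_mem hw]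
      rcases hw with hw | hw
      · rw [Set.indicator_of_mem hw]; linarith
      · rw [Set.indicator_of_mem hw (s := V')]; linarith
    · rw [Set.indicator_of_notMem hw]; linarith

/-- The properties of the tiling. -/
structure Tiling (β : ℝ) (W : Set (List Bool)) : Prop where
  ne : ∀ w ∈ W, w ≠ []
  sub : ∀ w ∈ W, cyl β w ⊆ Set.Ioo 0 (1 / (β - 1))
  symm : ∀ w ∈ W, w.map not ∈ W
  disj : W.PairwiseDisjoint (cyl β)
  cover : volume (Set.Ioo 0 (1 / (β - 1)) \ ⋃ w ∈ W, cyl β w) = 0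
  summ : Summable (W.indicator fun w => (w.length : ℝ) * sz β w)

local instance instMSWord : MeasurableSpace (List Bool) := ⊤
local instance instDMSWord : DiscreteMeasurableSpace (List Bool) := ⟨fun _ => trivial⟩

open Classical in
/-- the word of the tile containing x -/
def idx (β : ℝ) (W : Set (List Bool)) (x : ℝ) : List Bool :=
  if h : ∃ w ∈ W, x ∈ cyl β w then h.choose else []

/-- induced map -/
def ind (β : ℝ) (W : Set (List Bool)) (x : ℝ) : ℝ :=
  β ^ (idx β W x).length * (x - lo β (idx β W x))

/-- normalized Lebesgue measure -/
def leb (β : ℝ) : Measure ℝ :=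
  (ENNReal.ofReal (1 / (β - 1)))⁻¹ • volume.restrict (Set.Ioo 0 (1 / (β - 1)))

variable {β : ℝ} {W : Set (List Bool)}

lemma idx_eq (hW : Tiling β W) {w : List Bool} (hw : w ∈ W) {x : ℝ} (hx : x ∈ cyl β w) :
    idx β W x = w := by
  have h : ∃ w ∈ W, x ∈ cyl β w := ⟨w, hw, hx⟩
  unfold idx
  rw [dif_pos h]
  by_contra hne
  exact Set.disjoint_left.1 (hW.disj h.choose_spec.1 hw hne) h.choose_spec.2 hx

lemma idx_none {x : ℝ} (hx : ¬ ∃ w ∈ W, x ∈ cyl β w) : idx β W x = [] := by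
  unfold idx
  rw [dif_neg hx]

lemma measurableSet_cyl (w : List Bool) : MeasurableSet (cyl β w) := measurableSet_Ioo

lemma measurable_idx (hW : Tiling β W) : Measurable (idx β W) := by
  refine measurable_to_countable' fun w => ?_
  have hU : MeasurableSet (⋃ w ∈ W, cyl β w) :=
    MeasurableSet.biUnion (Set.to_countable _) fun w _ => measurableSet_cyl w
  by_cases hw : w ∈ W
  · have : idx β W ⁻¹' {w} = cyl β w := by
      ext x
      constructor
      · intro hx
        by_cases h : ∃ w ∈ W, x ∈ cyl β w
        · obtain ⟨v, hv, hxv⟩ := h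
          have : idx β W x = v := idx_eq hW hv hxv
          have h2 : idx β W x = w := hx
          rw [← h2, this]; exact hxv
        · have h2 : idx β W x = w := hx
          rw [idx_none h] at h2
          exact absurd h2.symm (hW.ne w hw)
      · intro hx; exact idx_eq hW hw hx
    rw [this]; exact measurableSet_cyl w
  · by_cases hn : w = []
    · have : idx β W ⁻¹' {w} = (⋃ w ∈ W, cyl β w)ᶜ := by
        ext x
        simp only [Set.mem_preimage, Set.mem_singleton_iff, Set.mem_compl_iff, Set.mem_iUnion,
          exists_prop, hn]
        constructor
        · rintro hx ⟨v, hv, hxv⟩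
          rw [idx_eq hW hv hxv] at hx
          exact hW.ne v hv hx
        · intro h; exact idx_none h
      rw [this]; exact hU.compl
    · have : idx β W ⁻¹' {w} = ∅ := by
        ext x
        simp only [Set.mem_preimage, Set.mem_singleton_iff, Set.mem_empty_iff_false, iff_false]
        intro hx
        by_cases h : ∃ w ∈ W, x ∈ cyl β w
        · obtain ⟨v, hv, hxv⟩ := h
          rw [idx_eq hW hv hxv] at hx
          exact hw (hx ▸ hv)
        · rw [idx_none h] at hx
          exact hn hx.symm
      rw [this]; exact MeasurableSet.empty

lemma measurable_ind (hW : Tiling β W) : Measurable (ind β W) := by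
  have h1 : Measurable (fun x => β ^ (idx β W x).length) :=
    (Measurable.of_discrete (f := fun w : List Bool => β ^ w.length)).comp (measurable_idx hW)
  have h2 : Measurable (fun x => lo β (idx β W x)) :=
    (Measurable.of_discrete (f := lo β)).comp (measurable_idx hW)
  exact h1.mul (measurable_id.sub h2)

lemma M_pos (hβ : β ∈ Set.Ioo (1 : ℝ) 2) : 0 < 1 / (β - 1) := by
  have : 0 < β - 1 := by linarith [hβ.1]
  positivity

lemma leb_apply (S : Set ℝ) :
    leb β S = (ENNReal.ofReal (1 / (β - 1)))⁻¹ * volume (S ∩ Set.Ioo 0 (1 / (β - 1))) := by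
  rw [leb, Measure.smul_apply, Measure.restrict_apply' measurableSet_Ioo, smul_eq_mul]

lemma leb_prob (hβ : β ∈ Set.Ioo (1 : ℝ) 2) : IsProbabilityMeasure (leb β) := by
  constructor
  rw [leb_apply, Set.univ_inter, Real.volume_Ioo, sub_zero]
  exact ENNReal.inv_mul_cancel (by simpa using M_pos hβ) ENNReal.ofReal_ne_top

lemma leb_ae (hW : Tiling β W) : ∀ᵐ x ∂(leb β), ∃ w ∈ W, x ∈ cyl β w := by
  rw [ae_iff, leb_apply]
  have : {x | ¬ ∃ w ∈ W, x ∈ cyl β w} ∩ Set.Ioo 0 (1 / (β - 1)) =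
      Set.Ioo 0 (1 / (β - 1)) \ ⋃ w ∈ W, cyl β w := by
    ext x
    simp only [Set.mem_inter_iff, Set.mem_ofPred_eq, Set.mem_sdiff, Set.mem_iUnion, exists_prop]
    tauto
  rw [this, hW.cover, mul_zero]

lemma leb_cyl_ind_aux (hβ : β ∈ Set.Ioo (1 : ℝ) 2) (hW : Tiling β W) {w : List Bool} (hw : w ∈ W)
    (A : Set ℝ) :
    leb β (cyl β w ∩ ind β W ⁻¹' A) = ENNReal.ofReal ((β ^ w.length)⁻¹) * leb β A := by
  have h2 : 0 < β := by linarith [hβ.1]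
  have hp : 0 < β ^ w.length := by positivity
  have e : cyl β w ∩ ind β W ⁻¹' A ∩ Set.Ioo 0 (1 / (β - 1)) =
      (fun x => x - lo β w) ⁻¹' ((fun x => β ^ w.length * x) ⁻¹' (A ∩ Set.Ioo 0 (1 / (β - 1)))) := by
    have hc : ∀ x, x ∈ cyl β w ↔ β ^ w.length * (x - lo β w) ∈ Set.Ioo 0 (1 / (β - 1)) := by
      intro x
      simp only [cyl, Set.mem_Ioo, mul_pos_iff_of_pos_left hp, sub_pos]
      have : x < lo β w + sz β w ↔ β ^ w.length * (x - lo β w) < 1 / (β - 1) := by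
        rw [sz, ← sub_lt_iff_lt_add', lt_div_iff₀ hp, mul_comm]
      rw [this]
    ext x
    simp only [Set.mem_inter_iff, Set.mem_preimage]
    rw [← hc x]
    constructor
    · rintro ⟨⟨hx, hA⟩, _⟩
      rw [ind, idx_eq hW hw hx] at hA
      exact ⟨hA, hx⟩
    · rintro ⟨hA, hx⟩
      refine ⟨⟨hx, ?_⟩, hW.sub w hw hx⟩
      rw [ind, idx_eq hW hw hx]
      exact hA
  simp only [sub_eq_add_neg _ (lo β w)] at e
  rw [leb_apply, leb_apply, e, measure_preimage_add_right, Real.volume_preimage_mul_left hp.ne',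
    abs_of_pos (inv_pos.2 hp)]
  ring

lemma leb_cyl (hβ : β ∈ Set.Ioo (1 : ℝ) 2) (hW : Tiling β W) {w : List Bool} (hw : w ∈ W) :
    leb β (cyl β w) = ENNReal.ofReal ((β ^ w.length)⁻¹) := by
  have := leb_prob hβ
  simpa using leb_cyl_ind_aux hβ hW hw Set.univ

lemma leb_sum (hW : Tiling β W) (s : Set (List Bool)) {B : Set ℝ} (hB : MeasurableSet B) :
    leb β (idx β W ⁻¹' s ∩ B) = ∑' w : (W ∩ s : Set (List Bool)), leb β (cyl β w ∩ B) := by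
  have e : (idx β W ⁻¹' s ∩ B : Set ℝ) =ᵐ[leb β] ⋃ w ∈ W ∩ s, cyl β w ∩ B := by
    filter_upwards [leb_ae hW] with x hx
    obtain ⟨w, hw, hx⟩ := hx
    have hi := idx_eq hW hw hx
    apply propext
    change (x ∈ (idx β W ⁻¹' s ∩ B : Set ℝ) ↔ x ∈ ⋃ w ∈ W ∩ s, cyl β w ∩ B)
    simp only [Set.mem_iUnion, Set.mem_inter_iff, Set.mem_preimage, hi, exists_prop]
    constructor
    · rintro ⟨h1, h2⟩; exact ⟨w, ⟨hw, h1⟩, hx, h2⟩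
    · rintro ⟨v, ⟨hv, hvs⟩, hxv, hxB⟩
      have : w = v := by rw [← hi, idx_eq hW hv hxv]
      exact ⟨this ▸ hvs, hxB⟩
  rw [measure_congr e, measure_biUnion (Set.to_countable _)]
  · intro u hu v hv huv
    exact (hW.disj hu.1 hv.1 huv).mono Set.inter_subset_left Set.inter_subset_left
  · intro w _; exact (measurableSet_cyl w).inter hB

lemma leb_indep_aux (hβ : β ∈ Set.Ioo (1 : ℝ) 2) (hW : Tiling β W) (s : Set (List Bool))
    {A : Set ℝ} (hA : MeasurableSet A) :
    leb β (idx β W ⁻¹' s ∩ ind β W ⁻¹' A) = leb β (idx β W ⁻¹' s) * leb β A := by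
  rw [leb_sum hW s (measurable_ind hW hA)]
  have h := leb_sum hW s MeasurableSet.univ
  simp only [Set.inter_univ] at h
  rw [h, ← ENNReal.tsum_mul_right]
  refine tsum_congr fun w => ?_
  rw [leb_cyl_ind_aux hβ hW w.2.1, leb_cyl hβ hW w.2.1]

lemma mp_ind (hβ : β ∈ Set.Ioo (1 : ℝ) 2) (hW : Tiling β W) :
    MeasurePreserving (ind β W) (leb β) (leb β) := by
  have := leb_prob hβ
  refine ⟨measurable_ind hW, ?_⟩
  ext A hA
  rw [Measure.map_apply (measurable_ind hW) hA]
  simpa using leb_indep_aux hβ hW Set.univ hA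

lemma indep_idx_ind (hβ : β ∈ Set.Ioo (1 : ℝ) 2) (hW : Tiling β W) :
    IndepFun (idx β W) (ind β W) (leb β) := by
  rw [indepFun_iff_measure_inter_preimage_eq_mul]
  intro s A _ hA
  rw [leb_indep_aux hβ hW s hA, (mp_ind hβ hW).measure_preimage hA.nullMeasurableSet]

lemma indepFun_comp_mp {Ω E E' : Type*} [MeasurableSpace Ω] [MeasurableSpace E] [MeasurableSpace E']
    {μ : Measure Ω} {f : Ω → E} {g : Ω → E'} {h : Ω → Ω} (hf : Measurable f) (hg : Measurable g)
    (hfg : IndepFun f g μ) (hh : MeasurePreserving h μ μ) : IndepFun (f ∘ h) (g ∘ h) μ := by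
  rw [indepFun_iff_measure_inter_preimage_eq_mul] at hfg ⊢
  intro s t hs ht
  have := hfg s t hs ht
  rw [Set.preimage_comp, Set.preimage_comp, ← Set.preimage_inter,
    hh.measure_preimage ((hf hs).inter (hg ht)).nullMeasurableSet,
    hh.measure_preimage (hf hs).nullMeasurableSet, hh.measure_preimage (hg ht).nullMeasurableSet,
    this]

lemma slln (hβ : β ∈ Set.Ioo (1 : ℝ) 2) (hW : Tiling β W) (g : List Bool → ℝ)
    (hg : Integrable (fun x => g (idx β W x)) (leb β)) :
    ∀ᵐ x ∂(leb β), Tendsto (fun n : ℕ => (∑ i ∈ Finset.range n, g (idx β W ((ind β W)^[i] x))) / n)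
      atTop (𝓝 (∫ x, g (idx β W x) ∂(leb β))) := by
  have hgm : Measurable g := Measurable.of_discrete
  have hgi : Measurable (fun x => g (idx β W x)) := hgm.comp (measurable_idx hW)
  have hlt : ∀ i j, i < j → IndepFun (fun x => g (idx β W ((ind β W)^[i] x)))
      (fun x => g (idx β W ((ind β W)^[j] x))) (leb β) := by
    intro i j hij
    obtain ⟨m, rfl⟩ := Nat.exists_eq_add_of_lt hij
    have h1 : IndepFun (g ∘ idx β W) ((fun x => g (idx β W ((ind β W)^[m] x))) ∘ ind β W) (leb β) :=
      (indep_idx_ind hβ hW).comp hgm (hgi.comp ((measurable_ind hW).iterate m))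
    have h2 := indepFun_comp_mp (h := (ind β W)^[i]) (hgm.comp (measurable_idx hW))
      ((hgi.comp ((measurable_ind hW).iterate m)).comp (measurable_ind hW)) h1
      ((mp_ind hβ hW).iterate i)
    have e : (fun x => g (idx β W ((ind β W)^[i + m + 1] x))) =
        (((fun x => g (idx β W x)) ∘ (ind β W)^[m]) ∘ ind β W) ∘ (ind β W)^[i] := by
      funext x
      simp only [Function.comp]
      rw [← Function.iterate_succ_apply, ← Function.iterate_add_apply,
        show m.succ + i = i + m + 1 by omega]
    rw [e]
    exact h2
  have := strong_law_ae_real (μ := leb β) (fun i x => g (idx β W ((ind β W)^[i] x))) hg ?_ ?_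
  · exact this
  · intro i j hij
    rcases lt_or_gt_of_ne hij with h | h
    · exact hlt i j h
    · exact (hlt j i h).symm
  · intro i
    refine ⟨(hgi.comp ((measurable_ind hW).iterate i)).aemeasurable, hgi.aemeasurable, ?_⟩
    have := ((mp_ind hβ hW).iterate i).map_eq
    change Measure.map ((fun x => g (idx β W x)) ∘ (ind β W)^[i]) (leb β) =
      Measure.map (fun x => g (idx β W x)) (leb β)
    rw [← Measure.map_map hgi ((measurable_ind hW).iterate i), this]

lemma integrable_len (hβ : β ∈ Set.Ioo (1 : ℝ) 2) (hW : Tiling β W) :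
    Integrable (fun x => ((idx β W x).length : ℝ)) (leb β) := by
  have h1 : 0 < β - 1 := by linarith [hβ.1]
  have h2 : 0 < β := by linarith [hβ.1]
  have hm : Measurable (fun w : List Bool => (w.length : ℝ)) := Measurable.of_discrete
  refine ⟨(hm.comp (measurable_idx hW)).aestronglyMeasurable, ?_⟩
  rw [hasFiniteIntegral_iff_enorm]
  have e : ∫⁻ x, ‖((idx β W x).length : ℝ)‖ₑ ∂(leb β) =
      ∫⁻ w, ‖(w.length : ℝ)‖ₑ ∂((leb β).map (idx β W)) :=
    (lintegral_map (f := fun w : List Bool => ‖(w.length : ℝ)‖ₑ) Measurable.of_discrete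
      (measurable_idx hW)).symm
  rw [e, lintegral_countable']
  have hs := (hW.summ.mul_left (β - 1)).tsum_ofReal_ne_top
  refine lt_of_le_of_lt (ENNReal.tsum_le_tsum fun w => ?_) (lt_top_iff_ne_top.2 hs)
  rw [Measure.map_apply (measurable_idx hW) trivial]
  have hl := leb_sum hW {w} MeasurableSet.univ
  simp only [Set.inter_univ] at hl
  by_cases hw : w ∈ W
  · have hWw : W ∩ {w} = {w} := by simpa using hw
    rw [hWw, tsum_singleton (f := fun w => leb β (cyl β w)), leb_cyl hβ hW hw] at hl
    rw [hl, Set.indicator_of_mem hw, Real.enorm_of_nonneg (Nat.cast_nonneg _),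
      ← ENNReal.ofReal_mul (Nat.cast_nonneg _)]
    apply ENNReal.ofReal_le_ofReal
    rw [sz]
    apply le_of_eq
    field_simp
  · have hWw : W ∩ {w} = ∅ := by simpa using hw
    have : leb β (idx β W ⁻¹' {w}) = 0 := by
      rw [hl, hWw]; simp
    rw [this, mul_zero]; exact zero_le

/-- digit discrepancy of a word -/
def disc (w : List Bool) : ℝ := (w.map fun b => if b then (1 : ℝ) else -1).sum

lemma disc_not (w : List Bool) : disc (w.map not) = - disc w := by
  induction w with
  | nil => simp [disc]
  | cons b w ih =>
    simp only [disc, List.map_cons, List.sum_cons] at ih ⊢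
    rw [ih]
    cases b <;> simp <;> ring

lemma disc_abs (w : List Bool) : |disc w| ≤ w.length := by
  induction w with
  | nil => simp [disc]
  | cons b w ih =>
    simp only [disc, List.map_cons, List.sum_cons, List.length_cons] at ih ⊢
    refine (abs_add_le _ _).trans ?_
    push_cast
    cases b <;> simp <;> linarith

lemma idx_symm (hβ : β ∈ Set.Ioo (1 : ℝ) 2) (hW : Tiling β W) (x : ℝ) :
    idx β W (1 / (β - 1) - x) = (idx β W x).map not := by
  by_cases h : ∃ w ∈ W, x ∈ cyl β w
  · obtain ⟨w, hw, hx⟩ := h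
    rw [idx_eq hW hw hx]
    apply idx_eq hW (hW.symm w hw)
    rw [mem_cyl_not hβ, sub_sub_cancel]; exact hx
  · rw [idx_none h, idx_none]
    · rfl
    · rintro ⟨w, hw, hx⟩
      exact h ⟨w.map not, hW.symm w hw, (mem_cyl_not hβ w x).2 hx⟩

lemma integrable_disc (hβ : β ∈ Set.Ioo (1 : ℝ) 2) (hW : Tiling β W) :
    Integrable (fun x => disc (idx β W x)) (leb β) := by
  refine (integrable_len hβ hW).mono ?_ ?_
  · exact ((Measurable.of_discrete (f := disc)).comp (measurable_idx hW)).aestronglyMeasurable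
  · filter_upwards with x
    rw [Real.norm_eq_abs, Real.norm_of_nonneg (Nat.cast_nonneg _)]
    exact disc_abs _

lemma integral_disc (hβ : β ∈ Set.Ioo (1 : ℝ) 2) (hW : Tiling β W) :
    ∫ x, disc (idx β W x) ∂(leb β) = 0 := by
  rw [leb, integral_smul_measure, ← integral_Ioc_eq_integral_Ioo,
    ← intervalIntegral.integral_of_le (M_pos hβ).le]
  have h := intervalIntegral.integral_comp_sub_left (a := 0) (b := 1 / (β - 1))
    (fun x => disc (idx β W x)) (1 / (β - 1))
  simp only [idx_symm hβ hW, disc_not, sub_self, sub_zero, intervalIntegral.integral_neg] at h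
  have : ∫ x in (0 : ℝ)..(1 / (β - 1)), disc (idx β W x) = 0 := by linarith
  rw [this, smul_zero]

/-- concatenation of the first n words -/
def cat (w : ℕ → List Bool) : ℕ → List Bool
  | 0 => []
  | n + 1 => cat w n ++ w n

/-- digits of the infinite concatenation -/
def dig (w : ℕ → List Bool) (i : ℕ) : Bool := (cat w (i + 1)).getD i false

lemma cat_prefix (w : ℕ → List Bool) {m n : ℕ} (h : m ≤ n) : cat w m <+: cat w n := by
  induction n, h using Nat.le_induction with
  | base => exact List.prefix_refl _
  | succ n _ ih => exact ih.trans (List.prefix_append _ _)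

lemma le_len_cat {w : ℕ → List Bool} (hw : ∀ n, w n ≠ []) (n : ℕ) : n ≤ (cat w n).length := by
  induction n with
  | zero => simp
  | succ n ih =>
    have := List.length_pos_iff.2 (hw n)
    simp only [cat, List.length_append]; omega

lemma cat_eq {w : ℕ → List Bool} (hw : ∀ n, w n ≠ []) (n : ℕ) :
    cat w n = (List.range (cat w n).length).map (dig w) := by
  apply List.ext_getElem
  · simp
  · intro i h1 h2
    have h3 : i < (cat w (i + 1)).length := le_len_cat hw (i + 1)
    simp only [List.getElem_map, List.getElem_range, dig]
    rw [List.getD_eq_getElem _ _ h3]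
    rcases le_total n (i + 1) with h | h
    · exact (cat_prefix w h).getElem h1
    · exact ((cat_prefix w h).getElem h3).symm

lemma lo_range (hβ : β ∈ Set.Ioo (1 : ℝ) 2) (d : ℕ → Bool) (m : ℕ) :
    lo β ((List.range m).map d) =
      ∑ i ∈ Finset.range m, (((if d i then 1 else 0 : ℕ)) : ℝ) / β ^ (i + 1) := by
  have h2 : 0 < β := by linarith [hβ.1]
  induction m with
  | zero => simp [lo]
  | succ m ih =>
    rw [List.range_succ, List.map_append, lo_append hβ, ih, Finset.sum_range_succ]
    simp only [List.map_cons, List.map_nil, lo, List.length_map, List.length_range, pow_succ]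
    congr 1
    cases d m <;> simp <;> field_simp

lemma disc_append (u v : List Bool) : disc (u ++ v) = disc u + disc v := by
  simp [disc]

lemma disc_range (d : ℕ → Bool) (m : ℕ) :
    disc ((List.range m).map d) = ∑ i ∈ Finset.range m, (if d i then (1 : ℝ) else -1) := by
  induction m with
  | zero => simp [disc]
  | succ m ih =>
    rw [List.range_succ, List.map_append, disc_append, ih, Finset.sum_range_succ]
    simp [disc]

lemma disc_cat (w : ℕ → List Bool) (n : ℕ) :
    disc (cat w n) = ∑ i ∈ Finset.range n, disc (w i) := by
  induction n with
  | zero => simp [cat, disc]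
  | succ n ih => rw [cat, disc_append, ih, Finset.sum_range_succ]

lemma len_cat (w : ℕ → List Bool) (n : ℕ) :
    ((cat w n).length : ℝ) = ∑ i ∈ Finset.range n, ((w i).length : ℝ) := by
  induction n with
  | zero => simp [cat]
  | succ n ih => rw [cat, List.length_append, Nat.cast_add, ih, Finset.sum_range_succ]

lemma count_zero (d : ℕ → Bool) (N : ℕ) :
    (((Finset.range N).filter fun i => (if d i then 1 else 0 : ℕ) = 0).card : ℝ) =
      (N - ∑ i ∈ Finset.range N, (if d i then (1 : ℝ) else -1)) / 2 := by
  induction N with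
  | zero => simp
  | succ N ih =>
    rw [Finset.sum_range_succ, Finset.range_add_one, Finset.filter_insert]
    cases h : d N
    · simp only [Bool.false_eq_true, if_false, if_true]
      rw [Finset.card_insert_of_notMem (by simp)]
      push_cast
      rw [ih]; ring
    · simp only [if_true, one_ne_zero, if_false]
      rw [ih]; push_cast; ring

lemma normal_of {w : ℕ → List Bool} (hw : ∀ n, w n ≠ []) {c : ℝ}
    (hD : Tendsto (fun n : ℕ => (∑ i ∈ Finset.range n, disc (w i)) / n) atTop (𝓝 0))
    (hL : Tendsto (fun n : ℕ => (∑ i ∈ Finset.range n, ((w i).length : ℝ)) / n) atTop (𝓝 c)) :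
    simplyNormal (fun i => if dig w i then 1 else 0) := by
  set S : ℕ → ℝ := fun N => ∑ i ∈ Finset.range N, (if dig w i then (1 : ℝ) else -1) with hS
  have hlen : Tendsto (fun n : ℕ => ((w n).length : ℝ) / n) atTop (𝓝 0) := by
    have h1 := (tendsto_add_atTop_iff_nat 1).2 hL
    have h2 : Tendsto (fun n : ℕ => 1 + 1 / (n : ℝ)) atTop (𝓝 (1 + 0)) :=
      tendsto_const_nhds.add tendsto_one_div_atTop_nhds_zero_nat
    have h3 := (h1.mul h2).sub hL
    rw [add_zero, mul_one, sub_self] at h3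
    refine h3.congr' ?_
    filter_upwards [eventually_gt_atTop 0] with n hn
    have hn' : (0 : ℝ) < n := by exact_mod_cast hn
    rw [Finset.sum_range_succ]
    push_cast
    field_simp
    ring
  have hsum : Tendsto (fun n : ℕ => |(∑ i ∈ Finset.range n, disc (w i)) / n| +
      ((w n).length : ℝ) / n) atTop (𝓝 0) := by
    simpa using hD.abs.add hlen
  have hSlim : Tendsto (fun N : ℕ => S N / N) atTop (𝓝 0) := by
    rw [Metric.tendsto_atTop]
    intro e he
    obtain ⟨n0, hn0⟩ := eventually_atTop.1 (hsum.eventually (gt_mem_nhds he))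
    refine ⟨(cat w (n0 + 1)).length, fun N hN => ?_⟩
    have hex : ∃ n, N < (cat w n).length := ⟨N + 1, le_len_cat hw (N + 1)⟩
    classical
    obtain ⟨n, hn1, hn2⟩ : ∃ n, (cat w n).length ≤ N ∧ N < (cat w (n + 1)).length := by
      have hs := Nat.find_spec hex
      have hp : Nat.find hex ≠ 0 := by
        intro h0; rw [h0] at hs; simp [cat] at hs
      obtain ⟨n, hn⟩ := Nat.exists_eq_succ_of_ne_zero hp
      refine ⟨n, ?_, ?_⟩
      · have := Nat.find_min hex (m := n) (by omega)
        omega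
      · rw [hn] at hs; exact hs
    have hn : n0 + 1 ≤ n := by
      by_contra hlt
      have := (cat_prefix w (show n + 1 ≤ n0 + 1 by omega)).length_le
      omega
    have hbound := hn0 n (by omega)
    have hn' : (0 : ℝ) < n := by exact_mod_cast (by omega : 0 < n)
    have hnN : (n : ℝ) ≤ N := by exact_mod_cast (le_len_cat hw n).trans hn1
    have hSP : S (cat w n).length = ∑ i ∈ Finset.range n, disc (w i) := by
      rw [← disc_cat, cat_eq hw n, disc_range, hS]
      simp
    have hdiff : |S N - S (cat w n).length| ≤ (w n).length := by
      rw [hS]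
      simp only
      rw [← Finset.sum_Ico_eq_sub _ hn1]
      refine (Finset.abs_sum_le_sum_abs _ _).trans ?_
      calc ∑ i ∈ Finset.Ico (cat w n).length N, |(if dig w i then (1 : ℝ) else -1)|
          = ∑ i ∈ Finset.Ico (cat w n).length N, (1 : ℝ) :=
            Finset.sum_congr rfl fun i _ => by cases dig w i <;> simp
        _ ≤ (w n).length := by
            simp only [Finset.sum_const, Nat.card_Ico, nsmul_eq_mul, mul_one]
            rw [cat, List.length_append] at hn2
            exact_mod_cast (by omega)
    rw [dist_zero_right, Real.norm_eq_abs, abs_div, Nat.abs_cast, div_lt_iff₀ (by linarith)]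
    rw [abs_div, Nat.abs_cast, ← add_div, div_lt_iff₀ hn'] at hbound
    have : |S N| ≤ |S N - S (cat w n).length| + |S (cat w n).length| := by
      simpa using abs_add_le (S N - S (cat w n).length) (S (cat w n).length)
    rw [hSP] at this hdiff
    nlinarith
  unfold simplyNormal
  have : Tendsto (fun N : ℕ => (1 - S N / N) / 2) atTop (𝓝 ((1 - 0) / 2)) :=
    (tendsto_const_nhds.sub hSlim).div_const 2
  rw [sub_zero] at this
  refine this.congr' ?_
  filter_upwards [eventually_gt_atTop 0] with n hn
  have hn' : (0 : ℝ) < n := by exact_mod_cast hn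
  rw [count_zero]
  field_simp
  rfl

lemma expansion_of (hβ : β ∈ Set.Ioo (1 : ℝ) 2) (hW : Tiling β W) {x : ℝ}
    (hx : ∀ n, ∃ w ∈ W, (ind β W)^[n] x ∈ cyl β w) :
    isExpansion β x (fun i => if dig (fun n => idx β W ((ind β W)^[n] x)) i then 1 else 0) := by
  have h2 : 0 < β := by linarith [hβ.1]
  set w : ℕ → List Bool := fun n => idx β W ((ind β W)^[n] x) with hwdef
  have hw : ∀ n, w n ≠ [] := by
    intro n
    obtain ⟨v, hv, hxv⟩ := hx n
    simp only [hwdef]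
    rw [idx_eq hW hv hxv]
    exact hW.ne v hv
  refine ⟨fun i => by dsimp only; split <;> simp, ?_⟩
  have hrec : ∀ n, x = lo β (cat w n) + (ind β W)^[n] x / β ^ (cat w n).length := by
    intro n
    induction n with
    | zero => simp [cat, lo]
    | succ n ih =>
      have e : (ind β W)^[n + 1] x = β ^ (w n).length * ((ind β W)^[n] x - lo β (w n)) := by
        rw [Function.iterate_succ_apply', ind]
      rw [cat, lo_append hβ, e, List.length_append, pow_add]
      conv_lhs => rw [ih]
      field_simp
      ring
  have hbd : ∀ n, (ind β W)^[n] x ∈ Set.Ioo 0 (1 / (β - 1)) := by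
    intro n
    obtain ⟨v, hv, hxv⟩ := hx n
    exact hW.sub v hv hxv
  have htop : Tendsto (fun n => (cat w n).length) atTop atTop :=
    tendsto_atTop_mono (le_len_cat hw) tendsto_id
  have hsum : Summable (fun i : ℕ => (((if dig w i then 1 else 0 : ℕ)) : ℝ) / β ^ (i + 1)) := by
    have hg : Summable (fun i : ℕ => (β⁻¹) ^ (i + 1)) :=
      (summable_nat_add_iff 1).2 (summable_geometric_of_lt_one (by positivity) (inv_lt_one_of_one_lt₀ hβ.1))
    refine Summable.of_nonneg_of_le (fun i => by positivity) (fun i => ?_) hg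
    rw [inv_pow, div_eq_mul_inv]
    apply mul_le_of_le_one_left (by positivity)
    split <;> simp
  have t1 := hsum.hasSum.tendsto_sum_nat.comp htop
  have t2 : Tendsto (fun n => lo β (cat w n)) atTop (𝓝 x) := by
    have hz : Tendsto (fun n => (ind β W)^[n] x / β ^ (cat w n).length) atTop (𝓝 0) := by
      have hp : Tendsto (fun n => (1 / (β - 1)) * (β⁻¹) ^ (cat w n).length) atTop
          (𝓝 ((1 / (β - 1)) * 0)) :=
        ((tendsto_pow_atTop_nhds_zero_of_lt_one (by positivity)
          (inv_lt_one_of_one_lt₀ hβ.1)).comp htop).const_mul _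
      rw [mul_zero] at hp
      refine squeeze_zero (fun n => div_nonneg (hbd n).1.le (by positivity)) (fun n => ?_) hp
      rw [inv_pow, div_eq_mul_inv]
      exact mul_le_mul_of_nonneg_right (hbd n).2.le (by positivity)
    have := (tendsto_const_nhds (x := x)).sub hz
    rw [sub_zero] at this
    refine this.congr fun n => ?_
    linarith [hrec n]
  refine tendsto_nhds_unique t2 (t1.congr fun n => ?_)
  simp only [Function.comp]
  rw [← lo_range hβ, ← cat_eq hw n]

end SN
end

theorem ae_x_has_simply_normal_expansion
    (β : ℝ) (hβ : β ∈ Set.Ioo (1 : ℝ) 2) :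
    MeasureTheory.volume
      {x : ℝ | x ∈ Set.Icc (0 : ℝ) (1 / (β - 1)) ∧
        ¬ ∃ ε : ℕ → ℕ, isExpansion β x ε ∧ simplyNormal ε} = 0 := by
  obtain ⟨W, a1, a2, a3, a4, a5, a6⟩ := SN.exists_tiling hβ
  have hW : SN.Tiling β W := ⟨a1, a2, a3, a4, a5, a6⟩
  have hall : ∀ᵐ x ∂(SN.leb β), ∀ n, ∃ w ∈ W, (SN.ind β W)^[n] x ∈ SN.cyl β w := by
    rw [ae_all_iff]
    intro n
    exact ((SN.mp_ind hβ hW).iterate n).quasiMeasurePreserving.ae (SN.leb_ae hW)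
  have hL := SN.slln hβ hW (fun w => (w.length : ℝ)) (SN.integrable_len hβ hW)
  have hD := SN.slln hβ hW SN.disc (SN.integrable_disc hβ hW)
  rw [SN.integral_disc hβ hW] at hD
  have hgood : ∀ᵐ x ∂(SN.leb β), ∃ ε : ℕ → ℕ, isExpansion β x ε ∧ simplyNormal ε := by
    filter_upwards [hall, hL, hD] with x h1 h2 h3
    refine ⟨_, SN.expansion_of hβ hW h1, SN.normal_of ?_ h3 h2⟩
    intro n
    obtain ⟨v, hv, hxv⟩ := h1 n
    rw [SN.idx_eq hW hv hxv]
    exact hW.ne v hv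
  rw [ae_iff, SN.leb_apply, mul_eq_zero, ENNReal.inv_eq_zero] at hgood
  have hz := hgood.resolve_left ENNReal.ofReal_ne_top
  refine measure_mono_null (t := _ ∪ ({0} ∪ {1 / (β - 1)})) ?_ (measure_union_null hz
    (measure_union_null (measure_singleton 0) (measure_singleton (1 / (β - 1)))))
  rintro x ⟨⟨h0, h1⟩, hx⟩
  rcases eq_or_lt_of_le h0 with h | h
  · right; left; exact h.symm
  · rcases eq_or_lt_of_le h1 with h' | h'
    · right; right; exact h'
    · left; exact ⟨hx, h, h'⟩
end

section
/- The map β ↦ α(β), assigning to each β ∈ (1,2] the quasi-greedy β-expansion of 1, is a strictly increasing bijection from (1,2] onto the set of sequences (γ_i) ∈ {0,1}^ℕ that do not end with 0^∞ and satisfy γ_{n+1}γ_{n+2}⋯ ≼ γ_1γ_2⋯ for all n ≥ 0. Furthermore, this map is left continuous with respect to the order topology on {0,1}^ℕ induced by the metric ρ((ε_i),(δ_i)) = 2^{−inf{j ≥ 1 : ε_j ≠ δ_j}}. -/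
/-- Strict lexicographic order on sequences: `a ≺ b`. -/
def lexLt (a b : ℕ → ℕ) : Prop := ∃ n, (∀ i < n, a i = b i) ∧ a n < b n

/-- Lexicographic order `a ≼ b`. -/
def lexLe (a b : ℕ → ℕ) : Prop := lexLt a b ∨ a = b

/-- A sequence does not end with `0^∞`. -/
def notEndZero (γ : ℕ → ℕ) : Prop := ∀ n, ∃ m, n ≤ m ∧ γ m ≠ 0

/-- `γ` is the quasi-greedy β-expansion of 1: it is a {0,1}-sequence not ending
in `0^∞` summing to 1 in base β, and it is lexicographically largest among such
sequences. -/
def isQuasiGreedy (β : ℝ) (γ : ℕ → ℕ) : Prop :=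
  (∀ i, γ i ≤ 1) ∧ notEndZero γ ∧ (∑' i : ℕ, (γ i : ℝ) / β ^ (i + 1)) = 1 ∧
  ∀ δ : ℕ → ℕ, (∀ i, δ i ≤ 1) → notEndZero δ →
    (∑' i : ℕ, (δ i : ℝ) / β ^ (i + 1)) = 1 → lexLe δ γ

open Filter Topology

noncomputable section

/-- Quasi-greedy digit. -/
def qgDig (β x : ℝ) : ℕ := if 1 < β * x then 1 else 0

/-- Quasi-greedy orbit. -/
def qgOrb (β x : ℝ) : ℕ → ℝ
  | 0 => x
  | n + 1 => β * qgOrb β x n - (qgDig β (qgOrb β x n) : ℝ)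

end

lemma qgDig_le (β x : ℝ) : qgDig β x ≤ 1 := by
  unfold qgDig; split_ifs <;> simp

lemma qgOrb_mem {β x : ℝ} (hβ : 1 < β) (hβ2 : β ≤ 2) (hx : 0 < x) (hx1 : x ≤ 1) (n : ℕ) :
    0 < qgOrb β x n ∧ qgOrb β x n ≤ 1 := by
  induction n with
  | zero => exact ⟨hx, hx1⟩
  | succ n ih =>
    obtain ⟨h0, h1⟩ := ih
    simp only [qgOrb]
    unfold qgDig
    split_ifs with h
    · push_cast
      constructor <;> nlinarith
    · push_cast
      constructor
      · have : 0 < β * qgOrb β x n := by positivity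
        linarith
      · linarith

lemma qgOrb_add (β x : ℝ) (n i : ℕ) : qgOrb β (qgOrb β x n) i = qgOrb β x (n + i) := by
  induction i with
  | zero => rfl
  | succ i ih => rw [← add_assoc]; simp only [qgOrb, ih]

/-- No nonnegative sequence growing geometrically is bounded. -/
lemma no_growth {b C D : ℝ} (hb : 1 < b) (hD : 0 < D) (h : ∀ n : ℕ, b ^ n * D ≤ C) : False := by
  obtain ⟨n, hn⟩ := pow_unbounded_of_one_lt (C / D) hb
  rw [div_lt_iff₀ hD] at hn
  linarith [h n]

lemma qg_lexLt {β₁ β₂ x y : ℝ} (h1 : 1 < β₁) (h12 : β₁ ≤ β₂) (h2 : β₂ ≤ 2)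
    (hx : 0 < x) (hx1 : x ≤ 1) (hy : 0 < y) (hy1 : y ≤ 1) (hxy : β₁ * x < β₂ * y) :
    lexLt (fun i => qgDig β₁ (qgOrb β₁ x i)) (fun i => qgDig β₂ (qgOrb β₂ y i)) := by
  have hr := qgOrb_mem (x := x) h1 (h12.trans h2) hx hx1
  have hs := qgOrb_mem (x := y) (h1.trans_le h12) h2 hy hy1
  have key : ∀ n, (∀ i < n, qgDig β₁ (qgOrb β₁ x i) = qgDig β₂ (qgOrb β₂ y i)) →
      β₁ ^ n * (β₂ * y - β₁ * x) ≤ β₂ * qgOrb β₂ y n - β₁ * qgOrb β₁ x n := by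
    intro n
    induction n with
    | zero => intro _; simp [qgOrb]
    | succ n ih =>
      intro h
      have h' := ih (fun i hi => h i (by omega))
      have hd := h n (by omega)
      have e : qgOrb β₂ y (n+1) - qgOrb β₁ x (n+1) = β₂ * qgOrb β₂ y n - β₁ * qgOrb β₁ x n := by
        simp only [qgOrb, hd]; ring
      have := (hs (n+1)).1
      have h3 : β₁ * (β₁ ^ n * (β₂ * y - β₁ * x)) ≤
          β₁ * (qgOrb β₂ y (n+1) - qgOrb β₁ x (n+1)) := by
        rw [e]; exact mul_le_mul_of_nonneg_left h' (by linarith)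
      have h4 : 0 ≤ (β₂ - β₁) * qgOrb β₂ y (n+1) := mul_nonneg (by linarith) this.le
      rw [pow_succ]
      nlinarith
  have hex : ∃ n, qgDig β₁ (qgOrb β₁ x n) ≠ qgDig β₂ (qgOrb β₂ y n) := by
    by_contra! hc
    refine no_growth (C := β₂) h1 (sub_pos.2 hxy) (fun n => ?_)
    have := key n (fun i _ => hc i)
    have a1 := hr n
    have a2 := hs n
    nlinarith
  classical
  refine ⟨Nat.find hex, fun i hi => by simpa using Nat.find_min hex hi, ?_⟩
  have hne := Nat.find_spec hex
  have hk := key (Nat.find hex) (fun i hi => by simpa using Nat.find_min hex hi)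
  set n := Nat.find hex
  have hpos : 0 < β₁ ^ n * (β₂ * y - β₁ * x) := mul_pos (by positivity) (sub_pos.2 hxy)
  have hlt : β₁ * qgOrb β₁ x n < β₂ * qgOrb β₂ y n := by linarith
  simp only
  unfold qgDig at hne ⊢
  split_ifs at hne ⊢ with ha hb hb
  · exact absurd rfl hne
  · linarith
  · norm_num
  · exact absurd rfl hne

/-- Bounded recursions compute the sums. -/
lemma hasSum_of_rec {β C : ℝ} (hβ : 1 < β) {γ : ℕ → ℕ} {v : ℕ → ℝ} (hC : ∀ n, |v n| ≤ C)
    (hv : ∀ n, v (n+1) = β * v n - γ n) : HasSum (fun i => (γ i : ℝ) / β ^ (i+1)) (v 0) := by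
  rw [hasSum_iff_tendsto_nat_of_nonneg (fun i => by positivity)]
  have hp : ∀ n, ∑ i ∈ Finset.range n, (γ i : ℝ) / β ^ (i+1) = v 0 - v n * (β⁻¹) ^ n := by
    intro n
    induction n with
    | zero => simp
    | succ n ih =>
      rw [Finset.sum_range_succ, ih, hv n]
      have : β ≠ 0 := by positivity
      rw [inv_pow, inv_pow, pow_succ]
      field_simp
      ring
  simp_rw [hp]
  have h0 : Tendsto (fun n => v n * (β⁻¹) ^ n) atTop (𝓝 0) := by
    refine squeeze_zero_norm (a := fun n => C * (β⁻¹) ^ n) (fun n => ?_) ?_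
    · rw [norm_mul, Real.norm_eq_abs, Real.norm_eq_abs, abs_of_nonneg (a := β⁻¹ ^ n) (by positivity)]
      exact mul_le_mul_of_nonneg_right (hC n) (by positivity)
    · have := (tendsto_pow_atTop_nhds_zero_of_lt_one (r := β⁻¹) (by positivity)
        (inv_lt_one_of_one_lt₀ hβ)).const_mul C
      simpa using this
  simpa using h0.const_sub (v 0)

lemma summable_geo {β : ℝ} (hβ : 1 < β) : Summable (fun i : ℕ => 1 / β ^ (i+1)) := by
  have : Summable (fun i : ℕ => (β⁻¹) ^ i) :=
    summable_geometric_of_lt_one (by positivity) (inv_lt_one_of_one_lt₀ hβ)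
  have := (summable_nat_add_iff 1).2 this
  simpa [one_div] using this

lemma summable_dig {β : ℝ} (hβ : 1 < β) {γ : ℕ → ℕ} (hγ : ∀ i, γ i ≤ 1) :
    Summable (fun i : ℕ => (γ i : ℝ) / β ^ (i+1)) := by
  refine Summable.of_nonneg_of_le (fun i => by positivity) (fun i => ?_) (summable_geo hβ)
  have : (γ i : ℝ) ≤ 1 := by exact_mod_cast hγ i
  gcongr

/-- Tails of expansions. -/
lemma tails {β : ℝ} (hβ : 1 < β) {γ : ℕ → ℕ} (hγ : ∀ i, γ i ≤ 1) (hz : notEndZero γ) :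
    ∃ v : ℕ → ℝ, ∃ C : ℝ, v 0 = (∑' i : ℕ, (γ i : ℝ) / β ^ (i + 1)) ∧ (∀ n, 0 < v n) ∧
      (∀ n, v n ≤ C) ∧ ∀ n, v (n+1) = β * v n - γ n := by
  have hs : ∀ n, Summable (fun i : ℕ => (γ (n+i) : ℝ) / β ^ (i+1)) := fun n =>
    summable_dig (γ := fun i => γ (n+i)) hβ (fun i => hγ _)
  refine ⟨fun n => ∑' i : ℕ, (γ (n+i) : ℝ) / β ^ (i+1), ∑' i : ℕ, 1 / β ^ (i+1), by simp,
    fun n => ?_, fun n => ?_, fun n => ?_⟩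
  · obtain ⟨m, hm, hm0⟩ := hz n
    refine (hs n).tsum_pos (fun i => by positivity) (m - n) ?_
    rw [Nat.add_sub_cancel' hm]
    have : 0 < (γ m : ℝ) := by exact_mod_cast Nat.pos_of_ne_zero hm0
    positivity
  · refine (hs n).tsum_le_tsum (fun i => ?_) (summable_geo hβ)
    have : (γ (n+i) : ℝ) ≤ 1 := by exact_mod_cast hγ _
    gcongr
  · have hb : β ≠ 0 := by positivity
    simp only
    rw [(hs n).tsum_eq_zero_add]
    simp only [add_zero, zero_add, pow_one]
    rw [mul_add, mul_div_cancel₀ _ hb, add_sub_cancel_left, ← tsum_mul_left]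
    refine tsum_congr (fun i => ?_)
    rw [show n + (i+1) = n + 1 + i by ring, pow_succ β (i+1)]
    field_simp

lemma qg_notEndZero {β : ℝ} (hβ : 1 < β) (hβ2 : β ≤ 2) :
    notEndZero (fun i => qgDig β (qgOrb β 1 i)) := by
  intro n
  by_contra! hc
  have hm := qgOrb_mem hβ hβ2 one_pos le_rfl
  refine no_growth (C := 1) hβ (hm n).1 (fun k => ?_)
  have : β ^ k * qgOrb β 1 n = qgOrb β 1 (n + k) := by
    induction k with
    | zero => simp
    | succ k ih =>
      have := hc (n+k) (by omega)
      rw [← add_assoc, qgOrb, this, ← ih, pow_succ]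
      push_cast; ring
  rw [this]; exact (hm _).2

lemma qg_isQuasiGreedy {β : ℝ} (hβ : 1 < β) (hβ2 : β ≤ 2) :
    isQuasiGreedy β (fun i => qgDig β (qgOrb β 1 i)) := by
  have hm := qgOrb_mem hβ hβ2 one_pos le_rfl
  refine ⟨fun i => qgDig_le _ _, qg_notEndZero hβ hβ2, ?_, ?_⟩
  · exact (hasSum_of_rec (γ := fun i => qgDig β (qgOrb β 1 i)) (v := qgOrb β 1) (C := 1) hβ
      (fun n => by rw [abs_of_pos (hm n).1]; exact (hm n).2) (fun n => rfl)).tsum_eq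
  · intro δ hδ hz hsum
    obtain ⟨v, C, hv0, hpos, -, hrec⟩ := tails hβ hδ hz
    rw [hsum] at hv0
    by_cases hE : δ = fun i => qgDig β (qgOrb β 1 i)
    · exact Or.inr hE
    left
    have hex : ∃ n, δ n ≠ qgDig β (qgOrb β 1 n) := by
      by_contra! hc; exact hE (funext hc)
    classical
    have hmin : ∀ i < Nat.find hex, δ i = qgDig β (qgOrb β 1 i) :=
      fun i hi => by simpa using Nat.find_min hex hi
    refine ⟨Nat.find hex, hmin, ?_⟩
    have hne := Nat.find_spec hex
    set n := Nat.find hex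
    have heq : ∀ j ≤ n, v j = qgOrb β 1 j := by
      intro j
      induction j with
      | zero => intro _; simpa [qgOrb] using hv0
      | succ j ih =>
        intro hj
        rw [hrec, ih (by omega), hmin j (by omega)]; rfl
    have h1 := heq n le_rfl
    have h2 := hrec n
    have h3 := hpos (n+1)
    have h4 := hδ n
    simp only
    unfold qgDig at hne ⊢
    rw [← h1] at hne ⊢
    split_ifs at hne ⊢ with ha
    · omega
    · have : δ n = 1 := by omega
      rw [this] at h2; push_cast at h2; linarith

lemma lexLt_irrefl (a : ℕ → ℕ) : ¬ lexLt a a := fun ⟨_, _, h⟩ => lt_irrefl _ h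

lemma qg_self {β : ℝ} (hβ : 1 < β) (hβ2 : β ≤ 2) (n : ℕ) :
    lexLe (fun i => qgDig β (qgOrb β 1 (n + i))) (fun i => qgDig β (qgOrb β 1 i)) := by
  have hm := qgOrb_mem hβ hβ2 one_pos le_rfl n
  simp_rw [← qgOrb_add]
  rcases hm.2.lt_or_eq with h | h
  · left
    exact qg_lexLt hβ le_rfl hβ2 hm.1 hm.2 one_pos le_rfl (by nlinarith)
  · right; rw [h]

lemma exists_base {γ : ℕ → ℕ} (hγ : ∀ i, γ i ≤ 1) (hz : notEndZero γ)
    (hself : ∀ n : ℕ, lexLe (fun i => γ (n + i)) γ) :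
    ∃ β : ℝ, 1 < β ∧ β ≤ 2 ∧ (∑' i : ℕ, (γ i : ℝ) / β ^ (i + 1)) = 1 := by
  have h0 : γ 0 = 1 := by
    obtain ⟨m, -, hm⟩ := hz 0
    have hle : γ m ≤ γ 0 := by
      rcases hself m with ⟨k, hk, hlt⟩ | h
      · rcases Nat.eq_zero_or_pos k with rfl | hk0
        · exact hlt.le
        · exact (hk 0 hk0).le
      · exact (congrFun h 0).le
    have := hγ 0
    omega
  obtain ⟨m, hm1, hm⟩ := hz 1
  have hm' : γ m = 1 := by have := hγ m; omega
  set b : ℝ := (2:ℝ) ^ ((1:ℝ) / ((m + 1 : ℕ) : ℝ)) with hb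
  have hbp : b ^ (m+1) = 2 := by
    rw [hb, ← Real.rpow_natCast, ← Real.rpow_mul (by norm_num), one_div,
      inv_mul_cancel₀ (by positivity), Real.rpow_one]
  have hb1 : 1 < b := Real.one_lt_rpow (by norm_num) (by positivity)
  have hb2 : b ≤ 2 := by rw [← hbp]; exact le_self_pow₀ hb1.le (by omega)
  have hcont : ContinuousOn (fun β : ℝ => ∑' i : ℕ, (γ i : ℝ) / β ^ (i + 1)) (Set.Icc b 2) := by
    refine continuousOn_tsum (u := fun i => 1 / b ^ (i+1)) (fun i => ?_) (summable_geo hb1) ?_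
    · refine continuousOn_const.div (by fun_prop) (fun x hx => ?_)
      have : 0 < x := by linarith [hx.1]
      positivity
    · intro i x hx
      have hx0 : 0 < x := by linarith [hx.1]
      rw [Real.norm_eq_abs, abs_of_nonneg (by positivity)]
      have : (γ i : ℝ) ≤ 1 := by exact_mod_cast hγ i
      have := hx.1
      gcongr
  have hfb : 1 ≤ ∑' i : ℕ, (γ i : ℝ) / b ^ (i + 1) := by
    have := (summable_dig hb1 hγ).sum_le_tsum {0, m} (fun i _ => by positivity)
    rw [Finset.sum_pair (by omega), h0, hm', hbp] at this
    have h3 : (1:ℝ)/2 ≤ 1 / b := by gcongr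
    norm_num at this h3
    linarith
  have hf2 : ∑' i : ℕ, (γ i : ℝ) / (2:ℝ) ^ (i + 1) ≤ 1 := by
    have h1 : ∑' i : ℕ, (1:ℝ) / (2:ℝ) ^ (i + 1) = 1 := by
      have := (hasSum_of_rec (β := 2) (γ := fun _ => 1) (v := fun _ => 1) (C := 1) (by norm_num)
        (fun n => by simp) (fun n => by norm_num)).tsum_eq
      simpa using this
    rw [← h1]
    refine (summable_dig (by norm_num) hγ).tsum_le_tsum (fun i => ?_) (summable_geo (by norm_num))
    have : (γ i : ℝ) ≤ 1 := by exact_mod_cast hγ i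
    gcongr
  obtain ⟨β, hβ, hβe⟩ := intermediate_value_Icc' hb2 hcont ⟨hf2, hfb⟩
  exact ⟨β, by linarith [hβ.1], hβ.2, hβe⟩

lemma qg_surj {γ : ℕ → ℕ} (hγ : ∀ i, γ i ≤ 1) (hz : notEndZero γ)
    (hself : ∀ n : ℕ, lexLe (fun i => γ (n + i)) γ) :
    ∃ β : ℝ, 1 < β ∧ β ≤ 2 ∧ (fun i => qgDig β (qgOrb β 1 i)) = γ := by
  obtain ⟨β, hβ, hβ2, hsum⟩ := exists_base hγ hz hself
  refine ⟨β, hβ, hβ2, ?_⟩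
  obtain ⟨v, C, hv0, hpos, hC, hrec⟩ := tails hβ hγ hz
  rw [hsum] at hv0
  have hstep : ∀ n, 1 < v n → ∃ m, β * (v n - 1) ≤ v m - 1 := by
    intro n hn
    have hdiff : ∀ k, (∀ i < k, γ (n+i) = γ i) → v (n+k) - v k = β ^ k * (v n - 1) := by
      intro k
      induction k with
      | zero => intro _; simp [hv0]
      | succ k ih =>
        intro h
        have h1 := ih (fun i hi => h i (by omega))
        rw [← add_assoc, hrec, hrec, h k (by omega), pow_succ]
        linear_combination β * h1
    rcases hself n with ⟨k, hk, hlt⟩ | h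
    · refine ⟨n + k + 1, ?_⟩
      have h1 := hdiff k hk
      simp only at hlt
      have h2 := hγ k
      have e1 : γ k = 1 := by omega
      have e2 : γ (n+k) = 0 := by omega
      have r1 := hrec (n+k)
      have r2 := hrec k
      rw [e2] at r1
      rw [e1] at r2
      push_cast at r1 r2
      have r3 := hpos (k+1)
      have r4 : 1 ≤ β ^ k := one_le_pow₀ hβ.le
      have r5 : β * (1 * (v n - 1)) ≤ β * (β ^ k * (v n - 1)) := by
        apply mul_le_mul_of_nonneg_left _ (by linarith)
        exact mul_le_mul_of_nonneg_right r4 (by linarith)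
      rw [← h1] at r5
      linarith
    · exfalso
      refine no_growth (C := C) hβ (sub_pos.2 hn) (fun k => ?_)
      rw [← hdiff k (fun i _ => congrFun h i)]
      linarith [hC (n+k), hpos k]
  have hle : ∀ n, v n ≤ 1 := by
    intro n
    by_contra! hn
    refine no_growth (C := C) hβ (sub_pos.2 hn) (fun k => ?_)
    have : ∃ m, β ^ k * (v n - 1) ≤ v m - 1 := by
      induction k with
      | zero => exact ⟨n, by simp⟩
      | succ k ih =>
        obtain ⟨m, hm⟩ := ih
        have hp : 0 < β ^ k * (v n - 1) := mul_pos (by positivity) (sub_pos.2 hn)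
        obtain ⟨m', hm'⟩ := hstep m (by linarith)
        refine ⟨m', le_trans ?_ hm'⟩
        rw [pow_succ, mul_comm (β ^ k), mul_assoc]
        exact mul_le_mul_of_nonneg_left hm (by linarith)
    obtain ⟨m, hm⟩ := this
    linarith [hC m]
  have hdig : ∀ n, qgDig β (v n) = γ n := by
    intro n
    have h1 := hrec n
    have h2 := hpos (n+1)
    have h3 := hle (n+1)
    have h4 := hγ n
    unfold qgDig
    rcases Nat.le_one_iff_eq_zero_or_eq_one.1 h4 with h | h
    · rw [h] at h1 ⊢
      push_cast at h1
      rw [if_neg (by linarith)]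
    · rw [h] at h1 ⊢
      push_cast at h1
      rw [if_pos (by linarith)]
  have horb : ∀ n, qgOrb β 1 n = v n := by
    intro n
    induction n with
    | zero => exact hv0.symm
    | succ n ih => rw [qgOrb, ih, hdig, hrec]
  funext n
  rw [horb, hdig]

lemma qg_left {β : ℝ} (hβ : 1 < β) (hβ2 : β ≤ 2) (k : ℕ) :
    Tendsto (fun q => qgOrb q 1 k) (𝓝[Set.Ioc 1 β] β) (𝓝 (qgOrb β 1 k)) ∧
    (∀ᶠ q in 𝓝[Set.Ioc 1 β] β, qgOrb q 1 k ≤ qgOrb β 1 k) ∧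
    (∀ᶠ q in 𝓝[Set.Ioc 1 β] β, ∀ i < k, qgDig q (qgOrb q 1 i) = qgDig β (qgOrb β 1 i)) := by
  have hmem : ∀ᶠ q in 𝓝[Set.Ioc 1 β] β, q ∈ Set.Ioc 1 β := self_mem_nhdsWithin
  have hid : Tendsto (fun q : ℝ => q) (𝓝[Set.Ioc 1 β] β) (𝓝 β) := tendsto_id.mono_left nhdsWithin_le_nhds
  induction k with
  | zero =>
    refine ⟨tendsto_const_nhds, Eventually.of_forall fun _ => le_rfl, Eventually.of_forall fun _ i hi => ?_⟩
    omega
  | succ k ih =>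
    obtain ⟨ht, hle, hd⟩ := ih
    have hm := qgOrb_mem hβ hβ2 one_pos le_rfl k
    have hmul : ∀ᶠ q in 𝓝[Set.Ioc 1 β] β, q * qgOrb q 1 k ≤ β * qgOrb β 1 k := by
      filter_upwards [hle, hmem] with q h1 h2
      have := qgOrb_mem h2.1 (h2.2.trans hβ2) one_pos le_rfl k
      exact mul_le_mul h2.2 h1 this.1.le (by linarith)
    have hdk : ∀ᶠ q in 𝓝[Set.Ioc 1 β] β, qgDig q (qgOrb q 1 k) = qgDig β (qgOrb β 1 k) := by
      unfold qgDig
      by_cases h : 1 < β * qgOrb β 1 k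
      · filter_upwards [(hid.mul ht).eventually (lt_mem_nhds h)] with q hq
        rw [if_pos h, if_pos hq]
      · filter_upwards [hmul] with q hq
        rw [if_neg h, if_neg (by linarith)]
    refine ⟨?_, ?_, ?_⟩
    · have := (hid.mul ht).sub_const (qgDig β (qgOrb β 1 k) : ℝ)
      refine this.congr' ?_
      filter_upwards [hdk] with q hq
      simp only [qgOrb, hq]
    · filter_upwards [hdk, hmul] with q hq h2
      simp only [qgOrb, hq]
      linarith
    · filter_upwards [hdk, hd] with q hq h2 i hi
      rcases Nat.lt_succ_iff_lt_or_eq.1 hi with h | rfl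
      · exact h2 i h
      · exact hq

theorem quasiGreedy_strictMono_bijection_leftContinuous :
    ∃ α : ℝ → ℕ → ℕ,
      (∀ β ∈ Set.Ioc (1 : ℝ) 2, isQuasiGreedy β (α β)) ∧
      -- strictly increasing
      (∀ β₁ ∈ Set.Ioc (1 : ℝ) 2, ∀ β₂ ∈ Set.Ioc (1 : ℝ) 2,
        β₁ < β₂ → lexLt (α β₁) (α β₂)) ∧
      -- bijection onto the set of self-dominated {0,1}-sequences not ending in 0^∞
      Set.BijOn α (Set.Ioc (1 : ℝ) 2)
        {γ : ℕ → ℕ | (∀ i, γ i ≤ 1) ∧ notEndZero γ ∧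
          ∀ n : ℕ, lexLe (fun i => γ (n + i)) γ} ∧
      -- left continuity with respect to the metric ρ((ε_i),(δ_i)) = 2^{-inf{j : ε_j ≠ δ_j}}:
      -- for every k, sequences for nearby smaller bases agree in the first k entries
      (∀ β ∈ Set.Ioc (1 : ℝ) 2, ∀ k : ℕ, ∃ δ > (0 : ℝ),
        ∀ q ∈ Set.Ioc (1 : ℝ) 2, β - δ < q → q ≤ β → ∀ i < k, α q i = α β i) := by
  refine ⟨fun β i => qgDig β (qgOrb β 1 i), fun β hβ => qg_isQuasiGreedy hβ.1 hβ.2, ?_, ?_, ?_⟩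
  · intro β₁ h1 β₂ h2 h
    exact qg_lexLt h1.1 h.le h2.2 one_pos le_rfl one_pos le_rfl (by linarith)
  · refine ⟨?_, ?_, ?_⟩
    · intro β hβ
      exact ⟨fun i => qgDig_le _ _, qg_notEndZero hβ.1 hβ.2, qg_self hβ.1 hβ.2⟩
    · intro β₁ h1 β₂ h2 h
      by_contra hne
      simp only at h
      rcases lt_or_gt_of_ne hne with hlt | hlt
      · have := qg_lexLt h1.1 hlt.le h2.2 one_pos le_rfl one_pos le_rfl (by linarith)
        rw [h] at this
        exact lexLt_irrefl _ this
      · have := qg_lexLt h2.1 hlt.le h1.2 one_pos le_rfl one_pos le_rfl (by linarith)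
        rw [h] at this
        exact lexLt_irrefl _ this
    · rintro γ ⟨h1, h2, h3⟩
      obtain ⟨β, hβ, hβ2, h⟩ := qg_surj h1 h2 h3
      exact ⟨β, ⟨hβ, hβ2⟩, h⟩
  · intro β hβ k
    have h := (qg_left hβ.1 hβ.2 k).2.2
    obtain ⟨δ, hδ, hs⟩ := Metric.mem_nhdsWithin_iff.1 h
    refine ⟨δ, hδ, fun q hq h1 h2 => hs ⟨?_, hq.1, h2⟩⟩
    rw [Metric.mem_ball, Real.dist_eq, abs_lt]
    constructor <;> linarith
end

section
/- Let β ∈ (1,2]. A sequence (ε_i) ∈ {0,1}^ℕ is the unique β-expansion of the number Σ_{i=1}^∞ ε_i β^{-i} (i.e., (ε_i) ∈ Ũ_β) if and only if for every n ≥ 1: ε_{n+1}ε_{n+2}⋯ ≺ α(β) whenever ε_n = 0, and ε_{n+1}ε_{n+2}⋯ ≻ \overline{α(β)} whenever ε_n = 1, where α(β) is the quasi-greedy β-expansion of 1 and \overline{α(β)} is its reflection. -/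
namespace Univ

/-- value of a sequence -/
noncomputable def V (β : ℝ) (s : ℕ → ℕ) : ℝ := ∑' i : ℕ, (s i : ℝ) / β ^ (i + 1)

/-- shift of a sequence -/
def sh (k : ℕ) (s : ℕ → ℕ) : ℕ → ℕ := fun i => s (k + i)

lemma sh_sh (k l : ℕ) (s : ℕ → ℕ) : sh l (sh k s) = sh (k + l) s := by
  funext i; simp [sh, add_assoc]

lemma sh_zero (s : ℕ → ℕ) : sh 0 s = s := by
  funext i; simp [sh]

lemma sh_le {s : ℕ → ℕ} (hs : ∀ i, s i ≤ 1) (k : ℕ) : ∀ i, sh k s i ≤ 1 := fun i => hs _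

lemma hasGeom {β : ℝ} (hβ : 1 < β) :
    HasSum (fun i : ℕ => (1 : ℝ) / β ^ (i + 1)) (1 / (β - 1)) := by
  have h0 : 0 < β := by linarith
  have h := (hasSum_geometric_of_lt_one (r := β⁻¹) (by positivity) (inv_lt_one_of_one_lt₀ hβ)).mul_left β⁻¹
  have e : β⁻¹ * (1 - β⁻¹)⁻¹ = 1 / (β - 1) := by
    have : β - 1 ≠ 0 := by linarith
    have h2 : (1 - β⁻¹) = (β - 1) / β := by field_simp
    rw [h2]; field_simp
  rw [e] at h
  have e2 : (fun i : ℕ => (1 : ℝ) / β ^ (i + 1)) = fun i => β⁻¹ * β⁻¹ ^ i := by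
    funext i
    rw [pow_succ, inv_pow]; field_simp
  rw [e2]; exact h

lemma summ {β : ℝ} (hβ : 1 < β) {s : ℕ → ℕ} (hs : ∀ i, s i ≤ 1) :
    Summable (fun i : ℕ => (s i : ℝ) / β ^ (i + 1)) := by
  have h0 : 0 < β := by linarith
  refine Summable.of_nonneg_of_le (fun i => by positivity) (fun i => ?_) (hasGeom hβ).summable
  have : (s i : ℝ) ≤ 1 := by exact_mod_cast hs i
  gcongr

lemma V_nonneg {β : ℝ} (hβ : 1 < β) (s : ℕ → ℕ) : 0 ≤ V β s :=
  tsum_nonneg (fun i => by have h0 : 0 < β := by linarith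
                           positivity)

lemma V_le {β : ℝ} (hβ : 1 < β) {s : ℕ → ℕ} (hs : ∀ i, s i ≤ 1) : V β s ≤ 1 / (β - 1) := by
  have h0 : 0 < β := by linarith
  rw [← (hasGeom hβ).tsum_eq]
  refine (summ hβ hs).tsum_le_tsum (fun i => ?_) (hasGeom hβ).summable
  have : (s i : ℝ) ≤ 1 := by exact_mod_cast hs i
  gcongr

lemma V_refl {β : ℝ} (hβ : 1 < β) {s : ℕ → ℕ} (hs : ∀ i, s i ≤ 1) :
    V β (fun i => 1 - s i) = 1 / (β - 1) - V β s := by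
  rw [← (hasGeom hβ).tsum_eq]
  unfold V
  rw [← (hasGeom hβ).summable.tsum_sub (summ hβ hs)]
  congr 1; funext i
  rw [Nat.cast_sub (hs i)]; push_cast; ring

lemma V_step {β : ℝ} (hβ : 1 < β) {s : ℕ → ℕ} (hs : ∀ i, s i ≤ 1) :
    β * V β s = s 0 + V β (sh 1 s) := by
  have h0 : 0 < β := by linarith
  unfold V
  rw [(summ hβ hs).tsum_eq_zero_add, mul_add, ← tsum_mul_left]
  congr 1
  · simp; field_simp
  · congr 1; funext i
    simp only [sh, add_comm 1 i]
    field_simp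
    ring

lemma V_step' {β : ℝ} (hβ : 1 < β) {s : ℕ → ℕ} (hs : ∀ i, s i ≤ 1) (n : ℕ) :
    β * V β (sh n s) = s n + V β (sh (n + 1) s) := by
  rw [V_step hβ (sh_le hs n), sh_sh]; simp [sh]

lemma V_diff {β : ℝ} (hβ : 1 < β) {a b : ℕ → ℕ} (ha : ∀ i, a i ≤ 1) (hb : ∀ i, b i ≤ 1)
    (k : ℕ) (h : ∀ i < k, a i = b i) :
    β ^ k * (V β a - V β b) = V β (sh k a) - V β (sh k b) := by
  induction k with
  | zero => simp [sh_zero]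
  | succ k ih =>
    have := ih (fun i hi => h i (by omega))
    have h1 := V_step' hβ ha k
    have h2 := V_step' hβ hb k
    rw [h k (by omega)] at h1
    rw [pow_succ]
    linear_combination β * this + h1 - h2

lemma V_pos {β : ℝ} (hβ : 1 < β) {s : ℕ → ℕ} (hs : ∀ i, s i ≤ 1) (hn : notEndZero s) (k : ℕ) :
    0 < V β (sh k s) := by
  have h0 : 0 < β := by linarith
  obtain ⟨m, hm, hne⟩ := hn k
  refine (summ hβ (sh_le hs k)).tsum_pos (fun i => by positivity) (m - k) ?_
  have : sh k s (m - k) = s m := by simp only [sh]; congr 1; omega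
  rw [this]
  have : 0 < s m := Nat.pos_of_ne_zero hne
  positivity

/-- orbit of quasi-greedy map -/
noncomputable def orb (β x : ℝ) : ℕ → ℝ
  | 0 => x
  | n + 1 => if 1 < β * orb β x n then β * orb β x n - 1 else β * orb β x n

open Classical in
/-- digits of quasi-greedy map -/
noncomputable def dig (β x : ℝ) (n : ℕ) : ℕ := if 1 < β * orb β x n then 1 else 0

lemma dig_le (β x : ℝ) (n : ℕ) : dig β x n ≤ 1 := by unfold dig; split_ifs <;> simp

lemma orb_succ (β x : ℝ) (n : ℕ) : β * orb β x n = dig β x n + orb β x (n + 1) := by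
  unfold dig
  rw [orb]; split_ifs <;> simp

lemma orb_mem {β x : ℝ} (hβ : 1 < β) (hβ2 : β ≤ 2) (hx : 0 < x) (hx' : x ≤ 1 / (β - 1)) (n : ℕ) :
    0 < orb β x n ∧ orb β x n ≤ 1 / (β - 1) := by
  have hb : 0 < β - 1 := by linarith
  induction n with
  | zero => exact ⟨hx, hx'⟩
  | succ n ih =>
    obtain ⟨h1, h2⟩ := ih
    rw [orb]
    rw [le_div_iff₀ hb] at h2 ⊢
    split_ifs with h
    · refine ⟨by linarith, by nlinarith⟩
    · refine ⟨by nlinarith, ?_⟩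
      push Not at h
      nlinarith

lemma exists_exp {β x : ℝ} (hβ : 1 < β) (hβ2 : β ≤ 2) (hx : 0 < x) (hx' : x ≤ 1 / (β - 1)) :
    ∃ d : ℕ → ℕ, (∀ i, d i ≤ 1) ∧ notEndZero d ∧ V β d = x := by
  have h0 : 0 < β := by linarith
  have hd := dig_le β x
  have hstep : ∀ n k, β ^ k * (V β (sh n (dig β x)) - orb β x n)
      = V β (sh (n + k) (dig β x)) - orb β x (n + k) := by
    intro n k
    induction k with
    | zero => simp
    | succ k ih =>
      have h1 := V_step' hβ hd (n + k)
      have h2 := orb_succ β x (n + k)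
      rw [pow_succ, ← add_assoc]
      linear_combination β * ih + h1 - h2
  have key : ∀ n, V β (sh n (dig β x)) = orb β x n := by
    intro n
    by_contra hne
    have hpos : 0 < |V β (sh n (dig β x)) - orb β x n| := abs_pos.mpr (sub_ne_zero.mpr hne)
    obtain ⟨k, hk⟩ := pow_unbounded_of_one_lt ((1 / (β - 1)) / |V β (sh n (dig β x)) - orb β x n|) hβ
    rw [div_lt_iff₀ hpos] at hk
    have : |β ^ k * (V β (sh n (dig β x)) - orb β x n)| ≤ 1 / (β - 1) := by
      rw [hstep]
      have a1 := V_nonneg hβ (sh (n + k) (dig β x))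
      have a2 := V_le hβ (sh_le hd (n + k))
      obtain ⟨a3, a4⟩ := orb_mem hβ hβ2 hx hx' (n + k)
      rw [abs_le]; constructor <;> linarith
    rw [abs_mul, abs_of_pos (by positivity : 0 < β ^ k)] at this
    linarith
  refine ⟨dig β x, hd, ?_, ?_⟩
  · intro n
    by_contra hcon
    push Not at hcon
    have : V β (sh n (dig β x)) = 0 := by
      unfold V
      have : ∀ i, sh n (dig β x) i = 0 := fun i => hcon (n + i) (by omega)
      simp [this]
    have h2 := (orb_mem hβ hβ2 hx hx' n).1
    rw [← key n] at h2
    linarith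
  · have := key 0
    simpa [sh_zero, orb] using this

/-- replace the digit at `n` by one and the rest by `d` -/
def splice (s : ℕ → ℕ) (n : ℕ) (d : ℕ → ℕ) : ℕ → ℕ :=
  fun i => if i < n then s i else if i = n then 1 else d (i - (n + 1))

lemma splice_le {s d : ℕ → ℕ} (hs : ∀ i, s i ≤ 1) (hd : ∀ i, d i ≤ 1) (n : ℕ) :
    ∀ i, splice s n d i ≤ 1 := by
  intro i; unfold splice; split_ifs
  · exact hs _
  · rfl
  · exact hd _

lemma splice_V {β : ℝ} (hβ : 1 < β) {s d : ℕ → ℕ} (hs : ∀ i, s i ≤ 1) (hd : ∀ i, d i ≤ 1) (n : ℕ)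
    (h0 : s n = 0) (h : V β d = V β (sh (n + 1) s) - 1) : V β (splice s n d) = V β s := by
  have hl := splice_le hs hd n
  have h1 := V_diff hβ hl hs n (fun i hi => by simp [splice, hi])
  have h2 := V_step' hβ hs n
  have h3 := V_step' hβ hl n
  have h4 : sh (n + 1) (splice s n d) = d := by
    funext i
    have a1 : ¬ (n + 1 + i < n) := by omega
    have a2 : ¬ (n + 1 + i = n) := by omega
    simp [sh, splice, a1, a2]
  have h5 : splice s n d n = 1 := by simp [splice]
  rw [h4, h5, h] at h3
  rw [h0] at h2
  push_cast at h2 h3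
  have hb : 0 < β := by linarith
  have h6 : V β (sh n (splice s n d)) = V β (sh n s) := by
    apply mul_left_cancel₀ hb.ne'
    linarith
  rw [h6, sub_self] at h1
  have : 0 < β ^ n := by positivity
  rcases mul_eq_zero.mp h1 with h | h <;> linarith

lemma tail_le {β : ℝ} (hβ : 1 < β) (hβ2 : β ≤ 2) {γ : ℕ → ℕ} (hγ : isQuasiGreedy β γ) (n : ℕ) :
    V β (sh n γ) ≤ 1 := by
  obtain ⟨hg, hne, h1, hmax⟩ := hγ
  induction n with
  | zero => exact le_of_eq (by simpa [sh_zero, V] using h1)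
  | succ n ih =>
    by_contra hcon
    push Not at hcon
    have hst := V_step' hβ hg n
    have hz : γ n = 0 := by
      rcases Nat.le_one_iff_eq_zero_or_eq_one.mp (hg n) with h | h
      · exact h
      · rw [h] at hst; push_cast at hst; nlinarith
    obtain ⟨d, hd, hdn, hdV⟩ := exists_exp (x := V β (sh (n + 1) γ) - 1) hβ hβ2 (by linarith)
      (by have := V_le hβ (sh_le hg (n + 1)); linarith)
    have hV := splice_V hβ hg hd n hz hdV
    have hle := hmax (splice γ n d) (splice_le hg hd n) (by
      intro N
      obtain ⟨m, hm, hm'⟩ := hdn N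
      refine ⟨n + 1 + m, by omega, ?_⟩
      have a1 : ¬ (n + 1 + m < n) := by omega
      have a2 : ¬ (n + 1 + m = n) := by omega
      simpa [splice, a1, a2] using hm') (hV.trans h1)
    have hn1 : splice γ n d n = 1 := by simp [splice]
    have hpre : ∀ i < n, splice γ n d i = γ i := fun i hi => by simp [splice, hi]
    rcases hle with ⟨k, hk, hlt⟩ | h
    · rcases lt_trichotomy k n with h | h | h
      · rw [hpre k h] at hlt; omega
      · subst h; omega
      · have := hk n h; omega
    · rw [h] at hn1; omega

lemma lex_total (a b : ℕ → ℕ) (h : ¬ lexLt a b) : lexLt b a ∨ a = b := by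
  classical
  by_cases hab : a = b
  · exact Or.inr hab
  · left
    have hex : ∃ n, a n ≠ b n := by
      by_contra hc; push Not at hc; exact hab (funext hc)
    have hmin : ∀ i < Nat.find hex, a i = b i := fun i hi => by
      have := Nat.find_min hex hi; push Not at this; exact this
    refine ⟨Nat.find hex, fun i hi => (hmin i hi).symm, ?_⟩
    have hne := Nat.find_spec hex
    by_contra hc
    exact h ⟨Nat.find hex, hmin, by omega⟩

lemma forward {β : ℝ} (hβ : 1 < β) (hβ2 : β ≤ 2) {γ : ℕ → ℕ} (hγ : isQuasiGreedy β γ)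
    {ε : ℕ → ℕ} (hε : ∀ i, ε i ≤ 1)
    (hu : ∀ δ : ℕ → ℕ, (∀ i, δ i ≤ 1) → V β δ = V β ε → δ = ε) (n : ℕ) (hn : ε n = 0) :
    lexLt (sh (n + 1) ε) γ := by
  by_contra hcon
  have hg1 : V β γ = 1 := hγ.2.2.1
  have hge : 1 ≤ V β (sh (n + 1) ε) := by
    rcases lex_total _ _ hcon with ⟨k, hk, hlt⟩ | h
    · have hd := V_diff hβ hγ.1 (sh_le hε (n + 1)) k hk
      have s1 := V_step' hβ hγ.1 k
      have s2 := V_step' hβ (sh_le hε (n + 1)) k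
      have e1 := sh_le hε (n + 1) k
      have z1 : γ k = 0 := by omega
      have z2 : sh (n + 1) ε k = 1 := by omega
      rw [z1] at s1; rw [z2] at s2
      push_cast at s1 s2
      have t1 := tail_le hβ hβ2 hγ (k + 1)
      have t2 := V_nonneg hβ (sh (k + 1) (sh (n + 1) ε))
      have hb : 0 < β := by linarith
      have hp : 0 < β ^ k := by positivity
      by_contra hc
      push Not at hc
      have p1 : 0 < β ^ k * (V β γ - V β (sh (n + 1) ε)) := mul_pos hp (by linarith)
      rw [hd] at p1
      have := mul_pos hb p1
      linarith
    · rw [h, hg1]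
  obtain ⟨d, hd, hdV⟩ : ∃ d : ℕ → ℕ, (∀ i, d i ≤ 1) ∧ V β d = V β (sh (n + 1) ε) - 1 := by
    rcases hge.eq_or_lt with h | h
    · exact ⟨fun _ => 0, by simp, by rw [← h]; simp [V]⟩
    · obtain ⟨d, h1, _, h2⟩ := exists_exp (x := V β (sh (n + 1) ε) - 1) hβ hβ2 (by linarith)
        (by have := V_le hβ (sh_le hε (n + 1)); linarith)
      exact ⟨d, h1, h2⟩
  have := hu _ (splice_le hε hd n) (splice_V hβ hε hd n hn hdV)
  have h1 : splice ε n d n = 1 := by simp [splice]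
  rw [this] at h1; omega

lemma backward {β : ℝ} (hβ : 1 < β) {γ : ℕ → ℕ} (hγ : isQuasiGreedy β γ)
    {ε : ℕ → ℕ} (hε : ∀ i, ε i ≤ 1)
    (hl : ∀ n, ε n = 0 → lexLt (sh (n + 1) ε) γ) (n : ℕ) (hn : ε n = 0) :
    V β (sh (n + 1) ε) < 1 := by
  have hg1 : V β γ = 1 := hγ.2.2.1
  have hb : 0 < β := by linarith
  have step : ∀ m, ε m = 0 → 0 ≤ V β (sh (m + 1) ε) - 1 → ∃ m', ε m' = 0 ∧
      β * (V β (sh (m + 1) ε) - 1) < V β (sh (m' + 1) ε) - 1 := by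
    intro m hm h0
    obtain ⟨k, hk, hlt⟩ := hl m hm
    have hd := V_diff hβ (sh_le hε (m + 1)) hγ.1 k hk
    have s1 := V_step' hβ hγ.1 k
    have s2 := V_step' hβ (sh_le hε (m + 1)) k
    have e1 := hγ.1 k
    have z1 : γ k = 1 := by omega
    have z2 : sh (m + 1) ε k = 0 := by omega
    rw [z1] at s1; rw [z2, sh_sh, sh_sh] at s2
    push_cast at s1 s2
    refine ⟨m + 1 + k, z2, ?_⟩
    have t1 := V_pos hβ hγ.1 hγ.2.1 (k + 1)
    have p1 : 1 ≤ β ^ k := one_le_pow₀ hβ.le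
    rw [hg1, sh_sh] at hd
    have : V β (sh (m + 1) ε) - 1 ≤ β ^ k * (V β (sh (m + 1) ε) - 1) := le_mul_of_one_le_left h0 p1
    rw [hd] at this
    have := mul_le_mul_of_nonneg_left this hb.le
    rw [show m + 1 + k + 1 = m + 1 + (k + 1) by ring]
    linarith
  by_contra hcon
  push Not at hcon
  obtain ⟨m, hm, hm'⟩ := step n hn (by linarith)
  have hc : 0 < V β (sh (m + 1) ε) - 1 := lt_of_le_of_lt (mul_nonneg hb.le (by linarith)) hm'
  have grow : ∀ j : ℕ, ∃ q, ε q = 0 ∧ β ^ j * (V β (sh (m + 1) ε) - 1) ≤ V β (sh (q + 1) ε) - 1 := by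
    intro j
    induction j with
    | zero => exact ⟨m, hm, by simp⟩
    | succ j ih =>
      obtain ⟨q, hq, hq'⟩ := ih
      have : 0 ≤ β ^ j * (V β (sh (m + 1) ε) - 1) := by positivity
      obtain ⟨r, hr, hr'⟩ := step q hq (by linarith)
      refine ⟨r, hr, ?_⟩
      have := mul_le_mul_of_nonneg_left hq' hb.le
      rw [pow_succ]
      linarith
  obtain ⟨j, hj⟩ := pow_unbounded_of_one_lt ((1 / (β - 1)) / (V β (sh (m + 1) ε) - 1)) hβ
  rw [div_lt_iff₀ hc] at hj
  obtain ⟨q, _, hq⟩ := grow j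
  have := V_le hβ (sh_le hε (q + 1))
  linarith

lemma no_above {β : ℝ} (hβ : 1 < β) {γ : ℕ → ℕ} (hγ : isQuasiGreedy β γ)
    {ε : ℕ → ℕ} (hε : ∀ i, ε i ≤ 1)
    (hl : ∀ n, ε n = 0 → lexLt (sh (n + 1) ε) γ)
    {δ : ℕ → ℕ} (hδ : ∀ i, δ i ≤ 1) (hV : V β δ = V β ε) : ¬ lexLt ε δ := by
  rintro ⟨k, hk, hlt⟩
  have e1 := hδ k
  have z1 : δ k = 1 := by omega
  have z2 : ε k = 0 := by omega
  have hd := V_diff hβ hε hδ k hk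
  have s1 := V_step' hβ hδ k
  have s2 := V_step' hβ hε k
  rw [z1] at s1; rw [z2] at s2
  push_cast at s1 s2
  rw [hV, sub_self, mul_zero] at hd
  have h1 := backward hβ hγ hε hl k z2
  have h2 := V_nonneg hβ (sh (k + 1) δ)
  have : V β (sh k ε) = V β (sh k δ) := by linarith
  rw [this] at s2
  linarith

lemma lexLt_refl {a b : ℕ → ℕ} (ha : ∀ i, a i ≤ 1) (hb : ∀ i, b i ≤ 1)
    (h : lexLt (fun i => 1 - a i) b) : lexLt (fun i => 1 - b i) a := by
  obtain ⟨k, hk, hlt⟩ := h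
  refine ⟨k, fun i hi => ?_, ?_⟩
  · have := hk i hi; have := ha i; have := hb i; simp only at *; omega
  · have := ha k; have := hb k; simp only at *; omega

lemma refl_refl {a : ℕ → ℕ} (ha : ∀ i, a i ≤ 1) : (fun i => 1 - (1 - a i)) = a := by
  funext i; have := ha i; omega

end Univ

open Univ in
theorem univoque_lexicographic_characterization
    (β : ℝ) (hβ : β ∈ Set.Ioc (1 : ℝ) 2)
    (γ : ℕ → ℕ) (hγ : isQuasiGreedy β γ)
    (ε : ℕ → ℕ) (hε : ∀ i, ε i ≤ 1) :
    -- ε is the unique β-expansion of its value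
    (∀ δ : ℕ → ℕ, (∀ i, δ i ≤ 1) →
        (∑' i : ℕ, (δ i : ℝ) / β ^ (i + 1)) = (∑' i : ℕ, (ε i : ℝ) / β ^ (i + 1)) →
        δ = ε) ↔
    -- iff lexicographic conditions: the tail after each 0 is ≺ α(β), and the
    -- tail after each 1 is ≻ reflection of α(β)
    (∀ n : ℕ,
      (ε n = 0 → lexLt (fun i => ε (n + 1 + i)) γ) ∧
      (ε n = 1 → lexLt (fun i => 1 - γ i) (fun i => ε (n + 1 + i)))) := by
  obtain ⟨h1, h2⟩ := hβ
  have hr : ∀ i, (fun i => 1 - ε i) i ≤ 1 := fun i => by simp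
  constructor
  · intro hu n
    refine ⟨fun hn => forward h1 h2 hγ hε hu n hn, fun hn => ?_⟩
    have hu' : ∀ δ : ℕ → ℕ, (∀ i, δ i ≤ 1) → V β δ = V β (fun i => 1 - ε i) →
        δ = (fun i => 1 - ε i) := by
      intro δ hδ hV
      have := hu (fun i => 1 - δ i) (fun i => by simp) (by
        change V β _ = V β ε
        rw [V_refl h1 hδ, hV, V_refl h1 hε]; ring)
      rw [← this, refl_refl hδ]
    have := forward h1 h2 hγ hr hu' n (by simp [hn])
    exact lexLt_refl (sh_le hε (n + 1)) hγ.1 this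
  · intro hl δ hδ hV
    change V β δ = V β ε at hV
    have a1 := no_above h1 hγ hε (fun n hn => (hl n).1 hn) hδ hV
    have a2 := no_above h1 hγ hr (fun n hn => by
      have h3 := hε n
      have h4 : ε n = 1 := by omega
      exact lexLt_refl hγ.1 (sh_le hε (n + 1)) ((hl n).2 h4))
      (δ := fun i => 1 - δ i) (fun i => by simp)
      (by rw [V_refl h1 hδ, hV, V_refl h1 hε])
    rcases lex_total _ _ a1 with h | h
    · exact absurd (by
        obtain ⟨k, hk, hlt⟩ := h
        refine ⟨k, fun i hi => by simp [hk i hi], ?_⟩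
        have := hε k
        simp only; omega) a2
    · exact h.symm
end
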